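/- arXiv:2109.10887 — 3 statements merged into one kernel-verified Lean document; each statement's English description precedes it below -/
import Mathlib

section
/- Fix α, β ∈ ℝ. For every x ∈ (−1,1), lim_{N→∞} N · Σ_{n=N+1}^∞ [n!·(2n+α+β+1)·Γ(n+α+β+1) / (2^{α+β+1}·Γ(n+α+1)·Γ(n+β+1))] · P_n^{(α,β)}(x)² / (n(n+α+β+1)) = (1−x)^{−α−1/2}·(1+x)^{−β−1/2} / π. Moreover, for all x, y ∈ (−1,1) with x ≠ y and every real γ < 2, lim_{N→∞} N^γ · Σ_{n=N+1}^∞ [n!·(2n+α+β+1)·Γ(n+α+β+1) / (2^{α+β+1}·Γ(n+α+1)·Γ(n+β+1))] · P_n^{(α,β)}(x)·P_n^{(α,β)}(y) / (n(n+α+β+1)) = 0. (The sums are over those n for which all Gamma factors are defined, i.e. over all sufficiently large n.) -/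
open Filter Topology

/-- The Jacobi polynomials `P_n^{(α,β)}`, defined for arbitrary real parameters via the
rising Pochhammer symbol. -/
noncomputable def jacobiP (α β : ℝ) (n : ℕ) (x : ℝ) : ℝ :=
  (1 / (n.factorial : ℝ)) *
    ∑ k ∈ Finset.range (n + 1),
      (n.choose k : ℝ) * (ascPochhammer ℝ k).eval ((n : ℝ) + α + β + 1) *
        (ascPochhammer ℝ (n - k)).eval (α + (k : ℝ) + 1) * ((x - 1) / 2) ^ k

namespace JacobiAux

/-- coefficients of the Jacobi polynomial in powers of `(x-1)/2` -/
noncomputable def cf (α β : ℝ) (n k : ℕ) : ℝ :=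
  (1 / (n.factorial : ℝ)) * ((n.choose k : ℝ) * (ascPochhammer ℝ k).eval ((n : ℝ) + α + β + 1) *
        (ascPochhammer ℝ (n - k)).eval (α + (k : ℝ) + 1))

noncomputable def qp (α β : ℝ) (n : ℕ) : Polynomial ℝ :=
  ∑ k ∈ Finset.range (n + 1), Polynomial.C (cf α β n k) * Polynomial.X ^ k

lemma cf_zero_of_lt (α β : ℝ) {n k : ℕ} (h : n < k) : cf α β n k = 0 := by
  simp [cf, Nat.choose_eq_zero_of_lt h]

lemma qp_coeff (α β : ℝ) (n k : ℕ) : (qp α β n).coeff k = cf α β n k := by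
  simp only [qp, Polynomial.finsetSum_coeff, Polynomial.coeff_C_mul, Polynomial.coeff_X_pow]
  by_cases h : k < n + 1
  · simp [Finset.sum_ite_eq, h]
  · rw [cf_zero_of_lt α β (by omega)]
    simp [Finset.sum_ite_eq]; omega

lemma jacobiP_eq (α β : ℝ) (n : ℕ) (x : ℝ) :
    jacobiP α β n x = (qp α β n).eval ((x - 1) / 2) := by
  simp only [jacobiP, qp, Polynomial.eval_finsetSum, cf, Finset.mul_sum]
  refine Finset.sum_congr rfl fun k _ => ?_
  simp; ring

lemma cf_eq (α β : ℝ) (k j : ℕ) : cf α β (k + j) k =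
    (ascPochhammer ℝ k).eval ((k : ℝ) + j + α + β + 1) * (ascPochhammer ℝ j).eval (α + (k : ℝ) + 1)
      / (k.factorial * j.factorial) := by
  have h : (((k + j).choose k : ℕ) : ℝ) * k.factorial * j.factorial = (k + j).factorial := by
    have := Nat.add_choose_mul_factorial_mul_factorial k j
    rw [Nat.choose_symm_add] at *
    exact_mod_cast this
  have h1 : (k.factorial : ℝ) ≠ 0 := by exact_mod_cast k.factorial_ne_zero
  have h2 : (j.factorial : ℝ) ≠ 0 := by exact_mod_cast j.factorial_ne_zero
  have h3 : ((k + j).factorial : ℝ) ≠ 0 := by exact_mod_cast (k + j).factorial_ne_zero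
  simp only [cf, Nat.add_sub_cancel_left]
  push_cast
  field_simp
  rw [← h]; ring

lemma asc_left (k : ℕ) (z : ℝ) : (ascPochhammer ℝ (k + 1)).eval z =
    z * (ascPochhammer ℝ k).eval (z + 1) := by
  rw [ascPochhammer_succ_left]; simp

lemma asc_right (k : ℕ) (z : ℝ) : (ascPochhammer ℝ (k + 1)).eval z =
    (ascPochhammer ℝ k).eval z * (z + k) := ascPochhammer_succ_eval k z

lemma asc_shift (k : ℕ) (z : ℝ) : z * (ascPochhammer ℝ k).eval (z + 1) =
    (ascPochhammer ℝ k).eval z * (z + k) := by rw [← asc_left, asc_right]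

lemma fac_succ (k : ℕ) : (((k + 1).factorial : ℕ) : ℝ) = (k + 1) * k.factorial := by
  push_cast [Nat.factorial_succ]; ring

lemma cf_R1 (α β : ℝ) (n k : ℕ) :
    (2 * ((n : ℝ) + 1) + α + β + 1) * cf α β (n + 1) k =
      ((n : ℝ) + 1 + α + β + 1) * cf (α + 1) β (n + 1) k - (n + 1 + β) * cf (α + 1) β n k := by
  rcases Nat.lt_or_ge (n + 1) k with h | h
  · rw [cf_zero_of_lt _ _ h, cf_zero_of_lt _ _ h, cf_zero_of_lt _ _ (by omega)]; ring
  rcases Nat.lt_or_ge n k with h' | h'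
  · obtain rfl : k = n + 1 := by omega
    rw [cf_zero_of_lt _ _ h']
    have e1 := cf_eq α β (n + 1) 0
    have e2 := cf_eq (α + 1) β (n + 1) 0
    simp only [add_zero] at e1 e2
    rw [e1, e2]
    have h1 : ((n + 1).factorial : ℝ) ≠ 0 := by exact_mod_cast (n + 1).factorial_ne_zero
    have := asc_shift (n + 1) ((n : ℝ) + 1 + α + β + 1)
    push_cast at this ⊢
    simp only [ascPochhammer_zero, Polynomial.eval_one, Nat.factorial_zero, Nat.cast_one, add_zero]
    rw [show (n : ℝ) + 1 + (α + 1) + β + 1 = (n : ℝ) + 1 + α + β + 1 + 1 by ring]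
    field_simp
    linear_combination -this
  · obtain ⟨j, rfl⟩ := Nat.exists_eq_add_of_le h'
    rw [add_assoc k j 1, cf_eq, cf_eq, cf_eq]
    have h1 : (k.factorial : ℝ) ≠ 0 := by exact_mod_cast k.factorial_ne_zero
    have h2 : (j.factorial : ℝ) ≠ 0 := by exact_mod_cast j.factorial_ne_zero
    have h3 : (j : ℝ) + 1 ≠ 0 := by positivity
    have e1 := asc_shift k ((k : ℝ) + j + 1 + α + β + 1)
    have e2 := asc_left j (α + (k : ℝ) + 1)
    have e3 := asc_right j (α + 1 + (k : ℝ) + 1)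
    rw [fac_succ, e2, e3]
    push_cast
    rw [show (k : ℝ) + (j + 1) + (α + 1) + β + 1 = (k : ℝ) + j + 1 + α + β + 1 + 1 by ring,
      show (k : ℝ) + (j + 1) + α + β + 1 = (k : ℝ) + j + 1 + α + β + 1 by ring,
      show (k : ℝ) + j + (α + 1) + β + 1 = (k : ℝ) + j + 1 + α + β + 1 by ring,
      show α + 1 + (k : ℝ) + 1 = α + k + 1 + 1 by ring]
    set B := (ascPochhammer ℝ j).eval (α + (k : ℝ) + 1 + 1)
    field_simp
    linear_combination (-(B * (α + 1 + 1 + k + j))) * e1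

lemma cf_R3 (α β : ℝ) (n k : ℕ) :
    (2 * ((n : ℝ) + 1) + α + β + 1) * cf α β (n + 1) k =
      ((n : ℝ) + 1 + α + β + 1) * cf α (β + 1) (n + 1) k + (n + 1 + α) * cf α (β + 1) n k := by
  rcases Nat.lt_or_ge (n + 1) k with h | h
  · rw [cf_zero_of_lt _ _ h, cf_zero_of_lt _ _ h, cf_zero_of_lt _ _ (by omega)]; ring
  rcases Nat.lt_or_ge n k with h' | h'
  · obtain rfl : k = n + 1 := by omega
    rw [cf_zero_of_lt _ _ h']
    have e1 := cf_eq α β (n + 1) 0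
    have e2 := cf_eq α (β + 1) (n + 1) 0
    simp only [add_zero] at e1 e2
    rw [e1, e2]
    have h1 : ((n + 1).factorial : ℝ) ≠ 0 := by exact_mod_cast (n + 1).factorial_ne_zero
    have := asc_shift (n + 1) ((n : ℝ) + 1 + α + β + 1)
    push_cast at this ⊢
    simp only [ascPochhammer_zero, Polynomial.eval_one, Nat.factorial_zero, Nat.cast_one, add_zero]
    rw [show (n : ℝ) + 1 + α + (β + 1) + 1 = (n : ℝ) + 1 + α + β + 1 + 1 by ring]
    field_simp
    linear_combination -this
  · obtain ⟨j, rfl⟩ := Nat.exists_eq_add_of_le h'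
    rw [add_assoc k j 1, cf_eq, cf_eq, cf_eq]
    have h1 : (k.factorial : ℝ) ≠ 0 := by exact_mod_cast k.factorial_ne_zero
    have h2 : (j.factorial : ℝ) ≠ 0 := by exact_mod_cast j.factorial_ne_zero
    have h3 : (j : ℝ) + 1 ≠ 0 := by positivity
    have e1 := asc_shift k ((k : ℝ) + j + 1 + α + β + 1)
    have e2 := asc_right j (α + (k : ℝ) + 1)
    rw [fac_succ, e2]
    push_cast
    rw [show (k : ℝ) + (j + 1) + α + (β + 1) + 1 = (k : ℝ) + j + 1 + α + β + 1 + 1 by ring,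
      show (k : ℝ) + (j + 1) + α + β + 1 = (k : ℝ) + j + 1 + α + β + 1 by ring,
      show (k : ℝ) + j + α + (β + 1) + 1 = (k : ℝ) + j + 1 + α + β + 1 by ring]
    set B := (ascPochhammer ℝ j).eval (α + (k : ℝ) + 1)
    field_simp
    linear_combination (-(B * (α + 1 + k + j))) * e1

lemma cf_R2_zero (α β : ℝ) (n : ℕ) :
    0 = ((n : ℝ) + α + 1) * cf α β n 0 - (n + 1) * cf α β (n + 1) 0 := by
  have e1 := cf_eq α β 0 n
  have e2 := cf_eq α β 0 (n + 1)
  simp only [zero_add] at e1 e2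
  rw [e1, e2]
  have h2 : (n.factorial : ℝ) ≠ 0 := by exact_mod_cast n.factorial_ne_zero
  have h3 : (n : ℝ) + 1 ≠ 0 := by positivity
  rw [fac_succ, asc_right]
  push_cast
  simp only [ascPochhammer_zero, Polynomial.eval_one, Nat.factorial_zero, Nat.cast_one, add_zero]
  field_simp
  ring

lemma cf_R2_succ (α β : ℝ) (n k : ℕ) :
    -(2 * (n : ℝ) + α + β + 2) * cf (α + 1) β n k =
      ((n : ℝ) + α + 1) * cf α β n (k + 1) - (n + 1) * cf α β (n + 1) (k + 1) := by
  rcases Nat.lt_or_ge n k with h | h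
  · rw [cf_zero_of_lt _ _ h, cf_zero_of_lt _ _ (by omega), cf_zero_of_lt _ _ (by omega)]; ring
  rcases Nat.lt_or_ge n (k + 1) with h' | h'
  · obtain rfl : n = k := by omega
    rw [cf_zero_of_lt _ _ h']
    have e1 := cf_eq α β (n + 1) 0
    have e2 := cf_eq (α + 1) β n 0
    simp only [add_zero] at e1 e2
    rw [e1, e2]
    have h1 : (n.factorial : ℝ) ≠ 0 := by exact_mod_cast n.factorial_ne_zero
    have h3 : (n : ℝ) + 1 ≠ 0 := by positivity
    have e3 := asc_right n ((n : ℝ) + 1 + α + β + 1)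
    rw [fac_succ]
    push_cast
    simp only [ascPochhammer_zero, Polynomial.eval_one, Nat.factorial_zero, Nat.cast_one, add_zero]
    rw [e3, show (n : ℝ) + (α + 1) + β + 1 = (n : ℝ) + 1 + α + β + 1 by ring]
    field_simp
    ring
  · obtain ⟨j, rfl⟩ := Nat.exists_eq_add_of_le h'
    have e0 := cf_eq (α + 1) β k (j + 1)
    rw [show k + (j + 1) = k + 1 + j by ring] at e0
    rw [e0, add_assoc (k + 1) j 1, cf_eq, cf_eq]
    have h1 : (k.factorial : ℝ) ≠ 0 := by exact_mod_cast k.factorial_ne_zero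
    have h2 : (j.factorial : ℝ) ≠ 0 := by exact_mod_cast j.factorial_ne_zero
    have h3 : (j : ℝ) + 1 ≠ 0 := by positivity
    have h4 : (k : ℝ) + 1 ≠ 0 := by positivity
    have e1 := asc_left k ((k : ℝ) + 1 + j + α + β + 1)
    have e2 := asc_right j (α + (k : ℝ) + 1 + 1)
    have e3 := asc_right k ((k : ℝ) + 1 + j + α + β + 1 + 1)
    rw [fac_succ, fac_succ]
    push_cast
    rw [show α + ((k : ℝ) + 1) + 1 = α + (k : ℝ) + 1 + 1 by ring,
      show α + 1 + (k : ℝ) + 1 = α + (k : ℝ) + 1 + 1 by ring,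
      show (k : ℝ) + 1 + (j + 1) + α + β + 1 = (k : ℝ) + 1 + j + α + β + 1 + 1 by ring,
      show (k : ℝ) + (j + 1) + (α + 1) + β + 1 = (k : ℝ) + 1 + j + α + β + 1 + 1 by ring,
      e1, e2, e3]
    field_simp
    ring

lemma R1 (α β : ℝ) (n : ℕ) (x : ℝ) :
    (2 * ((n : ℝ) + 1) + α + β + 1) * jacobiP α β (n + 1) x =
      ((n : ℝ) + 1 + α + β + 1) * jacobiP (α + 1) β (n + 1) x
        - (n + 1 + β) * jacobiP (α + 1) β n x := by
  have : Polynomial.C (2 * ((n : ℝ) + 1) + α + β + 1) * qp α β (n + 1) =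
      Polynomial.C ((n : ℝ) + 1 + α + β + 1) * qp (α + 1) β (n + 1)
        - Polynomial.C ((n : ℝ) + 1 + β) * qp (α + 1) β n := by
    ext k
    simp only [Polynomial.coeff_C_mul, Polynomial.coeff_sub, qp_coeff]
    exact cf_R1 α β n k
  have := congrArg (Polynomial.eval ((x - 1) / 2)) this
  simpa only [jacobiP_eq, Polynomial.eval_mul, Polynomial.eval_sub, Polynomial.eval_C] using this

lemma R3 (α β : ℝ) (n : ℕ) (x : ℝ) :
    (2 * ((n : ℝ) + 1) + α + β + 1) * jacobiP α β (n + 1) x =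
      ((n : ℝ) + 1 + α + β + 1) * jacobiP α (β + 1) (n + 1) x
        + (n + 1 + α) * jacobiP α (β + 1) n x := by
  have : Polynomial.C (2 * ((n : ℝ) + 1) + α + β + 1) * qp α β (n + 1) =
      Polynomial.C ((n : ℝ) + 1 + α + β + 1) * qp α (β + 1) (n + 1)
        + Polynomial.C ((n : ℝ) + 1 + α) * qp α (β + 1) n := by
    ext k
    simp only [Polynomial.coeff_C_mul, Polynomial.coeff_add, qp_coeff]
    exact cf_R3 α β n k
  have := congrArg (Polynomial.eval ((x - 1) / 2)) this
  simpa only [jacobiP_eq, Polynomial.eval_mul, Polynomial.eval_add, Polynomial.eval_C] using this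

lemma R2 (α β : ℝ) (n : ℕ) (x : ℝ) :
    (1 - x) / 2 * ((2 * (n : ℝ) + α + β + 2) * jacobiP (α + 1) β n x) =
      ((n : ℝ) + α + 1) * jacobiP α β n x - (n + 1) * jacobiP α β (n + 1) x := by
  have : Polynomial.X * (Polynomial.C (-(2 * (n : ℝ) + α + β + 2)) * qp (α + 1) β n) =
      Polynomial.C ((n : ℝ) + α + 1) * qp α β n
        - Polynomial.C ((n : ℝ) + 1) * qp α β (n + 1) := by
    ext k
    cases k with
    | zero =>
      simp only [Polynomial.coeff_C_mul, Polynomial.coeff_sub, qp_coeff, Polynomial.coeff_X_mul_zero]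
      exact cf_R2_zero α β n
    | succ k =>
      simp only [Polynomial.coeff_C_mul, Polynomial.coeff_sub, qp_coeff, Polynomial.coeff_X_mul]
      exact cf_R2_succ α β n k
  have := congrArg (Polynomial.eval ((x - 1) / 2)) this
  simp only [Polynomial.eval_mul, Polynomial.eval_sub, Polynomial.eval_C,
    Polynomial.eval_X, ← jacobiP_eq] at this
  linear_combination this

/-- three term recurrence -/
lemma three_term (α β : ℝ) (n : ℕ) (x : ℝ) :
    (1 - x) / 2 * ((2 * (n : ℝ) + α + β + 2) * (2 * n + α + β + 3) * (2 * n + α + β + 4)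
        * jacobiP α β (n + 1) x) =
      (2 * n + α + β + 2) * (n + α + β + 2) *
        ((n + α + 2) * jacobiP α β (n + 1) x - (n + 2) * jacobiP α β (n + 2) x)
      - (2 * n + α + β + 4) * (n + 1 + β) *
        ((n + α + 1) * jacobiP α β n x - (n + 1) * jacobiP α β (n + 1) x) := by
  have h1 := R1 α β n x
  have h2 := R2 α β n x
  have h3 := R2 α β (n + 1) x
  push_cast at h3
  linear_combination (1 - x) / 2 * (2 * (n : ℝ) + α + β + 2) * (2 * n + α + β + 4) * h1 +
    (2 * (n : ℝ) + α + β + 2) * (n + α + β + 2) * h3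
    - (2 * n + α + β + 4) * (n + 1 + β) * h2

lemma jacobiP_zero (α β x : ℝ) : jacobiP α β 0 x = 1 := by simp [jacobiP]

lemma jacobiP_one (α β x : ℝ) : jacobiP α β 1 x = (α + 1) + (α + β + 2) * ((x - 1) / 2) := by
  simp only [jacobiP, Finset.sum_range_succ, Finset.sum_range_zero]
  simp
  rw [show (1 : ℝ) + α + β + 1 = α + β + 2 by ring]
  exact Or.inl rfl

lemma cf_ode (α β : ℝ) (n k : ℕ) :
    cf α β n (k + 1) * ((k : ℝ) + 1) * (k + α + 1) =
      ((n : ℝ) - k) * (n + k + α + β + 1) * cf α β n k := by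
  rcases Nat.lt_or_ge n k with h | h
  · rw [cf_zero_of_lt _ _ h, cf_zero_of_lt _ _ (by omega)]; ring
  rcases Nat.lt_or_ge n (k + 1) with h' | h'
  · obtain rfl : n = k := by omega
    rw [cf_zero_of_lt _ _ h']; ring
  · obtain ⟨j, rfl⟩ := Nat.exists_eq_add_of_le h'
    have e0 := cf_eq α β k (j + 1)
    rw [show k + (j + 1) = k + 1 + j by ring] at e0
    rw [e0, cf_eq]
    have h1 : (k.factorial : ℝ) ≠ 0 := by exact_mod_cast k.factorial_ne_zero
    have h2 : (j.factorial : ℝ) ≠ 0 := by exact_mod_cast j.factorial_ne_zero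
    have h3 : (j : ℝ) + 1 ≠ 0 := by positivity
    have h4 : (k : ℝ) + 1 ≠ 0 := by positivity
    have e1 := asc_right k ((k : ℝ) + 1 + j + α + β + 1)
    have e2 := asc_left j (α + (k : ℝ) + 1)
    rw [fac_succ, fac_succ]
    push_cast
    rw [show α + ((k : ℝ) + 1) + 1 = α + (k : ℝ) + 1 + 1 by ring,
      show (k : ℝ) + (j + 1) + α + β + 1 = (k : ℝ) + 1 + j + α + β + 1 by ring,
      e1, e2]
    field_simp
    ring

lemma qp_ode (α β : ℝ) (n : ℕ) :
    Polynomial.X * (1 + Polynomial.X) * Polynomial.derivative (Polynomial.derivative (qp α β n))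
     + (Polynomial.C (α + 1) + Polynomial.C (α + β + 2) * Polynomial.X)
        * Polynomial.derivative (qp α β n)
     = Polynomial.C ((n : ℝ) * (n + α + β + 1)) * qp α β n := by
  ext k
  rcases k with _ | _ | k
  · have := cf_ode α β n 0
    simp [mul_add, add_mul, mul_assoc, Polynomial.coeff_derivative, qp_coeff, Polynomial.coeff_X_mul] at this ⊢
    linear_combination this
  · have := cf_ode α β n 1
    simp [mul_add, add_mul, mul_assoc, Polynomial.coeff_derivative, qp_coeff, Polynomial.coeff_X_mul, Polynomial.coeff_C_mul] at this ⊢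
    linear_combination this
  · have := cf_ode α β n (k + 2)
    simp [mul_add, add_mul, mul_assoc, Polynomial.coeff_derivative, qp_coeff, Polynomial.coeff_X_mul, Polynomial.coeff_C_mul] at this ⊢
    linear_combination this

end JacobiAux

namespace JacobiAux

noncomputable def KK (α β : ℝ) (n : ℕ) : ℝ :=
  ((n.factorial : ℝ) * (2 * (n : ℝ) + α + β + 1) * Real.Gamma ((n : ℝ) + α + β + 1) /
              ((2 : ℝ) ^ (α + β + 1) * Real.Gamma ((n : ℝ) + α + 1) *
                Real.Gamma ((n : ℝ) + β + 1)))

/-- admissible indices -/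
structure Ok (α β : ℝ) (n : ℕ) : Prop where
  a : 0 < (n : ℝ) + α
  b : 0 < (n : ℝ) + β
  ab : 0 < (n : ℝ) + α + β

lemma Ok.mono {α β : ℝ} {n m : ℕ} (h : Ok α β n) (hm : n ≤ m) : Ok α β m := by
  have : (n : ℝ) ≤ m := by exact_mod_cast hm
  exact ⟨by linarith [h.a], by linarith [h.b], by linarith [h.ab]⟩

lemma Ok.succ {α β : ℝ} {n : ℕ} (h : Ok α β n) : Ok α β (n + 1) := h.mono (by omega)

lemma exists_ok (α β : ℝ) : ∃ n0, ∀ n ≥ n0, Ok α β n := by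
  obtain ⟨n, hn⟩ := exists_nat_gt (|α| + |β|)
  refine ⟨n, fun m hm => Ok.mono ⟨?_, ?_, ?_⟩ hm⟩ <;>
  linarith [neg_abs_le α, neg_abs_le β, abs_nonneg α, abs_nonneg β]

lemma KK_pos {α β : ℝ} {n : ℕ} (h : Ok α β n) : 0 < KK α β n := by
  have h1 := h.a
  have h2 := h.b
  have h3 := h.ab
  have g1 := Real.Gamma_pos_of_pos (show 0 < (n : ℝ) + α + 1 by linarith)
  have g2 := Real.Gamma_pos_of_pos (show 0 < (n : ℝ) + β + 1 by linarith)
  have g3 := Real.Gamma_pos_of_pos (show 0 < (n : ℝ) + α + β + 1 by linarith)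
  have : 0 < 2 * (n : ℝ) + α + β + 1 := by linarith [(n.cast_nonneg : (0:ℝ) ≤ n)]
  have : (0 : ℝ) < n.factorial := by exact_mod_cast n.factorial_pos
  unfold KK
  positivity

noncomputable def AA (α β : ℝ) (n : ℕ) : ℝ :=
  2 * ((n : ℝ) + 1) * (n + α + β + 1) / ((2 * n + α + β + 1) * (2 * n + α + β + 2))
noncomputable def DD (α β : ℝ) (n : ℕ) : ℝ :=
  2 * ((n : ℝ) + 1 + α) * (n + 1 + β) / ((2 * n + α + β + 3) * (2 * n + α + β + 2))
noncomputable def bb (α β : ℝ) (n : ℕ) : ℝ :=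
  (β ^ 2 - α ^ 2) / ((2 * n + α + β) * (2 * n + α + β + 2))
noncomputable def aa (α β : ℝ) (n : ℕ) : ℝ := AA α β n * √(KK α β n) / √(KK α β (n + 1))
noncomputable def pp (α β : ℝ) (n : ℕ) (x : ℝ) : ℝ := √(KK α β n) * jacobiP α β n x

lemma KK_succ {α β : ℝ} {n : ℕ} (h : Ok α β n) :
    KK α β (n + 1) = KK α β n * ((n + 1) * (2 * n + α + β + 3) * (n + α + β + 1) /
      ((n + α + 1) * (n + β + 1) * (2 * n + α + β + 1))) := by
  have h1 := h.a
  have h2 := h.b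
  have h3 := h.ab
  have hn : (0 : ℝ) ≤ n := n.cast_nonneg
  have g1 := Real.Gamma_pos_of_pos (show 0 < (n : ℝ) + α + 1 by linarith)
  have g2 := Real.Gamma_pos_of_pos (show 0 < (n : ℝ) + β + 1 by linarith)
  have g3 := Real.Gamma_pos_of_pos (show 0 < (n : ℝ) + α + β + 1 by linarith)
  have e1 := Real.Gamma_add_one (show (n : ℝ) + α + 1 ≠ 0 by linarith)
  have e2 := Real.Gamma_add_one (show (n : ℝ) + β + 1 ≠ 0 by linarith)
  have e3 := Real.Gamma_add_one (show (n : ℝ) + α + β + 1 ≠ 0 by linarith)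
  have p1 : 0 < 2 * (n : ℝ) + α + β + 1 := by linarith
  have p2 : 0 < (n : ℝ) + α + 1 := by linarith
  have p3 : 0 < (n : ℝ) + β + 1 := by linarith
  unfold KK
  rw [fac_succ]
  push_cast
  rw [show (n : ℝ) + 1 + α + 1 = n + α + 1 + 1 by ring,
    show (n : ℝ) + 1 + β + 1 = n + β + 1 + 1 by ring,
    show (n : ℝ) + 1 + α + β + 1 = n + α + β + 1 + 1 by ring, e1, e2, e3,
    show 2 * ((n : ℝ) + 1) + α + β + 1 = 2 * n + α + β + 3 by ring]
  have p1' := p1.ne'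
  set S := 2 * (n : ℝ) + α + β + 1
  field_simp

lemma AK_eq {α β : ℝ} {n : ℕ} (h : Ok α β n) :
    AA α β n * KK α β n = DD α β n * KK α β (n + 1) := by
  have h1 := h.a
  have h2 := h.b
  have h3 := h.ab
  have hn : (0 : ℝ) ≤ n := n.cast_nonneg
  have p1 : 0 < 2 * (n : ℝ) + α + β + 1 := by linarith
  have p2 : 0 < (n : ℝ) + α + 1 := by linarith
  have p3 : 0 < (n : ℝ) + β + 1 := by linarith
  have p4 : 0 < 2 * (n : ℝ) + α + β + 2 := by linarith
  have p5 : 0 < 2 * (n : ℝ) + α + β + 3 := by linarith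
  rw [KK_succ h, AA, DD]
  field_simp
  ring

lemma AA_pos {α β : ℝ} {n : ℕ} (h : Ok α β n) : 0 < AA α β n := by
  have h3 := h.ab
  have hn : (0 : ℝ) ≤ n := n.cast_nonneg
  have p1 : 0 < 2 * (n : ℝ) + α + β + 1 := by linarith
  have p2 : 0 < (n : ℝ) + α + β + 1 := by linarith
  have p4 : 0 < 2 * (n : ℝ) + α + β + 2 := by linarith
  unfold AA
  positivity

lemma aa_pos {α β : ℝ} {n : ℕ} (h : Ok α β n) : 0 < aa α β n := by
  have := AA_pos h
  have := KK_pos h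
  have := KK_pos h.succ
  unfold aa
  positivity

lemma aa_sq {α β : ℝ} {n : ℕ} (h : Ok α β n) : aa α β n ^ 2 = AA α β n * DD α β n := by
  have h1 := KK_pos h
  have h2 := KK_pos h.succ
  rw [aa, div_pow, mul_pow, Real.sq_sqrt h1.le, Real.sq_sqrt h2.le]
  field_simp
  have := AK_eq h
  linear_combination (AA α β n) * this

lemma aa_sqrt1 {α β : ℝ} {n : ℕ} (h : Ok α β n) :
    aa α β n * √(KK α β (n + 1)) = AA α β n * √(KK α β n) := by
  have h2 := Real.sqrt_pos.2 (KK_pos h.succ)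
  rw [aa]; field_simp

lemma aa_sqrt2 {α β : ℝ} {n : ℕ} (h : Ok α β n) :
    aa α β n * √(KK α β n) = DD α β n * √(KK α β (n + 1)) := by
  have h2 := Real.sqrt_pos.2 (KK_pos h.succ)
  have e1 := Real.sq_sqrt (KK_pos h).le
  have e2 := Real.sq_sqrt (KK_pos h.succ).le
  rw [aa]; field_simp
  rw [e1, e2]
  rw [AK_eq h, mul_comm]

lemma pp_rec {α β : ℝ} {n : ℕ} (h : Ok α β n) (x : ℝ) :
    x * pp α β (n + 1) x = aa α β (n + 1) * pp α β (n + 2) x + bb α β (n + 1) * pp α β (n + 1) x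
      + aa α β n * pp α β n x := by
  have h1 := aa_sqrt1 h.succ
  have h2 := aa_sqrt2 h
  have h3 := h.ab
  have hn : (0 : ℝ) ≤ n := n.cast_nonneg
  have p1 : 0 < 2 * (n : ℝ) + α + β + 2 := by linarith
  have p2 : 0 < 2 * (n : ℝ) + α + β + 3 := by linarith
  have p4 : 0 < 2 * (n : ℝ) + α + β + 4 := by linarith
  have key : x * jacobiP α β (n + 1) x = AA α β (n + 1) * jacobiP α β (n + 2) x
      + bb α β (n + 1) * jacobiP α β (n + 1) x + DD α β n * jacobiP α β n x := by
    have := three_term α β n x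
    unfold AA bb DD
    push_cast
    rw [show 2 * ((n : ℝ) + 1) + α + β + 1 = 2 * (n : ℝ) + α + β + 3 by ring,
      show 2 * ((n : ℝ) + 1) + α + β + 2 = 2 * (n : ℝ) + α + β + 4 by ring,
      show 2 * ((n : ℝ) + 1) + α + β = 2 * (n : ℝ) + α + β + 2 by ring]
    field_simp
    linear_combination (-2) * this
  unfold pp
  rw [show n + 2 = n + 1 + 1 by ring] at *
  linear_combination √(KK α β (n + 1)) * key - (jacobiP α β (n + 1 + 1) x) * h1
    - jacobiP α β n x * h2

lemma pp_rec0 {α β : ℝ} (h : Ok α β 0) (x : ℝ) :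
    x * pp α β 0 x = aa α β 0 * pp α β 1 x + bb α β 0 * pp α β 0 x := by
  have h1 := aa_sqrt1 h
  have h3 := h.ab
  simp only [Nat.cast_zero, zero_add] at h3
  have p1 : 0 < α + β + 2 := by linarith
  have p2 : 0 < α + β + 1 := by linarith
  have key : x = AA α β 0 * jacobiP α β 1 x + bb α β 0 := by
    rw [jacobiP_one]
    unfold AA bb
    simp
    field_simp
    ring
  unfold pp
  rw [jacobiP_zero]
  simp only [zero_add] at h1
  linear_combination √(KK α β 0) * key - (jacobiP α β 1 x) * h1

lemma pp_sq {α β : ℝ} {n : ℕ} (h : Ok α β n) (x y : ℝ) :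
    pp α β n x * pp α β n y = KK α β n * (jacobiP α β n x * jacobiP α β n y) := by
  have e1 := Real.sq_sqrt (KK_pos h).le
  unfold pp
  linear_combination (jacobiP α β n x * jacobiP α β n y) * e1

lemma form_id {z u v : ℝ} (hz : 1 ≤ z) :
    2 * (z - u) * (z + u) / ((2 * z - 1) * (2 * z)) * (2 * (z + v) * (z - v) / ((2 * z + 1) * (2 * z)))
      - 1 / 4 = (z ^ 2 * (1 - 4 * u ^ 2 - 4 * v ^ 2) + 4 * u ^ 2 * v ^ 2) /
        (4 * z ^ 2 * (4 * z ^ 2 - 1)) := by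
  have q1 : 2 * z - 1 ≠ 0 := by linarith
  have q2 : 2 * z + 1 ≠ 0 := by linarith
  have q3 : z ≠ 0 := by linarith
  rw [show 4 * z ^ 2 - 1 = (2 * z - 1) * (2 * z + 1) by ring]
  field_simp
  ring

lemma form_bd {z u v : ℝ} (hz : 1 ≤ z) :
    |(z ^ 2 * (1 - 4 * u ^ 2 - 4 * v ^ 2) + 4 * u ^ 2 * v ^ 2) /
        (4 * z ^ 2 * (4 * z ^ 2 - 1))| ≤
      (|1 - 4 * u ^ 2 - 4 * v ^ 2| + 4 * u ^ 2 * v ^ 2) / (4 * z ^ 2) := by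
  have hw : 1 ≤ z ^ 2 := by nlinarith
  have hd : 0 < 4 * z ^ 2 * (4 * z ^ 2 - 1) := by apply mul_pos <;> linarith
  rw [abs_div, abs_of_pos hd, div_le_div_iff₀ hd (by linarith)]
  have h1 : 0 ≤ 4 * u ^ 2 * v ^ 2 := by positivity
  have h2 : |z ^ 2 * (1 - 4 * u ^ 2 - 4 * v ^ 2) + 4 * u ^ 2 * v ^ 2| ≤
      z ^ 2 * (|1 - 4 * u ^ 2 - 4 * v ^ 2| + 4 * u ^ 2 * v ^ 2) := by
    refine (abs_add_le _ _).trans ?_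
    rw [abs_mul, abs_of_nonneg (sq_nonneg z), abs_of_nonneg h1, mul_add]
    have := mul_le_mul_of_nonneg_right hw h1
    linarith
  have h3 : 0 ≤ |1 - 4 * u ^ 2 - 4 * v ^ 2| + 4 * u ^ 2 * v ^ 2 := by positivity
  generalize |1 - 4 * u ^ 2 - 4 * v ^ 2| + 4 * u ^ 2 * v ^ 2 = M at *
  have h4 : z ^ 2 * M ≤ M * (4 * z ^ 2 - 1) := by
    rw [mul_comm]; exact mul_le_mul_of_nonneg_left (by linarith) h3
  calc _ ≤ (M * (4 * z ^ 2 - 1)) * (4 * z ^ 2) :=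
        mul_le_mul_of_nonneg_right (h2.trans h4) (by linarith)
    _ = _ := by ring

lemma half_bd {a M z C N : ℝ} (ha : 0 < a) (h : |a ^ 2 - 1 / 4| ≤ M / (4 * z ^ 2)) (hN : 0 < N)
    (hz : N ^ 2 ≤ 4 * z ^ 2) (hM : 0 ≤ M) (hC : 2 * M ≤ C) : |a - 1 / 2| ≤ C / N ^ 2 := by
  have h1 : |a - 1 / 2| ≤ 2 * |a ^ 2 - 1 / 4| := by
    rw [show a ^ 2 - 1 / 4 = (a - 1 / 2) * (a + 1 / 2) by ring, abs_mul,
      abs_of_pos (show 0 < a + 1 / 2 by linarith)]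
    nlinarith [abs_nonneg (a - 1 / 2)]
  refine h1.trans ((mul_le_mul_of_nonneg_left h (by norm_num)).trans ?_)
  rw [← mul_div_assoc]
  exact div_le_div₀ (by linarith) hC (by positivity) hz

lemma coeff_bounds (α β : ℝ) : ∃ C > 0, ∃ n0, ∀ n ≥ n0, Ok α β n ∧ C / ((n : ℝ) + 1) ^ 2 ≤ 1 / 4 ∧
    |aa α β n - 1 / 2| ≤ C / ((n : ℝ) + 1) ^ 2 ∧ |bb α β n| ≤ C / ((n : ℝ) + 1) ^ 2 := by
  obtain ⟨u, hu⟩ : ∃ u, u = (α + β) / 2 := ⟨_, rfl⟩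
  obtain ⟨v, hv⟩ : ∃ v, v = (α - β) / 2 := ⟨_, rfl⟩
  obtain ⟨M, hM⟩ : ∃ M, M = |1 - 4 * u ^ 2 - 4 * v ^ 2| + 4 * u ^ 2 * v ^ 2 := ⟨_, rfl⟩
  have hM0 : 0 ≤ M := by rw [hM]; positivity
  obtain ⟨C, hC⟩ : ∃ C, C = 2 * M + 4 * |β ^ 2 - α ^ 2| + 1 := ⟨_, rfl⟩
  have h0 : 0 ≤ |β ^ 2 - α ^ 2| := abs_nonneg _
  have hCpos : 0 < C := by rw [hC]; positivity
  obtain ⟨n1, hn1⟩ := exists_ok α β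
  obtain ⟨n2, hn2⟩ := exists_nat_gt (2 * |α + β| + 4 * C + 4)
  refine ⟨C, hCpos, max n1 n2, fun n hn => ?_⟩
  have ok := hn1 n (le_trans (le_max_left _ _) hn)
  have hn2' : (n2 : ℝ) ≤ n := by exact_mod_cast le_trans (le_max_right _ _) hn
  have hbig : 2 * |α + β| + 4 * C + 4 < n := lt_of_lt_of_le hn2 hn2'
  have hab := abs_le.1 (le_refl |α + β|)
  have habn := abs_nonneg (α + β)
  have hnp : (0 : ℝ) < n + 1 := by positivity
  obtain ⟨z, hz⟩ : ∃ z : ℝ, z = n + 1 + u := ⟨_, rfl⟩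
  have hz1 : ((n : ℝ) + 1) / 2 ≤ z := by rw [hz, hu]; linarith [hab.1]
  have hz3 : 2 ≤ z := by linarith
  have hz2 : ((n : ℝ) + 1) ^ 2 ≤ 4 * z ^ 2 := by
    rw [show 4 * z ^ 2 = (2 * z) ^ 2 by ring]
    exact pow_le_pow_left₀ hnp.le (by linarith) 2
  refine ⟨ok, ?_, ?_, ?_⟩
  · rw [div_le_iff₀ (by positivity)]; nlinarith
  · refine half_bd (aa_pos ok) (M := M) (z := z) ?_ hnp hz2 hM0 (by linarith)
    rw [hM]
    refine le_trans (le_of_eq ?_) (form_bd (by linarith))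
    rw [← form_id (by linarith), aa_sq ok, AA, DD]
    have e1 : 2 * (n : ℝ) + α + β + 1 = 2 * z - 1 := by rw [hz, hu]; ring
    have e2 : 2 * (n : ℝ) + α + β + 2 = 2 * z := by rw [hz, hu]; ring
    have e3 : 2 * (n : ℝ) + α + β + 3 = 2 * z + 1 := by rw [hz, hu]; ring
    have e4 : (n : ℝ) + α + β + 1 = z + u := by rw [hz, hu]; ring
    have e5 : (n : ℝ) + 1 = z - u := by rw [hz]; ring
    have e6 : (z - u) + α = z + v := by rw [hu, hv]; ring
    have e7 : (z - u) + β = z - v := by rw [hu, hv]; ring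
    rw [e1, e2, e3, e4, e5, e6, e7]
  · have e1 : 2 * (n : ℝ) + α + β = 2 * z - 2 := by rw [hz, hu]; ring
    have e2 : 2 * (n : ℝ) + α + β + 2 = 2 * z := by rw [hz, hu]; ring
    have h2 : z ^ 2 ≤ (2 * z - 2) * (2 * z) := by nlinarith
    rw [bb, e2, e1, abs_div, abs_of_pos (show 0 < (2 * z - 2) * (2 * z) by nlinarith)]
    calc |β ^ 2 - α ^ 2| / ((2 * z - 2) * (2 * z)) ≤ |β ^ 2 - α ^ 2| / z ^ 2 :=
          div_le_div_of_nonneg_left h0 (by positivity) h2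
      _ = 4 * |β ^ 2 - α ^ 2| / (4 * z ^ 2) := by field_simp
      _ ≤ _ := div_le_div₀ hCpos.le (by linarith) (by positivity) hz2

end JacobiAux

namespace JacobiAux

/-- the energy quadratic form -/
def En (p : ℕ → ℝ) (x : ℝ) (n : ℕ) : ℝ := p n ^ 2 + p (n + 1) ^ 2 - 2 * x * p n * p (n + 1)

lemma En_lower {p : ℕ → ℝ} {x δ : ℝ} (hx : |x| ≤ 1 - δ) (n : ℕ) :
    δ * (p n ^ 2 + p (n + 1) ^ 2) ≤ En p x n := by
  unfold En
  have h := abs_le.1 hx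
  nlinarith [mul_nonneg (show 0 ≤ 1 - δ + x by linarith) (sq_nonneg (p n - p (n + 1))),
    mul_nonneg (show 0 ≤ 1 - δ - x by linarith) (sq_nonneg (p n + p (n + 1))),
    mul_nonneg (show 0 ≤ 1 - δ + x by linarith) (sq_nonneg (p n + p (n + 1))),
    mul_nonneg (show 0 ≤ 1 - δ - x by linarith) (sq_nonneg (p n - p (n + 1)))]

lemma En_step {p a b ε : ℕ → ℝ} {x δ : ℝ} (hδ : 0 < δ) (hx : |x| ≤ 1 - δ) (n : ℕ)
    (hrec : x * p (n + 1) = a (n + 1) * p (n + 2) + b (n + 1) * p (n + 1) + a n * p n)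
    (ha : |a n - 1 / 2| ≤ ε n) (ha' : |a (n + 1) - 1 / 2| ≤ ε n) (hb : |b (n + 1)| ≤ ε n)
    (hε : ε n ≤ 1 / 4) :
    |En p x (n + 1) - En p x n| ≤ 144 / δ * ε n * En p x n := by
  have hε0 : 0 ≤ ε n := (abs_nonneg _).trans ha
  have hx1 : |x| ≤ 1 := by linarith
  have hlow := En_lower (p := p) hx n
  have key : En p x (n + 1) - En p x n = (p (n + 2) - p n) *
      ((1 - 2 * a (n + 1)) * p (n + 2) - 2 * b (n + 1) * p (n + 1) + (1 - 2 * a n) * p n) := by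
    unfold En
    linear_combination (-2) * (p (n + 2) - p n) * hrec
  rw [key]
  generalize p n = p0 at *
  generalize p (n + 1) = p1 at *
  generalize p (n + 2) = p2 at *
  generalize En p x n = E at *
  generalize a n = a0 at *
  generalize a (n + 1) = a1 at *
  generalize b (n + 1) = b1 at *
  generalize ε n = e at *
  have h2 : |p2| ≤ 5 * |p1| + 3 * |p0| := by
    have hA := abs_le.1 ha'
    have h1 : a1 * p2 = x * p1 - b1 * p1 - a0 * p0 := by linear_combination -hrec
    have h3 : a1 * |p2| = |x * p1 - b1 * p1 - a0 * p0| := by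
      rw [← h1, abs_mul, abs_of_nonneg (a := a1) (by linarith)]
    have h4 : |x * p1 - b1 * p1 - a0 * p0| ≤ |x| * |p1| + |b1| * |p1| + |a0| * |p0| := by
      rw [← abs_mul, ← abs_mul, ← abs_mul]
      exact (abs_sub _ _).trans (by gcongr; exact abs_sub _ _)
    have h5 : |a0| ≤ 3 / 4 := by
      have := abs_le.1 ha
      rw [abs_le]; constructor <;> linarith
    have i1 := mul_le_mul_of_nonneg_right hx1 (abs_nonneg p1)
    have i2 := mul_le_mul_of_nonneg_right (hb.trans hε) (abs_nonneg p1)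
    have i3 := mul_le_mul_of_nonneg_right h5 (abs_nonneg p0)
    have i4 := mul_le_mul_of_nonneg_right (show 1 / 4 ≤ a1 by linarith) (abs_nonneg p2)
    linarith
  have h3 : |(1 - 2 * a1) * p2 - 2 * b1 * p1 + (1 - 2 * a0) * p0| ≤
      2 * e * (6 * |p1| + 4 * |p0|) := by
    have j1 : |1 - 2 * a1| ≤ 2 * e := by
      have := abs_le.1 ha'
      rw [abs_le]; constructor <;> linarith
    have j2 : |1 - 2 * a0| ≤ 2 * e := by
      have := abs_le.1 ha
      rw [abs_le]; constructor <;> linarith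
    have j3 : |2 * b1| ≤ 2 * e := by rw [abs_mul]; simp; exact hb
    calc _ ≤ |1 - 2 * a1| * |p2| + |2 * b1| * |p1| + |1 - 2 * a0| * |p0| := by
          rw [← abs_mul, ← abs_mul, ← abs_mul]
          exact (abs_add_le _ _).trans (by gcongr; exact abs_sub _ _)
      _ ≤ 2 * e * |p2| + 2 * e * |p1| + 2 * e * |p0| := by gcongr
      _ ≤ 2 * e * (5 * |p1| + 3 * |p0|) + 2 * e * |p1| + 2 * e * |p0| := by gcongr
      _ = _ := by ring
  have h4 : |p2 - p0| ≤ 5 * |p1| + 4 * |p0| := (abs_sub _ _).trans (by linarith)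
  rw [abs_mul]
  calc _ ≤ (5 * |p1| + 4 * |p0|) * (2 * e * (6 * |p1| + 4 * |p0|)) := by gcongr
    _ ≤ 144 * e * (p0 ^ 2 + p1 ^ 2) := by
      rw [← sq_abs p0, ← sq_abs p1]
      have : (5 * |p1| + 4 * |p0|) * (2 * (6 * |p1| + 4 * |p0|)) ≤ 144 * (|p0| ^ 2 + |p1| ^ 2) := by
        nlinarith [sq_nonneg (|p0| - |p1|), sq_nonneg (|p0|), sq_nonneg (|p1|)]
      nlinarith
    _ ≤ 144 * e * (E / δ) := by
      gcongr
      rw [le_div_iff₀ hδ]; linarith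
    _ = _ := by ring

lemma En_bound {E ε : ℕ → ℝ} {D : ℝ} (hD : 0 ≤ D) (h0 : 0 ≤ E 0) (hε : ∀ n, 0 ≤ ε n)
    (h : ∀ n, |E (n + 1) - E n| ≤ D * ε n * E n) (n : ℕ) :
    E n ≤ E 0 * Real.exp (D * ∑ k ∈ Finset.range n, ε k) := by
  induction n with
  | zero => simp
  | succ n ih =>
    have h1 := (abs_le.1 (h n)).2
    have h2 : E (n + 1) ≤ (D * ε n + 1) * E n := by linarith
    have h3 : 0 ≤ D * ε n := mul_nonneg hD (hε n)
    rw [Finset.sum_range_succ, mul_add, Real.exp_add]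
    calc E (n + 1) ≤ (D * ε n + 1) * E n := h2
      _ ≤ (D * ε n + 1) * (E 0 * Real.exp (D * ∑ k ∈ Finset.range n, ε k)) := by gcongr
      _ ≤ Real.exp (D * ε n) * (E 0 * Real.exp (D * ∑ k ∈ Finset.range n, ε k)) := by
        gcongr
        exact Real.add_one_le_exp _
      _ = _ := by ring

lemma hasSum_tail (N : ℕ) : HasSum (fun n : ℕ => 1 / (((n + N + 1 : ℕ) : ℝ) * ((n + N + 1 : ℕ) + 1)))
    (1 / ((N : ℝ) + 1)) := by
  rw [hasSum_iff_tendsto_nat_of_nonneg (fun i => by positivity)]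
  have : ∀ n : ℕ, ∑ i ∈ Finset.range n, 1 / (((i + N + 1 : ℕ) : ℝ) * ((i + N + 1 : ℕ) + 1)) =
      1 / ((N : ℝ) + 1) - 1 / ((n : ℝ) + (N + 1)) := by
    intro n
    induction n with
    | zero => simp
    | succ n ih =>
      rw [Finset.sum_range_succ, ih]
      push_cast
      field_simp
      ring
  simp only [this]
  have h : Tendsto (fun n : ℕ => 1 / ((n : ℝ) + (N + 1))) atTop (𝓝 0) :=
    tendsto_const_nhds.div_atTop (tendsto_atTop_add_const_right _ _ tendsto_natCast_atTop_atTop)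
  simpa using tendsto_const_nhds.sub h

lemma tail_lim {c : ℕ → ℝ} {m : ℝ} (hc : Tendsto c atTop (𝓝 m)) :
    (∀ N, Summable (fun n : ℕ => c (n + N + 1) *
        (1 / (((n + N + 1 : ℕ) : ℝ) * ((n + N + 1 : ℕ) + 1))))) ∧
    Tendsto (fun N : ℕ => (N : ℝ) * ∑' n : ℕ, c (n + N + 1) *
        (1 / (((n + N + 1 : ℕ) : ℝ) * ((n + N + 1 : ℕ) + 1)))) atTop (𝓝 m) := by
  have hsum : ∀ N, Summable (fun n : ℕ => c (n + N + 1) *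
        (1 / (((n + N + 1 : ℕ) : ℝ) * ((n + N + 1 : ℕ) + 1)))) := by
    intro N
    obtain ⟨B, hB⟩ := hc.abs.bddAbove_range
    refine Summable.of_norm_bounded ((hasSum_tail N).summable.mul_left B) fun n => ?_
    rw [Real.norm_eq_abs, abs_mul, abs_of_nonneg (a := 1 / _) (by positivity)]
    gcongr
    exact hB ⟨n + N + 1, rfl⟩
  refine ⟨hsum, ?_⟩
  have h1 : Tendsto (fun N : ℕ => (N : ℝ) / ((N : ℝ) + 1)) atTop (𝓝 1) :=
    tendsto_natCast_div_add_atTop 1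
  have h2 : Tendsto (fun N : ℕ => (N : ℝ) * ((∑' n : ℕ, c (n + N + 1) *
        (1 / (((n + N + 1 : ℕ) : ℝ) * ((n + N + 1 : ℕ) + 1)))) - m * (1 / ((N : ℝ) + 1))))
        atTop (𝓝 0) := by
    rw [Metric.tendsto_atTop]
    intro e he
    obtain ⟨n0, hn0⟩ := Metric.tendsto_atTop.1 hc (e / 2) (by positivity)
    refine ⟨n0, fun N hN => ?_⟩
    have hd : (∑' n : ℕ, c (n + N + 1) *
        (1 / (((n + N + 1 : ℕ) : ℝ) * ((n + N + 1 : ℕ) + 1)))) - m * (1 / ((N : ℝ) + 1)) =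
        ∑' n : ℕ, (c (n + N + 1) - m) *
          (1 / (((n + N + 1 : ℕ) : ℝ) * ((n + N + 1 : ℕ) + 1))) := by
      rw [← (hasSum_tail N).tsum_eq, ← tsum_mul_left,
        ← (hsum N).tsum_sub ((hasSum_tail N).summable.mul_left m)]
      simp only [sub_mul]
    have hb : |∑' n : ℕ, (c (n + N + 1) - m) *
          (1 / (((n + N + 1 : ℕ) : ℝ) * ((n + N + 1 : ℕ) + 1)))| ≤ e / 2 * (1 / ((N : ℝ) + 1)) := by
      rw [← Real.norm_eq_abs]
      refine tsum_of_norm_bounded ((hasSum_tail N).mul_left (e / 2)) fun n => ?_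
      rw [Real.norm_eq_abs, abs_mul, abs_of_nonneg (a := 1 / _) (by positivity)]
      gcongr
      have := hn0 (n + N + 1) (by omega)
      rw [Real.dist_eq] at this
      exact this.le
    rw [Real.dist_eq, sub_zero, hd, abs_mul, abs_of_nonneg (N.cast_nonneg)]
    calc _ ≤ (N : ℝ) * (e / 2 * (1 / ((N : ℝ) + 1))) := by gcongr
      _ = e / 2 * ((N : ℝ) / (N + 1)) := by ring
      _ ≤ e / 2 * 1 := by
        gcongr
        rw [div_le_one (by positivity)]; linarith
      _ < e := by linarith
  have h3 := h2.add (h1.const_mul m)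
  simp only [mul_one, zero_add] at h3
  refine h3.congr fun N => ?_
  ring

lemma abel_tail {r g : ℕ → ℝ} {R : ℝ} (hr : ∀ n, |r n| ≤ R) (hg : Antitone g) (hg0 : ∀ n, 0 ≤ g n)
    (hs : Summable g) : Summable (fun n => (r (n + 1) - r n) * g n) ∧
      |∑' n, (r (n + 1) - r n) * g n| ≤ 2 * R * g 0 := by
  have hR : 0 ≤ R := (abs_nonneg _).trans (hr 0)
  have hsum : Summable (fun n => (r (n + 1) - r n) * g n) := by
    refine Summable.of_norm_bounded (hs.mul_left (2 * R)) fun n => ?_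
    rw [Real.norm_eq_abs, abs_mul, abs_of_nonneg (hg0 n)]
    gcongr
    · exact hg0 n
    · exact (abs_sub _ _).trans (by linarith [hr n, hr (n + 1)])
  refine ⟨hsum, ?_⟩
  have key : ∀ n, |∑ i ∈ Finset.range (n + 1), (r (i + 1) - r i) * g i - r (n + 1) * g n| ≤
      R * (2 * g 0 - g n) := by
    intro n
    induction n with
    | zero =>
      simp only [zero_add, Finset.sum_range_one]
      rw [show (r 1 - r 0) * g 0 - r 1 * g 0 = - (r 0 * g 0) by ring, abs_neg, abs_mul,
        abs_of_nonneg (hg0 0)]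
      nlinarith [hr 0, hg0 0]
    | succ n ih =>
      rw [Finset.sum_range_succ]
      have e : ∑ i ∈ Finset.range (n + 1), (r (i + 1) - r i) * g i +
          (r (n + 1 + 1) - r (n + 1)) * g (n + 1) - r (n + 1 + 1) * g (n + 1) =
          (∑ i ∈ Finset.range (n + 1), (r (i + 1) - r i) * g i - r (n + 1) * g n)
            + r (n + 1) * (g n - g (n + 1)) := by ring
      rw [e]
      refine (abs_add_le _ _).trans ?_
      rw [abs_mul]
      have h1 : 0 ≤ g n - g (n + 1) := by linarith [hg (Nat.le_succ n)]
      rw [abs_of_nonneg h1]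
      have := mul_le_mul_of_nonneg_right (hr (n + 1)) h1
      linarith
  have hb : ∀ n, |∑ i ∈ Finset.range (n + 1), (r (i + 1) - r i) * g i| ≤ 2 * R * g 0 := by
    intro n
    have h1 := key n
    have h2 : |r (n + 1) * g n| ≤ R * g n := by
      rw [abs_mul, abs_of_nonneg (hg0 n)]
      exact mul_le_mul_of_nonneg_right (hr _) (hg0 n)
    have := abs_add_le (∑ i ∈ Finset.range (n + 1), (r (i + 1) - r i) * g i - r (n + 1) * g n)
      (r (n + 1) * g n)
    rw [sub_add_cancel] at this
    linarith
  have ht := (hsum.hasSum.tendsto_sum_nat.comp (tendsto_add_atTop_nat 1)).abs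
  exact le_of_tendsto ht (Eventually.of_forall hb)

/-- the function `1/(n(n+s))` -/
noncomputable def gg (s : ℝ) (n : ℕ) : ℝ := 1 / ((n : ℝ) * (n + s))

lemma gg_ratio (s : ℝ) : Tendsto (fun n : ℕ => gg s n * ((n : ℝ) * (n + 1))) atTop (𝓝 1) := by
  have h1 : Tendsto (fun n : ℕ => (1 + 1 / (n : ℝ)) / (1 + s / (n : ℝ))) atTop
      (𝓝 ((1 + 0) / (1 + 0))) :=
    (tendsto_const_nhds.add (tendsto_const_div_atTop_nhds_zero_nat 1)).div
      (tendsto_const_nhds.add (tendsto_const_div_atTop_nhds_zero_nat s)) (by norm_num)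
  simp only [add_zero, div_one] at h1
  refine h1.congr' ?_
  obtain ⟨n0, hn0⟩ := exists_nat_gt (|s| + 1)
  filter_upwards [eventually_ge_atTop n0] with n hn
  have : (n0 : ℝ) ≤ n := by exact_mod_cast hn
  have h2 : 0 < (n : ℝ) := by linarith [abs_nonneg s]
  have h3 : 0 < (n : ℝ) + s := by linarith [neg_abs_le s]
  unfold gg
  field_simp

lemma gg_tail (s : ℝ) : ∃ n1, ∀ N ≥ n1, Antitone (fun n => gg s (n + N + 1)) ∧
    (∀ n, 0 ≤ gg s (n + N + 1)) ∧ Summable (fun n => gg s (n + N + 1)) := by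
  obtain ⟨n0, hn0⟩ := exists_nat_gt (|s| + 1)
  refine ⟨n0, fun N hN => ?_⟩
  have hN' : (n0 : ℝ) ≤ N := by exact_mod_cast hN
  have hs := neg_abs_le s
  have hs' := abs_nonneg s
  have hpos : ∀ n : ℕ, 0 < ((n + N + 1 : ℕ) : ℝ) ∧ 0 < ((n + N + 1 : ℕ) : ℝ) + s := by
    intro n
    push_cast
    have : (0 : ℝ) ≤ n := n.cast_nonneg
    constructor <;> linarith
  refine ⟨?_, fun n => ?_, ?_⟩
  · refine antitone_nat_of_succ_le fun n => ?_
    unfold gg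
    have h1 := (hpos n).1
    have h2 := (hpos n).2
    have e : ((n + 1 + N + 1 : ℕ) : ℝ) = ((n + N + 1 : ℕ) : ℝ) + 1 := by push_cast; ring
    rw [e]
    gcongr <;> linarith
  · have h1 := (hpos n).1
    have h2 := (hpos n).2
    unfold gg; positivity
  · have := (tail_lim (gg_ratio s)).1 N
    refine this.congr fun n => ?_
    have h1 := (hpos n).1
    field_simp

lemma main_off {q r : ℕ → ℝ} {R s : ℝ} {n0 : ℕ} (hq : ∀ n ≥ n0, q n = r (n + 1) - r n)
    (hr : ∀ n ≥ n0, |r n| ≤ R) : ∃ n1, ∀ N ≥ n1, Summable (fun n => q (n + N + 1) * gg s (n + N + 1)) ∧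
      |∑' n, q (n + N + 1) * gg s (n + N + 1)| ≤ 2 * R * gg s (N + 1) := by
  obtain ⟨n1, hn1⟩ := gg_tail s
  refine ⟨max n0 n1, fun N hN => ?_⟩
  have hN0 := le_trans (le_max_left _ _) hN
  obtain ⟨h1, h2, h3⟩ := hn1 N (le_trans (le_max_right _ _) hN)
  have := abel_tail (r := fun n => r (n + N + 1)) (R := R) (fun n => hr _ (by omega)) h1 h2 h3
  have e : ∀ n, q (n + N + 1) * gg s (n + N + 1) =
      (r (n + 1 + N + 1) - r (n + N + 1)) * gg s (n + N + 1) := by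
    intro n
    rw [hq _ (by omega), show n + N + 1 + 1 = n + 1 + N + 1 by ring]
  simp only [e]
  simpa only [zero_add] using this

lemma main_off_lim {q r : ℕ → ℝ} {R s : ℝ} {n0 : ℕ} (hq : ∀ n ≥ n0, q n = r (n + 1) - r n)
    (hr : ∀ n ≥ n0, |r n| ≤ R) {γ : ℝ} (hγ : γ < 2) :
    Tendsto (fun N : ℕ => (N : ℝ) ^ γ * ∑' n, q (n + N + 1) * gg s (n + N + 1)) atTop (𝓝 0) := by
  obtain ⟨n1, hn1⟩ := main_off (s := s) hq hr
  have h1 : Tendsto (fun N : ℕ => gg s (N + 1) * (((N + 1 : ℕ) : ℝ) * ((N + 1 : ℕ) + 1))) atTop (𝓝 1) :=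
    (gg_ratio s).comp (tendsto_add_atTop_nat 1)
  have h2 : Tendsto (fun N : ℕ => (N : ℝ) ^ (-(2 - γ))) atTop (𝓝 0) :=
    (tendsto_rpow_neg_atTop (by linarith)).comp tendsto_natCast_atTop_atTop
  have h3 := (h1.abs.const_mul (2 * R)).mul h2
  rw [mul_zero] at h3
  refine squeeze_zero_norm' ?_ h3
  filter_upwards [eventually_ge_atTop n1, eventually_ge_atTop 1, eventually_ge_atTop n0] with N hN hN1 hN0
  have hR : 0 ≤ R := (abs_nonneg _).trans (hr N hN0)
  have hp : (0 : ℝ) < N := by exact_mod_cast hN1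
  rw [Real.norm_eq_abs, abs_mul, abs_of_nonneg (by positivity)]
  have h4 := (hn1 N hN).2
  have h5 : (N : ℝ) ^ γ = (N : ℝ) ^ (-(2 - γ)) * (N : ℝ) ^ 2 := by
    rw [← Real.rpow_natCast, ← Real.rpow_add hp]; norm_num
  have h6 : 0 ≤ (N : ℝ) ^ (-(2 - γ)) := by positivity
  rw [h5, abs_mul, abs_of_nonneg (a := (_ : ℝ) * (_ + 1)) (by positivity)]
  calc _ ≤ (N : ℝ) ^ (-(2 - γ)) * (N : ℝ) ^ 2 * (2 * R * |gg s (N + 1)|) := by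
        gcongr
        exact h4.trans (by gcongr; exact le_abs_self _)
    _ = 2 * R * (|gg s (N + 1)| * (N : ℝ) ^ 2) * (N : ℝ) ^ (-(2 - γ)) := by ring
    _ ≤ _ := by
      gcongr
      push_cast
      nlinarith

lemma main_diag_lim {q r c : ℕ → ℝ} {R s m : ℝ} {n0 : ℕ}
    (hq : ∀ n ≥ n0, q n = c n + (r (n + 1) - r n))
    (hr : ∀ n ≥ n0, |r n| ≤ R) (hc : Tendsto c atTop (𝓝 m)) :
    Tendsto (fun N : ℕ => (N : ℝ) * ∑' n, q (n + N + 1) * gg s (n + N + 1)) atTop (𝓝 m) := by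
  have hq' : ∀ n ≥ n0, q n - c n = r (n + 1) - r n := fun n hn => by rw [hq n hn]; ring
  have hoff := main_off_lim (s := s) hq' hr (γ := 1) (by norm_num)
  obtain ⟨n1, hn1⟩ := main_off (s := s) hq' hr
  have hc' := hc.mul (gg_ratio s)
  rw [mul_one] at hc'
  obtain ⟨hs, hl⟩ := tail_lim hc'
  have h := hl.add hoff
  rw [add_zero] at h
  refine h.congr' ?_
  filter_upwards [eventually_ge_atTop n1] with N hN
  rw [Real.rpow_one, ← mul_add, ← (hs N).tsum_add (hn1 N hN).1]
  congr 2
  ext n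
  have : (0 : ℝ) < ((n + N + 1 : ℕ) : ℝ) := by positivity
  field_simp
  ring

end JacobiAux

namespace JacobiAux

/-- eventually bounded sequences -/
def Bd (g : ℕ → ℝ) : Prop := ∃ B, ∀ᶠ n in atTop, |g n| ≤ B

lemma Bd.add {f g : ℕ → ℝ} (hf : Bd f) (hg : Bd g) : Bd (fun n => f n + g n) := by
  obtain ⟨A, hA⟩ := hf
  obtain ⟨B, hB⟩ := hg
  refine ⟨A + B, ?_⟩
  filter_upwards [hA, hB] with n h1 h2
  exact (abs_add_le _ _).trans (add_le_add h1 h2)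

lemma Bd.mul {f g : ℕ → ℝ} (hf : Bd f) (hg : Bd g) : Bd (fun n => f n * g n) := by
  obtain ⟨A, hA⟩ := hf
  obtain ⟨B, hB⟩ := hg
  refine ⟨A * B, ?_⟩
  filter_upwards [hA, hB] with n h1 h2
  rw [abs_mul]
  exact mul_le_mul h1 h2 (abs_nonneg _) ((abs_nonneg _).trans h1)

lemma Bd.const (c : ℝ) : Bd (fun _ => c) := ⟨|c|, Eventually.of_forall fun _ => le_rfl⟩

lemma Bd.sub {f g : ℕ → ℝ} (hf : Bd f) (hg : Bd g) : Bd (fun n => f n - g n) := by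
  have := hf.add ((Bd.const (-1)).mul hg)
  refine (congrArg Bd ?_).mp this
  ext n; ring

lemma Bd.shift {f : ℕ → ℝ} (hf : Bd f) (k : ℕ) : Bd (fun n => f (n + k)) := by
  obtain ⟨A, hA⟩ := hf
  exact ⟨A, (tendsto_add_atTop_nat k).eventually hA⟩

lemma Bd.of_tendsto {f : ℕ → ℝ} {l : ℝ} (hf : Tendsto f atTop (𝓝 l)) : Bd f := by
  obtain ⟨B, hB⟩ := hf.abs.bddAbove_range
  exact ⟨B, Eventually.of_forall fun n => hB ⟨n, rfl⟩⟩

lemma zb {f g : ℕ → ℝ} (hf : Tendsto f atTop (𝓝 0)) (hg : Bd g) :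
    Tendsto (fun n => f n * g n) atTop (𝓝 0) := by
  obtain ⟨B, hB⟩ := hg
  have h := hf.abs.mul_const B
  simp only [abs_zero, zero_mul] at h
  refine squeeze_zero_norm' ?_ h
  filter_upwards [hB] with n hn
  rw [Real.norm_eq_abs, abs_mul]
  exact mul_le_mul_of_nonneg_left hn (abs_nonneg _)

lemma continuous_jacobiP (α β : ℝ) (n : ℕ) : Continuous (jacobiP α β n) := by
  have : jacobiP α β n = fun x => (qp α β n).eval ((x - 1) / 2) := funext fun x => jacobiP_eq α β n x
  rw [this]
  fun_prop

lemma continuous_pp (α β : ℝ) (n : ℕ) : Continuous (pp α β n) :=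
  continuous_const.mul (continuous_jacobiP α β n)

noncomputable def Ep (α β : ℝ) (n : ℕ) (x : ℝ) : ℝ := En (fun n => pp α β n x) x n

lemma continuous_Ep (α β : ℝ) (n : ℕ) : Continuous (Ep α β n) := by
  unfold Ep En
  have h1 := continuous_pp α β n
  have h2 := continuous_pp α β (n + 1)
  fun_prop

lemma summable_sq (M : ℝ) (n0 : ℕ) : Summable (fun n : ℕ => M / (((n + n0 : ℕ) : ℝ) + 1) ^ 2) := by
  have h := (Real.summable_one_div_nat_pow (p := 2)).2 (by norm_num)
  have h2 := ((summable_nat_add_iff (n0 + 1)).2 h).mul_left M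
  refine h2.congr fun n => ?_
  push_cast
  ring

lemma loc_bound (α β : ℝ) : ∃ n0, (∀ n ≥ n0, Ok α β n) ∧ ∀ δ > 0, ∃ M, 0 ≤ M ∧ ∀ x, |x| ≤ 1 - δ →
    ∀ n ≥ n0, 0 ≤ Ep α β n x ∧ Ep α β n x ≤ M ∧ pp α β n x ^ 2 ≤ M ∧
      |Ep α β (n + 1) x - Ep α β n x| ≤ M / ((n : ℝ) + 1) ^ 2 := by
  obtain ⟨C, hC, n0, h⟩ := coeff_bounds α β
  refine ⟨n0, fun n hn => (h n hn).1, fun δ hδ => ?_⟩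
  obtain ⟨M0, hM0⟩ := (isCompact_Icc (a := (-1 : ℝ)) (b := 1)).exists_bound_of_continuousOn
    (continuous_Ep α β n0).continuousOn
  set S := ∑' n : ℕ, C / (((n + n0 : ℕ) : ℝ) + 1) ^ 2 with hS
  set M1 := M0 * Real.exp (144 / δ * S) with hM1
  have hM00 : 0 ≤ M0 := (norm_nonneg _).trans (hM0 0 (by norm_num))
  have hM10 : 0 ≤ M1 := by positivity
  have hb : ∀ x, |x| ≤ 1 - δ → ∀ n, 
      |Ep α β (n + 1 + n0) x - Ep α β (n + n0) x| ≤
        144 / δ * (C / (((n + n0 : ℕ) : ℝ) + 1) ^ 2) * Ep α β (n + n0) x := by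
    intro x hx n
    obtain ⟨ok, h1, h2, h3⟩ := h (n + n0) (by omega)
    obtain ⟨ok', h1', h2', h3'⟩ := h (n + n0 + 1) (by omega)
    have hle : C / (((n + n0 + 1 : ℕ) : ℝ) + 1) ^ 2 ≤ C / (((n + n0 : ℕ) : ℝ) + 1) ^ 2 := by
      have : ((n + n0 : ℕ) : ℝ) ≤ ((n + n0 + 1 : ℕ) : ℝ) := by exact_mod_cast Nat.le_succ _
      exact div_le_div_of_nonneg_left hC.le (by positivity)
        (pow_le_pow_left₀ (by positivity) (by linarith) 2)
    have := En_step (p := fun n => pp α β n x) (a := aa α β) (b := bb α β)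
      (ε := fun n => C / ((n : ℝ) + 1) ^ 2) hδ hx (n + n0) (pp_rec ok x) h2 (h2'.trans hle)
      (h3'.trans hle) h1
    rw [show n + 1 + n0 = n + n0 + 1 by ring]
    exact this
  have hnn : ∀ x, |x| ≤ 1 - δ → ∀ n, 0 ≤ Ep α β n x := by
    intro x hx n
    have := En_lower (p := fun n => pp α β n x) hx n
    refine le_trans ?_ this
    positivity
  have hE : ∀ x, |x| ≤ 1 - δ → ∀ n, Ep α β (n + n0) x ≤ M1 := by
    intro x hx n
    have := En_bound (E := fun n => Ep α β (n + n0) x)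
      (ε := fun n => C / (((n + n0 : ℕ) : ℝ) + 1) ^ 2) (D := 144 / δ) (by positivity) (hnn x hx _)
      (fun n => by positivity) (hb x hx) n
    refine this.trans ?_
    rw [hM1]
    have hx' := abs_le.1 hx
    have h0 : Ep α β n0 x ≤ M0 :=
      (le_abs_self _).trans (hM0 x ⟨by linarith, by linarith⟩)
    simp only [zero_add]
    have hsum : ∑ k ∈ Finset.range n, C / (((k + n0 : ℕ) : ℝ) + 1) ^ 2 ≤ S :=
      (summable_sq C n0).sum_le_tsum _ (fun i _ => by positivity)
    gcongr
  refine ⟨max M1 (max (M1 / δ) (144 / δ * C * M1)), le_max_of_le_left hM10, fun x hx n hn => ?_⟩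
  obtain ⟨k, rfl⟩ := Nat.exists_eq_add_of_le' hn
  refine ⟨hnn x hx _, (hE x hx k).trans (le_max_left _ _), ?_, ?_⟩
  · have h1 := En_lower (p := fun n => pp α β n x) hx (k + n0)
    refine le_trans ?_ (le_trans (le_max_left _ _) (le_max_right _ _))
    rw [le_div_iff₀ hδ]
    have h2 := hE x hx k
    unfold Ep at h2
    nlinarith [sq_nonneg (pp α β (k + n0 + 1) x)]
  · rw [show k + n0 + 1 = k + 1 + n0 by ring]
    refine (hb x hx k).trans ?_
    calc _ ≤ 144 / δ * (C / (((k + n0 : ℕ) : ℝ) + 1) ^ 2) * M1 := by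
          gcongr; exact hE x hx k
      _ = (144 / δ * C * M1) / (((k + n0 : ℕ) : ℝ) + 1) ^ 2 := by ring
      _ ≤ _ := by
        gcongr
        exact le_trans (le_max_right _ _) (le_max_right _ _)

lemma exists_limit (α β : ℝ) : ∃ L : ℝ → ℝ, ∀ δ > 0,
    TendstoUniformlyOn (Ep α β) L atTop {x | |x| ≤ 1 - δ} := by
  obtain ⟨n0, hok, hM⟩ := loc_bound α β
  refine ⟨fun x => Ep α β n0 x + ∑' n : ℕ, (Ep α β (n + n0 + 1) x - Ep α β (n + n0) x), fun δ hδ => ?_⟩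
  obtain ⟨M, hM0, hM⟩ := hM δ hδ
  have h1 := tendstoUniformlyOn_tsum_nat (f := fun n x => Ep α β (n + n0 + 1) x - Ep α β (n + n0) x)
    (summable_sq M n0) (s := {x | |x| ≤ 1 - δ}) (fun n x hx => (hM x hx (n + n0) (by omega)).2.2.2)
  rw [Metric.tendstoUniformlyOn_iff] at h1 ⊢
  intro e he
  have h2 := h1 e he
  rw [eventually_atTop] at h2 ⊢
  obtain ⟨k, hk⟩ := h2
  refine ⟨k + n0, fun n hn x hx => ?_⟩
  obtain ⟨j, rfl⟩ := Nat.exists_eq_add_of_le' (show n0 ≤ n by omega)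
  have h3 := hk j (by omega) x hx
  have h4 : ∑ i ∈ Finset.range j, (Ep α β (i + n0 + 1) x - Ep α β (i + n0) x) =
      Ep α β (j + n0) x - Ep α β n0 x := by
    have := Finset.sum_range_sub (fun i => Ep α β (i + n0) x) j
    simp only [zero_add] at this
    rw [← this]
    refine Finset.sum_congr rfl fun i _ => ?_
    rw [show i + n0 + 1 = i + 1 + n0 by ring]
  rw [h4] at h3
  rw [Real.dist_eq] at h3 ⊢
  convert h3 using 2
  ring

lemma pp_Bd (α β : ℝ) {x : ℝ} (hx : x ∈ Set.Ioo (-1 : ℝ) 1) : Bd (fun n => pp α β n x) := by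
  obtain ⟨n0, hok, hM⟩ := loc_bound α β
  obtain ⟨M, hM0, hM⟩ := hM (1 - |x|) (by have := abs_lt.2 hx; linarith)
  refine ⟨√M, ?_⟩
  filter_upwards [eventually_ge_atTop n0] with n hn
  exact Real.abs_le_sqrt (hM x (by linarith) n hn).2.2.1

lemma tendsto_csq (C : ℝ) : Tendsto (fun n : ℕ => C / ((n : ℝ) + 1) ^ 2) atTop (𝓝 0) := by
  have := (summable_sq C 0).tendsto_atTop_zero
  simpa using this

lemma aa_lim (α β : ℝ) : Tendsto (aa α β) atTop (𝓝 (1 / 2)) := by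
  obtain ⟨C, hC, n0, h⟩ := coeff_bounds α β
  rw [tendsto_iff_norm_sub_tendsto_zero]
  refine squeeze_zero' (Eventually.of_forall fun _ => norm_nonneg _) ?_ (tendsto_csq C)
  filter_upwards [eventually_ge_atTop n0] with n hn
  exact (h n hn).2.2.1

lemma bb_lim (α β : ℝ) : Tendsto (bb α β) atTop (𝓝 0) := by
  obtain ⟨C, hC, n0, h⟩ := coeff_bounds α β
  refine squeeze_zero_norm' ?_ (tendsto_csq C)
  filter_upwards [eventually_ge_atTop n0] with n hn
  exact (h n hn).2.2.2

/-- approximate constant coefficient recurrence -/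
lemma defect_lim (α β : ℝ) {x : ℝ} (hx : x ∈ Set.Ioo (-1 : ℝ) 1) :
    Tendsto (fun n => pp α β (n + 2) x + pp α β n x - 2 * x * pp α β (n + 1) x) atTop (𝓝 0) := by
  have hB := pp_Bd α β hx
  have ha := aa_lim α β
  have hb := bb_lim α β
  have ha1 : Tendsto (fun n => 1 - 2 * aa α β (n + 1)) atTop (𝓝 0) := by
    have := (tendsto_const_nhds (x := (1 : ℝ))).sub ((ha.comp (tendsto_add_atTop_nat 1)).const_mul 2)
    simpa using this
  have ha0 : Tendsto (fun n => 1 - 2 * aa α β n) atTop (𝓝 0) := by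
    have := (tendsto_const_nhds (x := (1 : ℝ))).sub (ha.const_mul 2)
    simpa using this
  have hb1 : Tendsto (fun n => - 2 * bb α β (n + 1)) atTop (𝓝 0) := by
    have := (hb.comp (tendsto_add_atTop_nat 1)).const_mul (-2)
    simpa using this
  have := ((zb ha1 (hB.shift 2)).add (zb hb1 (hB.shift 1))).add (zb ha0 hB)
  simp only [add_zero] at this
  refine this.congr' ?_
  obtain ⟨n0, hok⟩ := exists_ok α β
  filter_upwards [eventually_ge_atTop n0] with n hn
  linear_combination 2 * pp_rec (hok n hn) x

lemma diag_lim (α β : ℝ) {x E : ℝ} (hx : x ∈ Set.Ioo (-1 : ℝ) 1)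
    (hE : Tendsto (fun n => Ep α β n x) atTop (𝓝 E)) (s : ℝ) :
    Tendsto (fun N : ℕ => (N : ℝ) * ∑' n, (pp α β (n + N + 1) x * pp α β (n + N + 1) x)
      * gg s (n + N + 1)) atTop (𝓝 (E / (2 * (1 - x ^ 2)))) := by
  have hx2 : 0 < 1 - x ^ 2 := by nlinarith [hx.1, hx.2]
  obtain ⟨B, hB⟩ := pp_Bd α β hx
  obtain ⟨n0, hn0⟩ := eventually_atTop.1 hB
  set q : ℕ → ℝ := fun n => pp α β n x * pp α β n x with hq
  have hqb : ∀ n ≥ n0, |q n| ≤ B * B := fun n hn => by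
    rw [hq]; simp only [abs_mul]
    exact mul_le_mul (hn0 n hn) (hn0 n hn) (abs_nonneg _) ((abs_nonneg _).trans (hn0 n hn))
  set r : ℕ → ℝ := fun n => -(q n - q (n - 1)) / (4 * (1 - x ^ 2)) with hr
  refine main_diag_lim (q := q) (r := r) (c := fun n => q n - (r (n + 1) - r n)) (n0 := n0 + 1)
    (R := (B * B + B * B) / (4 * (1 - x ^ 2))) (fun n _ => by ring) ?_ ?_
  · intro n hn
    rw [hr]; simp only
    rw [abs_div, abs_neg, abs_of_pos (show 0 < 4 * (1 - x ^ 2) by linarith)]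
    gcongr
    exact (abs_sub _ _).trans (add_le_add (hqb n (by omega)) (hqb _ (by omega)))
  · rw [← tendsto_add_atTop_iff_nat 1]
    have hd := zb (defect_lim α β hx) (((pp_Bd α β hx).shift 1).mul (Bd.const (2 * x)))
    have h := (((hE.comp (tendsto_add_atTop_nat 1)).add hE).add hd).div_const (4 * (1 - x ^ 2))
    rw [show E / (2 * (1 - x ^ 2)) = (E + E + 0) / (4 * (1 - x ^ 2)) by field_simp; ring]
    refine h.congr fun n => ?_
    simp only [hr, hq, Function.comp, Ep, En, Nat.add_sub_cancel]
    field_simp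
    ring

lemma off_lim (α β : ℝ) {x y : ℝ} (hx : x ∈ Set.Ioo (-1 : ℝ) 1) (hy : y ∈ Set.Ioo (-1 : ℝ) 1)
    (hxy : x ≠ y) (s : ℝ) {γ : ℝ} (hγ : γ < 2) :
    Tendsto (fun N : ℕ => (N : ℝ) ^ γ * ∑' n, (pp α β (n + N + 1) x * pp α β (n + N + 1) y)
      * gg s (n + N + 1)) atTop (𝓝 0) := by
  have hxy' : x - y ≠ 0 := sub_ne_zero.2 hxy
  have hX := pp_Bd α β hx
  have hY := pp_Bd α β hy
  have hbd : Bd (fun n => aa α β n * (pp α β (n + 1) x * pp α β n y - pp α β n x * pp α β (n + 1) y)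
      * (x - y)⁻¹) :=
    ((Bd.of_tendsto (aa_lim α β)).mul (((hX.shift 1).mul hY).sub (hX.mul (hY.shift 1)))).mul
      (Bd.const _)
  obtain ⟨R, hR⟩ := hbd
  obtain ⟨n1, hR⟩ := eventually_atTop.1 hR
  obtain ⟨n0, hok⟩ := exists_ok α β
  refine main_off_lim (q := fun n => pp α β n x * pp α β n y) (r := fun n => aa α β (n - 1) *
    (pp α β (n - 1 + 1) x * pp α β (n - 1) y - pp α β (n - 1) x * pp α β (n - 1 + 1) y) * (x - y)⁻¹)
    (R := R) (n0 := max n0 n1 + 1) ?_ (fun n hn => hR _ (by have := le_max_right n0 n1; omega)) hγ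
  intro n hn
  have := le_max_left n0 n1
  obtain ⟨k, rfl⟩ : ∃ k, n = k + 1 := ⟨n - 1, by omega⟩
  have ok := hok k (by omega)
  simp only [Nat.add_sub_cancel]
  have e1 := pp_rec ok x
  have e2 := pp_rec ok y
  field_simp
  linear_combination (pp α β (k + 1) y) * e1 - (pp α β (k + 1) x) * e2

end JacobiAux

namespace JacobiAux

lemma shift_abs {u v r t : ℕ → ℝ} {x σ ρ E : ℝ} (hσ : σ ^ 2 = 1)
    (hu : ∀ᶠ n in atTop, u n = r n * v (n + 1) + σ * t n * v n)
    (hr : Tendsto r atTop (𝓝 ρ)) (ht : Tendsto t atTop (𝓝 ρ)) (hv : Bd v)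
    (hd : Tendsto (fun n => v (n + 2) + v n - 2 * x * v (n + 1)) atTop (𝓝 0))
    (hE : Tendsto (fun n => En v x n) atTop (𝓝 E)) :
    Tendsto (fun n => En u x n) atTop (𝓝 (ρ ^ 2 * (2 + 2 * σ * x) * E)) := by
  set w : ℕ → ℝ := fun n => ρ * (v (n + 1) + σ * v n) with hw
  set e : ℕ → ℝ := fun n => (r n - ρ) * v (n + 1) + (t n - ρ) * (σ * v n) with he
  have hwB : Bd w := (Bd.const ρ).mul ((hv.shift 1).add ((Bd.const σ).mul hv))
  have hr0 : Tendsto (fun n => r n - ρ) atTop (𝓝 0) := by simpa using hr.sub_const ρ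
  have ht0 : Tendsto (fun n => t n - ρ) atTop (𝓝 0) := by simpa using ht.sub_const ρ
  have he0 : Tendsto e atTop (𝓝 0) := by
    simpa using (zb hr0 (hv.shift 1)).add (zb ht0 ((Bd.const σ).mul hv))
  have heB : Bd e := Bd.of_tendsto he0
  have he1 : Tendsto (fun n => e (n + 1)) atTop (𝓝 0) := he0.comp (tendsto_add_atTop_nat 1)
  have hmain : Tendsto (fun n => En w x n) atTop (𝓝 (ρ ^ 2 * (2 + 2 * σ * x) * E)) := by
    have hB : Bd (fun n => ρ ^ 2 * (2 * (2 * x * v (n + 1) - v n + σ * v (n + 1)) +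
        (v (n + 2) + v n - 2 * x * v (n + 1)) - 2 * x * (v (n + 1) + σ * v n))) := by
      refine (Bd.const _).mul ?_
      refine Bd.sub (Bd.add ((Bd.const 2).mul ?_) (Bd.of_tendsto hd))
        ((Bd.const (2 * x)).mul ((hv.shift 1).add ((Bd.const σ).mul hv)))
      exact (((Bd.const (2 * x)).mul (hv.shift 1)).sub hv).add ((Bd.const σ).mul (hv.shift 1))
    have := (hE.const_mul (ρ ^ 2 * (2 + 2 * σ * x))).add (zb hd hB)
    rw [add_zero] at this
    refine this.congr fun n => ?_
    simp only [En, hw, show n + 1 + 1 = n + 2 from rfl]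
    ring_nf
    simp only [hσ]
    ring
  have h1 : Tendsto (fun n => e n * (2 * w n + e n - 2 * x * w (n + 1))) atTop (𝓝 0) :=
    zb he0 ((((Bd.const 2).mul hwB).add heB).sub ((Bd.const (2 * x)).mul (hwB.shift 1)))
  have h2 : Tendsto (fun n => e (n + 1) * (2 * w (n + 1) + e (n + 1) - 2 * x * (w n + e n)))
      atTop (𝓝 0) :=
    zb he1 ((((Bd.const 2).mul (hwB.shift 1)).add (heB.shift 1)).sub
      ((Bd.const (2 * x)).mul (hwB.add heB)))
  have h := (hmain.add h1).add h2
  simp only [add_zero] at h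
  refine h.congr' ?_
  filter_upwards [hu, (tendsto_add_atTop_nat 1).eventually hu] with n hn hn1
  have e1 : u n = w n + e n := by rw [hn, hw, he]; ring
  have e2 : u (n + 1) = w (n + 1) + e (n + 1) := by rw [hn1, hw, he]; ring
  rw [En, En, e1, e2]
  ring

lemma KK_symm (α β : ℝ) (n : ℕ) : KK α β n = KK β α n := by
  unfold KK
  rw [show 2 * (n : ℝ) + α + β + 1 = 2 * n + β + α + 1 by ring,
    show (n : ℝ) + α + β + 1 = n + β + α + 1 by ring, add_comm α β]
  ring

lemma KK_up {α β : ℝ} {n : ℕ} (h : Ok α β n) :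
    KK α β n * ((2 * n + α + β + 2) * (n + α + β + 1)) =
      KK (α + 1) β n * (2 * (2 * n + α + β + 1) * (n + α + 1)) := by
  have h1 := h.a
  have h2 := h.b
  have h3 := h.ab
  have hn : (0 : ℝ) ≤ n := n.cast_nonneg
  have g1 := Real.Gamma_pos_of_pos (show 0 < (n : ℝ) + α + 1 by linarith)
  have g2 := Real.Gamma_pos_of_pos (show 0 < (n : ℝ) + β + 1 by linarith)
  have e1 := Real.Gamma_add_one (show (n : ℝ) + α + 1 ≠ 0 by linarith)
  have e3 := Real.Gamma_add_one (show (n : ℝ) + α + β + 1 ≠ 0 by linarith)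
  have p2 : 0 < (n : ℝ) + α + 1 := by linarith
  have p3 : (2 : ℝ) ^ (α + 1 + β + 1) = 2 ^ (α + β + 1) * 2 := by
    rw [show α + 1 + β + 1 = (α + β + 1) + 1 by ring, Real.rpow_add_one (by norm_num)]
  have p4 : (0 : ℝ) < 2 ^ (α + β + 1) := by positivity
  unfold KK
  rw [show (n : ℝ) + (α + 1) + 1 = n + α + 1 + 1 by ring,
    show (n : ℝ) + (α + 1) + β + 1 = n + α + β + 1 + 1 by ring, e1, e3, p3,
    show 2 * (n : ℝ) + (α + 1) + β + 1 = 2 * n + α + β + 2 by ring]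
  field_simp

lemma lim_lin (a c d e : ℝ) :
    Tendsto (fun n : ℕ => √(2 * ((n : ℝ) + a) * (n + c) / ((2 * n + d) * (2 * n + e)))) atTop
      (𝓝 (√(1 / 2))) := by
  have h0 : Tendsto (fun n : ℕ => ((n : ℝ))⁻¹) atTop (𝓝 0) := tendsto_inv_atTop_nhds_zero_nat
  have h (k a : ℝ) : Tendsto (fun n : ℕ => k + a * ((n : ℝ))⁻¹) atTop (𝓝 k) := by
    simpa using (h0.const_mul a).const_add k
  have := ((((h 1 a).const_mul 2).mul (h 1 c)).div ((h 2 d).mul (h 2 e)) (by norm_num)).sqrt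
  rw [show (2 * 1 * 1 / (2 * 2) : ℝ) = 1 / 2 by norm_num] at this
  refine this.congr' ?_
  filter_upwards [eventually_gt_atTop 0] with n hn
  have : (n : ℝ) ≠ 0 := by exact_mod_cast hn.ne'
  simp only [Pi.div_apply]
  congr 1
  rw [show 2 * ((n : ℝ) + a) * (n + c) = (2 * (1 + a * (n : ℝ)⁻¹) * (1 + c * (n : ℝ)⁻¹)) * n ^ 2 by
    field_simp, show (2 * (n : ℝ) + d) * (2 * n + e) =
    ((2 + d * (n : ℝ)⁻¹) * (2 + e * (n : ℝ)⁻¹)) * n ^ 2 by field_simp]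
  rw [mul_div_mul_right _ _ (by positivity)]

lemma r_eq {α β : ℝ} {n : ℕ} (h : Ok α β n) :
    √(KK α β (n + 1)) * ((n : ℝ) + 1 + α + β + 1) / (2 * ((n : ℝ) + 1) + α + β + 1) =
    √(2 * ((n : ℝ) + (α + 2)) * (n + (α + β + 2)) / ((2 * n + (α + β + 4)) * (2 * n + (α + β + 3))))
      * √(KK (α + 1) β (n + 1)) := by
  have h1 := h.a
  have h3 := h.ab
  have hn : (0 : ℝ) ≤ n := n.cast_nonneg
  have ok' : Ok (α + 1) β (n + 1) := ⟨by push_cast; linarith, by push_cast; linarith [h.b], by push_cast; linarith⟩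
  have k := KK_up h.succ
  have kp := KK_pos ok'
  have kp' := KK_pos h.succ
  rw [← Real.sqrt_mul (by have : 0 < (n:ℝ) + (α + 2) := by linarith
                          have : 0 < (n:ℝ) + (α + β + 2) := by linarith
                          have : 0 < 2*(n:ℝ) + (α + β + 3) := by linarith
                          have : 0 < 2*(n:ℝ) + (α + β + 4) := by linarith
                          positivity)]
  symm
  rw [Real.sqrt_eq_iff_mul_self_eq_of_pos (by
    have : 0 < (n:ℝ) + 1 + α + β + 1 := by linarith
    have : 0 < 2 * ((n:ℝ) + 1) + α + β + 1 := by linarith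
    positivity)]
  have e1 := Real.mul_self_sqrt kp'.le
  push_cast at k
  have q1 : 2 * (n:ℝ) + (α + β + 3) ≠ 0 := by linarith
  have q2 : 2 * (n:ℝ) + (α + β + 4) ≠ 0 := by linarith
  have q3 : 2 * ((n:ℝ) + 1) + α + β + 1 ≠ 0 := by linarith
  have : √(KK α β (n + 1)) * ((n:ℝ) + 1 + α + β + 1) / (2 * (n + 1) + α + β + 1) *
      (√(KK α β (n + 1)) * ((n:ℝ) + 1 + α + β + 1) / (2 * (n + 1) + α + β + 1)) =
      KK α β (n + 1) * ((n:ℝ) + 1 + α + β + 1) ^ 2 / (2 * (n + 1) + α + β + 1) ^ 2 := by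
    rw [div_mul_div_comm]; congr 1
    · linear_combination ((n:ℝ) + 1 + α + β + 1) ^ 2 * e1
    · ring
  rw [this]
  have z1 : (2 * ((n:ℝ) + 1) + α + β + 1) = 2 * (n:ℝ) + (α + β + 3) := by ring
  rw [z1] at k ⊢
  rw [div_mul_eq_mul_div, div_eq_div_iff (by positivity) (by positivity)]
  linear_combination (n + (α + β + 2)) * (2 * n + (α + β + 3)) * k

lemma t_eq {α β : ℝ} {n : ℕ} (h : Ok α β n) :
    √(KK α β (n + 1)) * ((n : ℝ) + 1 + β) / (2 * ((n : ℝ) + 1) + α + β + 1) =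
    √(2 * ((n : ℝ) + 1) * (n + (β + 1)) / ((2 * n + (α + β + 2)) * (2 * n + (α + β + 3))))
      * √(KK (α + 1) β n) := by
  have h1 := h.a
  have h2 := h.b
  have h3 := h.ab
  have hn : (0 : ℝ) ≤ n := n.cast_nonneg
  have ok' : Ok (α + 1) β n := ⟨by linarith, by linarith, by linarith⟩
  have k := KK_up h
  have k2 := KK_succ h
  have kp := KK_pos ok'
  have kp' := KK_pos h.succ
  rw [← Real.sqrt_mul (by have : 0 < (n:ℝ) + (β + 1) := by linarith
                          have : 0 < 2*(n:ℝ) + (α + β + 3) := by linarith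
                          have : 0 < 2*(n:ℝ) + (α + β + 2) := by linarith
                          positivity)]
  symm
  rw [Real.sqrt_eq_iff_mul_self_eq_of_pos (by
    have : 0 < (n:ℝ) + 1 + β := by linarith
    have : 0 < 2 * ((n:ℝ) + 1) + α + β + 1 := by linarith
    positivity)]
  have e1 := Real.mul_self_sqrt kp'.le
  have q1 : 2 * (n:ℝ) + (α + β + 3) ≠ 0 := by linarith
  have q2 : 2 * (n:ℝ) + (α + β + 2) ≠ 0 := by linarith
  have q3 : 2 * ((n:ℝ) + 1) + α + β + 1 ≠ 0 := by linarith
  have q4 : 2 * (n:ℝ) + α + β + 1 ≠ 0 := by linarith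
  have q5 : (n:ℝ) + α + 1 ≠ 0 := by linarith
  have q6 : (n:ℝ) + β + 1 ≠ 0 := by linarith
  have : √(KK α β (n + 1)) * ((n:ℝ) + 1 + β) / (2 * (n + 1) + α + β + 1) *
      (√(KK α β (n + 1)) * ((n:ℝ) + 1 + β) / (2 * (n + 1) + α + β + 1)) =
      KK α β (n + 1) * ((n:ℝ) + 1 + β) ^ 2 / (2 * (n + 1) + α + β + 1) ^ 2 := by
    rw [div_mul_div_comm]; congr 1
    · linear_combination ((n:ℝ) + 1 + β) ^ 2 * e1
    · ring
  rw [this, k2]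
  have k3 : KK α β n * (n + α + β + 1) = KK (α + 1) β n * (2 * (2 * n + α + β + 1) * (n + α + 1))
      / (2 * n + (α + β + 2)) := by
    rw [eq_div_iff q2]; linear_combination k
  rw [show KK α β n * (((n:ℝ) + 1) * (2 * n + α + β + 3) * (n + α + β + 1) /
      ((n + α + 1) * (n + β + 1) * (2 * n + α + β + 1))) =
      (KK α β n * (n + α + β + 1)) * (((n:ℝ) + 1) * (2 * n + α + β + 3) /
      ((n + α + 1) * (n + β + 1) * (2 * n + α + β + 1))) by ring, k3]
  have z1 : (2 * ((n:ℝ) + 1) + α + β + 1) = 2 * (n:ℝ) + (α + β + 3) := by ring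
  have z2 : (2 * (n:ℝ) + α + β + 3) = 2 * (n:ℝ) + (α + β + 3) := by ring
  have z3 : (n:ℝ) + 1 + β = n + β + 1 := by ring
  have z4 : (n:ℝ) + (β + 1) = n + β + 1 := by ring
  rw [z1, z2, z3, z4]
  field_simp

lemma sqrt_half_sq : √(1 / 2 : ℝ) ^ 2 = 1 / 2 := Real.sq_sqrt (by norm_num)

lemma shift_a {α β x E : ℝ} (hx : x ∈ Set.Ioo (-1 : ℝ) 1)
    (hE : Tendsto (fun n => Ep (α + 1) β n x) atTop (𝓝 E)) :
    Tendsto (fun n => Ep α β n x) atTop (𝓝 ((1 - x) * E)) := by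
  rw [← tendsto_add_atTop_iff_nat 1]
  have := shift_abs (u := fun n => pp α β (n + 1) x) (v := fun n => pp (α + 1) β n x) (σ := -1)
    (by norm_num) ?_ (lim_lin (α + 2) (α + β + 2) (α + β + 4) (α + β + 3))
    (lim_lin 1 (β + 1) (α + β + 2) (α + β + 3)) (pp_Bd (α + 1) β hx) (defect_lim (α + 1) β hx) hE
  · rw [sqrt_half_sq] at this
    exact (congrArg (fun z => Tendsto (fun n => Ep α β (n + 1) x) atTop (𝓝 z)) (by ring)).mp this
  · obtain ⟨n0, hok⟩ := exists_ok α β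
    filter_upwards [eventually_ge_atTop n0] with n hn
    have ok := hok n hn
    have q3 : 2 * ((n:ℝ) + 1) + α + β + 1 ≠ 0 := by linarith [ok.ab, (n.cast_nonneg : (0:ℝ) ≤ n)]
    have r := R1 α β n x
    unfold pp
    have e1 := r_eq ok
    have e2 := t_eq ok
    have : jacobiP α β (n + 1) x = (((n:ℝ)+1+α+β+1)*jacobiP (α+1) β (n+1) x - (n+1+β)*jacobiP (α+1) β n x) / (2 * ((n:ℝ) + 1) + α + β + 1) := by
      rw [eq_div_iff q3, ← r]; ring
    rw [this]
    linear_combination jacobiP (α+1) β (n+1) x * e1 - jacobiP (α+1) β n x * e2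

lemma shift_b {α β x E : ℝ} (hx : x ∈ Set.Ioo (-1 : ℝ) 1)
    (hE : Tendsto (fun n => Ep α (β + 1) n x) atTop (𝓝 E)) :
    Tendsto (fun n => Ep α β n x) atTop (𝓝 ((1 + x) * E)) := by
  rw [← tendsto_add_atTop_iff_nat 1]
  have := shift_abs (u := fun n => pp α β (n + 1) x) (v := fun n => pp α (β + 1) n x) (σ := 1)
    (by norm_num) ?_ (lim_lin (β + 2) (β + α + 2) (β + α + 4) (β + α + 3))
    (lim_lin 1 (α + 1) (β + α + 2) (β + α + 3)) (pp_Bd α (β + 1) hx) (defect_lim α (β + 1) hx) hE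
  · rw [sqrt_half_sq] at this
    exact (congrArg (fun z => Tendsto (fun n => Ep α β (n + 1) x) atTop (𝓝 z)) (by ring)).mp this
  · obtain ⟨n0, hok⟩ := exists_ok α β
    filter_upwards [eventually_ge_atTop n0] with n hn
    have ok := hok n hn
    have ok' : Ok β α n := ⟨ok.b, ok.a, by linarith [ok.ab]⟩
    have q3 : 2 * ((n:ℝ) + 1) + α + β + 1 ≠ 0 := by linarith [ok.ab, (n.cast_nonneg : (0:ℝ) ≤ n)]
    have r := R3 α β n x
    unfold pp
    have e1 := r_eq ok'
    have e2 := t_eq ok'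
    rw [KK_symm β α, KK_symm (β + 1) α] at e1 e2
    rw [show 2 * ((n:ℝ) + 1) + β + α + 1 = 2 * ((n:ℝ) + 1) + α + β + 1 by ring] at e1 e2
    have : jacobiP α β (n + 1) x = (((n:ℝ)+1+α+β+1)*jacobiP α (β+1) (n+1) x + (n+1+α)*jacobiP α (β+1) n x) / (2 * ((n:ℝ) + 1) + α + β + 1) := by
      rw [eq_div_iff q3, ← r]; ring
    rw [this]
    linear_combination jacobiP α (β+1) (n+1) x * e1 + jacobiP α (β+1) n x * e2

def Good (α β : ℝ) : Prop := ∀ x ∈ Set.Ioo (-1 : ℝ) 1, Tendsto (fun n => Ep α β n x) atTop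
  (𝓝 ((2 / Real.pi) * ((1 - x) ^ (1 / 2 - α) * (1 + x) ^ (1 / 2 - β))))

lemma Good.down_a {α β : ℝ} (h : Good (α + 1) β) : Good α β := by
  intro x hx
  convert shift_a hx (h x hx) using 2
  have h1 : 0 < 1 - x := by linarith [hx.2]
  rw [show 1 / 2 - α = (1 / 2 - (α + 1)) + 1 by ring, Real.rpow_add_one h1.ne']
  ring

lemma Good.down_b {α β : ℝ} (h : Good α (β + 1)) : Good α β := by
  intro x hx
  convert shift_b hx (h x hx) using 2
  have h1 : 0 < 1 + x := by linarith [hx.1]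
  rw [show 1 / 2 - β = (1 / 2 - (β + 1)) + 1 by ring, Real.rpow_add_one h1.ne']
  ring

lemma good_all (h : ∀ α β : ℝ, 1 < α → 1 < β → Good α β) (α β : ℝ) : Good α β := by
  have h1 : ∀ k : ℕ, ∀ α β : ℝ, 1 < α + k → 1 < β → Good α β := by
    intro k
    induction k with
    | zero => intro α β ha hb; exact h α β (by simpa using ha) hb
    | succ k ih =>
      intro α β ha hb
      exact Good.down_a (ih (α + 1) β (by push_cast at ha; linarith) hb)
  have h2 : ∀ k : ℕ, ∀ α β : ℝ, 1 < β + k → Good α β := by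
    intro k
    induction k with
    | zero =>
      intro α β hb
      obtain ⟨j, hj⟩ := exists_nat_gt (1 - α)
      exact h1 j α β (by linarith) (by simpa using hb)
    | succ k ih =>
      intro α β hb
      exact Good.down_b (ih α (β + 1) (by push_cast at hb; linarith))
  obtain ⟨j, hj⟩ := exists_nat_gt (1 - β)
  exact h2 j α β (by linarith)

end JacobiAux

namespace JacobiAux

noncomputable def ww (α β x : ℝ) : ℝ := (1 - x) ^ α * (1 + x) ^ β

lemma continuous_ww {α β : ℝ} (ha : 0 ≤ α) (hb : 0 ≤ β) : Continuous (ww α β) := by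
  unfold ww
  exact ((continuous_const.sub continuous_id).rpow_const (fun _ => Or.inr ha)).mul
    ((continuous_const.add continuous_id).rpow_const (fun _ => Or.inr hb))

lemma ww_nonneg {α β x : ℝ} (hx : x ∈ Set.Icc (-1 : ℝ) 1) : 0 ≤ ww α β x := by
  have h1 : 0 ≤ 1 - x := by linarith [hx.2]
  have h2 : 0 ≤ 1 + x := by linarith [hx.1]
  unfold ww; positivity

lemma real_beta {a b : ℝ} (ha : 0 < a) (hb : 0 < b) :
    ∫ t in (0 : ℝ)..1, t ^ (a - 1) * (1 - t) ^ (b - 1) =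
      Real.Gamma a * Real.Gamma b / Real.Gamma (a + b) := by
  have h := Complex.betaIntegral_eq_Gamma_mul_div (a : ℂ) (b : ℂ) (by simpa) (by simpa)
  rw [← Complex.ofReal_add, Complex.Gamma_ofReal, Complex.Gamma_ofReal, Complex.Gamma_ofReal] at h
  have h2 : Complex.betaIntegral a b =
      ((∫ t in (0 : ℝ)..1, t ^ (a - 1) * (1 - t) ^ (b - 1) : ℝ) : ℂ) := by
    rw [Complex.betaIntegral, ← intervalIntegral.integral_ofReal]
    refine intervalIntegral.integral_congr fun t ht => ?_
    rw [Set.uIcc_of_le zero_le_one] at ht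
    push_cast
    rw [Complex.ofReal_cpow ht.1, Complex.ofReal_cpow (by linarith [ht.2])]
    push_cast
    rfl
  rw [h2] at h
  exact_mod_cast h

lemma integral_ww {α β : ℝ} (ha : 0 < α) (hb : 0 < β) :
    ∫ x in (-1 : ℝ)..1, ww α β x =
      2 ^ (α + β + 1) * Real.Gamma (α + 1) * Real.Gamma (β + 1) / Real.Gamma (α + β + 2) := by
  have h1 := intervalIntegral.integral_comp_mul_sub (a := 0) (b := 1) (ww α β)
    (two_ne_zero : (2 : ℝ) ≠ 0) 1
  have h2 : ∫ x in (0 : ℝ)..1, ww α β (2 * x - 1) =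
      2 ^ (α + β) * ∫ t in (0 : ℝ)..1, t ^ (β + 1 - 1) * (1 - t) ^ (α + 1 - 1) := by
    rw [← intervalIntegral.integral_const_mul]
    refine intervalIntegral.integral_congr fun t ht => ?_
    rw [Set.uIcc_of_le zero_le_one] at ht
    simp only [ww]
    rw [show 1 - (2 * t - 1) = 2 * (1 - t) by ring, show 1 + (2 * t - 1) = 2 * t by ring,
      Real.mul_rpow (by norm_num) (by linarith [ht.2]), Real.mul_rpow (by norm_num) ht.1,
      Real.rpow_add (by norm_num)]
    simp only [add_sub_cancel_right]
    ring
  rw [h2, real_beta (by linarith) (by linarith)] at h1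
  norm_num at h1
  rw [Real.rpow_add_one (by norm_num), show α + β + 2 = β + 1 + (α + 1) by ring]
  linear_combination (-2) * h1

/-- integration against the weight -/
noncomputable def J (α β : ℝ) (f : ℝ → ℝ) : ℝ := ∫ x in (-1 : ℝ)..1, f x * ww α β x

section
variable {α β : ℝ}

lemma J_int (ha : 0 ≤ α) (hb : 0 ≤ β) {f : ℝ → ℝ} (hf : Continuous f) :
    IntervalIntegrable (fun x => f x * ww α β x) MeasureTheory.volume (-1) 1 :=
  (hf.mul (continuous_ww ha hb)).intervalIntegrable _ _

lemma J_add (ha : 0 ≤ α) (hb : 0 ≤ β) {f g : ℝ → ℝ} (hf : Continuous f) (hg : Continuous g) :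
    J α β (fun x => f x + g x) = J α β f + J α β g := by
  unfold J
  rw [← intervalIntegral.integral_add (J_int ha hb hf) (J_int ha hb hg)]
  refine intervalIntegral.integral_congr fun x _ => ?_
  simp only; ring

lemma J_smul (c : ℝ) (f : ℝ → ℝ) : J α β (fun x => c * f x) = c * J α β f := by
  unfold J
  rw [← intervalIntegral.integral_const_mul]
  refine intervalIntegral.integral_congr fun x _ => ?_
  simp only; ring

lemma J_congr {f g : ℝ → ℝ} (h : ∀ x, f x = g x) : J α β f = J α β g := by
  rw [show f = g from funext h]

lemma ode_eval (n : ℕ) (y : ℝ) :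
    y * (1 + y) * (Polynomial.derivative (Polynomial.derivative (qp α β n))).eval y +
    ((α + 1) + (α + β + 2) * y) * (Polynomial.derivative (qp α β n)).eval y =
    ((n : ℝ) * (n + α + β + 1)) * (qp α β n).eval y := by
  have := congrArg (Polynomial.eval y) (qp_ode α β n)
  simpa using this

lemma orth0 (ha : 0 < α) (hb : 0 < β) {n m : ℕ} (hnm : n ≠ m) :
    ∫ x in (-1 : ℝ)..1, jacobiP α β n x * jacobiP α β m x * ww α β x = 0 := by
  set F : ℝ → ℝ := fun x => (1 - x) ^ (α + 1) * (1 + x) ^ (β + 1) *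
    ((Polynomial.derivative (qp α β n)).eval ((x - 1) / 2) * (qp α β m).eval ((x - 1) / 2) -
    (qp α β n).eval ((x - 1) / 2) * (Polynomial.derivative (qp α β m)).eval ((x - 1) / 2)) with hF
  set c : ℝ := (-2) * ((n : ℝ) * (n + α + β + 1) - (m : ℝ) * (m + α + β + 1)) with hc
  have hc0 : c ≠ 0 := by
    have : c = (-2) * (((n : ℝ) - m) * (n + m + α + β + 1)) := by rw [hc]; ring
    rw [this]
    have h1 : (n : ℝ) - m ≠ 0 := sub_ne_zero.2 (by exact_mod_cast hnm)
    have h2 : (n : ℝ) + m + α + β + 1 ≠ 0 := by positivity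
    simp [h1, h2]
  have hd : ∀ x ∈ Set.uIcc (-1 : ℝ) 1,
      HasDerivAt F (c * (jacobiP α β n x * jacobiP α β m x * ww α β x)) x := by
    intro x hx
    rw [Set.uIcc_of_le (by norm_num)] at hx
    have hy : HasDerivAt (fun x : ℝ => (x - 1) / 2) (1 / 2) x :=
      ((hasDerivAt_id x).sub_const 1).div_const 2
    have hp (p : Polynomial ℝ) : HasDerivAt (fun x : ℝ => p.eval ((x - 1) / 2))
        ((Polynomial.derivative p).eval ((x - 1) / 2) * (1 / 2)) x :=
      (p.hasDerivAt _).comp x hy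
    have h1 : HasDerivAt (fun x : ℝ => (1 - x) ^ (α + 1)) (-1 * (α + 1) * (1 - x) ^ (α + 1 - 1)) x :=
      ((hasDerivAt_id x).const_sub 1).rpow_const (Or.inr (by linarith))
    have h2 : HasDerivAt (fun x : ℝ => (1 + x) ^ (β + 1)) (1 * (β + 1) * (1 + x) ^ (β + 1 - 1)) x :=
      ((hasDerivAt_id x).const_add 1).rpow_const (Or.inr (by linarith))
    have h3 := (h1.mul h2).mul (((hp (Polynomial.derivative (qp α β n))).mul (hp (qp α β m))).sub
      ((hp (qp α β n)).mul (hp (Polynomial.derivative (qp α β m)))))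
    refine HasDerivAt.congr_deriv h3 ?_
    have e1 : (1 - x) ^ (α + 1) = (1 - x) ^ α * (1 - x) :=
      Real.rpow_add_one' (by linarith [hx.2]) (by linarith)
    have e2 : (1 + x) ^ (β + 1) = (1 + x) ^ β * (1 + x) :=
      Real.rpow_add_one' (by linarith [hx.1]) (by linarith)
    have o1 := ode_eval (α := α) (β := β) n ((x - 1) / 2)
    have o2 := ode_eval (α := α) (β := β) m ((x - 1) / 2)
    simp only [Pi.mul_apply, Pi.sub_apply, add_sub_cancel_right, jacobiP_eq, ww, e1, e2]
    rw [hc]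
    generalize (1 - x) ^ α = A at *
    generalize (1 + x) ^ β = B at *
    generalize Polynomial.eval ((x - 1) / 2) (Polynomial.derivative (Polynomial.derivative (qp α β n))) = n2 at *
    generalize Polynomial.eval ((x - 1) / 2) (Polynomial.derivative (Polynomial.derivative (qp α β m))) = m2 at *
    generalize Polynomial.eval ((x - 1) / 2) (Polynomial.derivative (qp α β n)) = n1 at *
    generalize Polynomial.eval ((x - 1) / 2) (Polynomial.derivative (qp α β m)) = m1 at *
    generalize Polynomial.eval ((x - 1) / 2) (qp α β n) = n0 at *
    generalize Polynomial.eval ((x - 1) / 2) (qp α β m) = m0 at *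
    linear_combination (-2) * A * B * (m0 * o1 - n0 * o2)
  have hcont : Continuous (fun x => c * (jacobiP α β n x * jacobiP α β m x * ww α β x)) :=
    continuous_const.mul (((continuous_jacobiP α β n).mul (continuous_jacobiP α β m)).mul
      (continuous_ww ha.le hb.le))
  have h := intervalIntegral.integral_eq_sub_of_hasDerivAt hd (hcont.intervalIntegrable _ _)
  rw [intervalIntegral.integral_const_mul] at h
  have hF1 : F 1 = 0 := by
    rw [hF]; simp only [sub_self]; rw [Real.zero_rpow (by linarith)]; ring
  have hF2 : F (-1) = 0 := by
    rw [hF]; simp only [show (1 : ℝ) + -1 = 0 by norm_num]; rw [Real.zero_rpow (by linarith)]; ring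
  rw [hF1, hF2, sub_zero] at h
  exact (mul_eq_zero.1 h).resolve_left hc0

lemma ok0 (ha : 0 < α) (hb : 0 < β) (n : ℕ) : Ok α β n :=
  ⟨by positivity, by positivity, by positivity⟩

lemma orth (ha : 0 < α) (hb : 0 < β) {n m : ℕ} (hnm : n ≠ m) :
    J α β (fun x => pp α β n x * pp α β m x) = 0 := by
  have : J α β (fun x => pp α β n x * pp α β m x) =
      √(KK α β n) * √(KK α β m) * J α β (fun x => jacobiP α β n x * jacobiP α β m x) := by
    rw [← J_smul]
    refine J_congr fun x => ?_
    unfold pp; ring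
  rw [this, J, orth0 ha hb hnm, mul_zero]

lemma norm_succ (ha : 0 < α) (hb : 0 < β) (n : ℕ) :
    J α β (fun x => pp α β (n + 1) x * pp α β (n + 1) x) = J α β (fun x => pp α β n x * pp α β n x) := by
  have ok := ok0 ha hb n
  have hc := continuous_pp α β
  have h1 : J α β (fun x => x * (pp α β n x * pp α β (n + 1) x)) =
      aa α β n * J α β (fun x => pp α β n x * pp α β n x) := by
    have : ∀ x, x * (pp α β n x * pp α β (n + 1) x) =
        (aa α β (n + 1) * (pp α β n x * pp α β (n + 2) x) +
        bb α β (n + 1) * (pp α β n x * pp α β (n + 1) x)) + aa α β n * (pp α β n x * pp α β n x) := by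
      intro x; linear_combination (pp α β n x) * pp_rec ok x
    have c0 := hc n
    have c1 := hc (n + 1)
    have c2 := hc (n + 2)
    rw [J_congr this, J_add ha.le hb.le (by fun_prop) (by fun_prop),
      J_add ha.le hb.le (by fun_prop) (by fun_prop), J_smul, J_smul, J_smul, orth ha hb (by omega),
      orth ha hb (by omega)]
    ring
  have h2 : J α β (fun x => x * (pp α β n x * pp α β (n + 1) x)) =
      aa α β n * J α β (fun x => pp α β (n + 1) x * pp α β (n + 1) x) := by
    cases n with
    | zero =>
      have : ∀ x, x * (pp α β 0 x * pp α β (0 + 1) x) =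
          (aa α β 0 * (pp α β (0 + 1) x * pp α β (0 + 1) x) +
          bb α β 0 * (pp α β 0 x * pp α β (0 + 1) x)) := by
        intro x; linear_combination (pp α β 1 x) * pp_rec0 ok x
      have c0 := hc 0
      have c1 := hc (0 + 1)
      rw [J_congr this, J_add ha.le hb.le (by fun_prop) (by fun_prop),
        J_smul, J_smul, orth ha hb (n := 0) (m := 0 + 1) (by omega)]
      ring
    | succ n =>
      have : ∀ x, x * (pp α β (n + 1) x * pp α β (n + 1 + 1) x) =
          (aa α β (n + 1) * (pp α β (n + 1 + 1) x * pp α β (n + 1 + 1) x) +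
          bb α β (n + 1) * (pp α β (n + 1) x * pp α β (n + 1 + 1) x)) +
          aa α β n * (pp α β n x * pp α β (n + 1 + 1) x) := by
        intro x; linear_combination (pp α β (n + 2) x) * pp_rec (ok0 ha hb n) x
      have c0 := hc n
      have c1 := hc (n + 1)
      have c2 := hc (n + 1 + 1)
      rw [J_congr this, J_add ha.le hb.le (by fun_prop) (by fun_prop),
        J_add ha.le hb.le (by fun_prop) (by fun_prop), J_smul, J_smul, J_smul,
        orth ha hb (n := n + 1) (m := n + 1 + 1) (by omega), orth ha hb (n := n) (m := n + 1 + 1) (by omega)]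
      ring
  exact (mul_left_cancel₀ (aa_pos ok).ne' (h1.symm.trans h2)).symm

lemma norm_one (ha : 0 < α) (hb : 0 < β) (n : ℕ) :
    J α β (fun x => pp α β n x * pp α β n x) = 1 := by
  induction n with
  | succ n ih => rw [norm_succ ha hb, ih]
  | zero =>
    have k := KK_pos (ok0 ha hb 0)
    have : ∀ x, pp α β 0 x * pp α β 0 x = KK α β 0 * 1 := by
      intro x; rw [pp_sq (ok0 ha hb 0), jacobiP_zero]; ring
    rw [J_congr this, J_smul]
    unfold J
    simp only [one_mul]
    rw [integral_ww ha hb]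
    unfold KK
    have g1 := Real.Gamma_pos_of_pos (show 0 < α + 1 by linarith)
    have g2 := Real.Gamma_pos_of_pos (show 0 < β + 1 by linarith)
    have g3 := Real.Gamma_pos_of_pos (show 0 < α + β + 1 by linarith)
    have e3 := Real.Gamma_add_one (show α + β + 1 ≠ 0 by linarith)
    rw [show α + β + 2 = α + β + 1 + 1 by ring, e3]
    simp only [Nat.factorial_zero, Nat.cast_one, Nat.cast_zero, mul_zero, zero_add, one_mul]
    have p4 : (0 : ℝ) < 2 ^ (α + β + 1) := by positivity
    have p5 : 0 < α + β + 1 := by positivity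
    field_simp

lemma orthonormal (ha : 0 < α) (hb : 0 < β) (n m : ℕ) :
    J α β (fun x => pp α β n x * pp α β m x) = if n = m then 1 else 0 := by
  split_ifs with h
  · subst h; exact norm_one ha hb n
  · exact orth ha hb h

end
end JacobiAux

namespace JacobiAux

noncomputable def cc (k : ℕ) (d : ℤ) : ℝ :=
  (1 / Real.pi) * ∫ θ in (0 : ℝ)..Real.pi, Real.cos θ ^ k * Real.cos (d * θ)

lemma cc_zero (d : ℤ) : cc 0 d = if d = 0 then 1 else 0 := by
  unfold cc
  split_ifs with h
  · subst h
    simp [Real.pi_ne_zero]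
  · have hd : (d : ℝ) ≠ 0 := by exact_mod_cast h
    simp only [pow_zero, one_mul]
    rw [intervalIntegral.integral_comp_mul_left (fun x => Real.cos x) hd, integral_cos]
    simp [Real.sin_int_mul_pi]

lemma cc_succ (k : ℕ) (d : ℤ) : cc (k + 1) d = (1 / 2) * cc k (d + 1) + (1 / 2) * cc k (d - 1) := by
  unfold cc
  have : ∀ θ : ℝ, Real.cos θ ^ (k + 1) * Real.cos (d * θ) =
      (1 / 2) * (Real.cos θ ^ k * Real.cos ((d + 1 : ℤ) * θ)) +
      (1 / 2) * (Real.cos θ ^ k * Real.cos ((d - 1 : ℤ) * θ)) := by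
    intro θ
    push_cast
    rw [add_mul, sub_mul, one_mul, Real.cos_add, Real.cos_sub]
    ring
  simp only [this]
  rw [intervalIntegral.integral_add, intervalIntegral.integral_const_mul,
    intervalIntegral.integral_const_mul]
  · ring
  · exact Continuous.intervalIntegrable (by fun_prop) _ _
  · exact Continuous.intervalIntegrable (by fun_prop) _ _

section
variable {α β : ℝ}

lemma moments (ha : 0 < α) (hb : 0 < β) (k : ℕ) : ∀ i j : ℕ,
    Tendsto (fun n : ℕ => J α β (fun x => x ^ k * (pp α β (n + i) x * pp α β (n + j) x))) atTop
      (𝓝 (cc k ((i : ℤ) - j))) := by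
  induction k with
  | zero =>
    intro i j
    rw [cc_zero]
    refine tendsto_const_nhds.congr fun n => ?_
    simp only [pow_zero, one_mul]
    rw [orthonormal ha hb]
    have : ((i : ℤ) - j = 0) ↔ (n + i = n + j) := by omega
    simp only [this]
  | succ k ih =>
    intro i j
    rw [← tendsto_add_atTop_iff_nat 1]
    have hsh (n i : ℕ) : n + 1 + i = n + (i + 1) := by omega
    have h1 := ((aa_lim α β).comp (tendsto_add_atTop_nat (i + 1))).mul (ih (i + 2) (j + 1))
    have h2 := ((bb_lim α β).comp (tendsto_add_atTop_nat (i + 1))).mul (ih (i + 1) (j + 1))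
    have h3 := ((aa_lim α β).comp (tendsto_add_atTop_nat i)).mul (ih i (j + 1))
    have h := (h1.add h2).add h3
    have e : (1 / 2) * cc k (((i + 2 : ℕ) : ℤ) - ((j + 1 : ℕ) : ℤ)) +
        0 * cc k (((i + 1 : ℕ) : ℤ) - ((j + 1 : ℕ) : ℤ)) + (1 / 2) * cc k ((i : ℤ) - ((j + 1 : ℕ) : ℤ))
        = cc (k + 1) ((i : ℤ) - j) := by
      rw [cc_succ, show ((i + 2 : ℕ) : ℤ) - ((j + 1 : ℕ) : ℤ) = (i : ℤ) - j + 1 by push_cast; ring,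
        show (i : ℤ) - ((j + 1 : ℕ) : ℤ) = (i : ℤ) - j - 1 by push_cast; ring]
      ring
    rw [e] at h
    refine h.congr fun n => ?_
    simp only [Function.comp, hsh]
    have c0 := continuous_pp α β (n + i)
    have c1 := continuous_pp α β (n + (i + 1))
    have c2 := continuous_pp α β (n + (i + 2))
    have c3 := continuous_pp α β (n + (j + 1))
    have hrec : ∀ x, x ^ (k + 1) * (pp α β (n + (i + 1)) x * pp α β (n + (j + 1)) x) =
      (aa α β (n + (i + 1)) * (x ^ k * (pp α β (n + (i + 2)) x * pp α β (n + (j + 1)) x)) +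
      bb α β (n + (i + 1)) * (x ^ k * (pp α β (n + (i + 1)) x * pp α β (n + (j + 1)) x))) +
      aa α β (n + i) * (x ^ k * (pp α β (n + i) x * pp α β (n + (j + 1)) x)) := by
      intro x
      have := pp_rec (ok0 ha hb (n + i)) x
      rw [show n + i + 1 = n + (i + 1) by omega, show n + i + 2 = n + (i + 2) by omega] at this
      linear_combination (x ^ k * pp α β (n + (j + 1)) x) * this
    rw [J_congr hrec, J_add ha.le hb.le (by fun_prop) (by fun_prop),
      J_add ha.le hb.le (by fun_prop) (by fun_prop), J_smul, J_smul, J_smul]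

/-- the limit functional -/
noncomputable def TT (f : ℝ → ℝ) : ℝ := ∫ x in (-1 : ℝ)..1, f x * ((2 / Real.pi) * √(1 - x ^ 2))

lemma TT_pow (k : ℕ) : TT (fun x => x ^ k) = 2 * cc k 0 - 2 * cc (k + 1) 1 := by
  have h := intervalIntegral.integral_comp_mul_deriv (a := Real.pi) (b := 0) (f := Real.cos)
    (f' := fun x => -Real.sin x) (g := fun x => x ^ k * ((2 / Real.pi) * √(1 - x ^ 2)))
    (fun x _ => Real.hasDerivAt_cos x) (by fun_prop) (by fun_prop)
  rw [Real.cos_pi, Real.cos_zero] at h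
  rw [TT, ← h, intervalIntegral.integral_symm, ← intervalIntegral.integral_neg]
  unfold cc
  rw [← mul_assoc, ← mul_assoc, ← intervalIntegral.integral_const_mul,
    ← intervalIntegral.integral_const_mul, ← intervalIntegral.integral_sub]
  · refine intervalIntegral.integral_congr fun θ hθ => ?_
    rw [Set.uIcc_of_le Real.pi_pos.le] at hθ
    simp only [Function.comp]
    rw [← Real.abs_sin_eq_sqrt_one_sub_cos_sq, abs_of_nonneg (Real.sin_nonneg_of_mem_Icc hθ)]
    simp only [Int.cast_zero, zero_mul, Real.cos_zero, Int.cast_one, one_mul]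
    have := Real.sin_sq_add_cos_sq θ
    linear_combination (2 / Real.pi) * Real.cos θ ^ k * this
  · exact Continuous.intervalIntegrable (by fun_prop) _ _
  · exact Continuous.intervalIntegrable (by fun_prop) _ _

lemma lim_pow (ha : 0 < α) (hb : 0 < β) (k : ℕ) :
    Tendsto (fun n : ℕ => J α β (fun x => x ^ k * Ep α β n x)) atTop (𝓝 (TT fun x => x ^ k)) := by
  have h1 := moments ha hb k 0 0
  have h2 := moments ha hb k 1 1
  have h3 := moments ha hb (k + 1) 1 0
  have h := (h1.add h2).add (h3.const_mul (-2))
  rw [TT_pow]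
  have e : cc k ((0 : ℕ) - (0 : ℕ) : ℤ) + cc k ((1 : ℕ) - (1 : ℕ) : ℤ) + -2 * cc (k + 1) ((1 : ℕ) - (0 : ℕ) : ℤ) =
    2 * cc k 0 - 2 * cc (k + 1) 1 := by
    simp; ring
  rw [e] at h
  refine h.congr fun n => ?_
  have c0 := continuous_pp α β n
  have c1 := continuous_pp α β (n + 1)
  simp only [add_zero]
  have : ∀ x, x ^ k * Ep α β n x = (x ^ k * (pp α β n x * pp α β n x) +
    x ^ k * (pp α β (n + 1) x * pp α β (n + 1) x)) +
    (-2) * (x ^ (k + 1) * (pp α β (n + 1) x * pp α β n x)) := by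
    intro x; unfold Ep En; ring
  rw [J_congr this, J_add ha.le hb.le (by fun_prop) (by fun_prop),
      J_add ha.le hb.le (by fun_prop) (by fun_prop), J_smul]

lemma TT_add {f g : ℝ → ℝ} (hf : Continuous f) (hg : Continuous g) :
    TT (fun x => f x + g x) = TT f + TT g := by
  unfold TT
  rw [← intervalIntegral.integral_add]
  · refine intervalIntegral.integral_congr fun x _ => ?_
    simp only; ring
  · exact Continuous.intervalIntegrable (by fun_prop) _ _
  · exact Continuous.intervalIntegrable (by fun_prop) _ _

lemma TT_smul (c : ℝ) (f : ℝ → ℝ) : TT (fun x => c * f x) = c * TT f := by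
  unfold TT
  rw [← intervalIntegral.integral_const_mul]
  refine intervalIntegral.integral_congr fun x _ => ?_
  simp only; ring

lemma lim_poly (ha : 0 < α) (hb : 0 < β) (p : Polynomial ℝ) :
    Tendsto (fun n : ℕ => J α β (fun x => p.eval x * Ep α β n x)) atTop (𝓝 (TT fun x => p.eval x)) := by
  induction p using Polynomial.induction_on' with
  | add p q hp hq =>
    simp only [Polynomial.eval_add]
    rw [TT_add (by fun_prop) (by fun_prop)]
    refine (hp.add hq).congr fun n => ?_
    have c0 := continuous_Ep α β n
    rw [← J_add ha.le hb.le (by fun_prop) (by fun_prop)]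
    exact J_congr fun x => by ring
  | monomial k c =>
    simp only [Polynomial.eval_monomial]
    rw [TT_smul]
    refine ((lim_pow ha hb k).const_mul c).congr fun n => ?_
    rw [← J_smul]
    exact J_congr fun x => by ring

lemma Ep_nonneg {n : ℕ} {x : ℝ} (hx : x ∈ Set.Icc (-1 : ℝ) 1) : 0 ≤ Ep α β n x := by
  have := En_lower (p := fun n => pp α β n x) (δ := 0) (x := x) (by simpa using abs_le.2 hx) n
  simpa [Ep] using this

lemma lim_cont (ha : 0 < α) (hb : 0 < β) {f : ℝ → ℝ} (hf : Continuous f) :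
    Tendsto (fun n : ℕ => J α β (fun x => f x * Ep α β n x)) atTop (𝓝 (TT f)) := by
  have h1 : Tendsto (fun n : ℕ => J α β (fun x => Ep α β n x)) atTop (𝓝 (TT fun _ => 1)) := by
    simpa using lim_pow ha hb 0
  obtain ⟨B, hB⟩ := h1.bddAbove_range
  have hB' : ∀ n, J α β (fun x => Ep α β n x) ≤ B := fun n => hB ⟨n, rfl⟩
  set D := max B (TT fun _ => 1) with hD
  have key1 : ∀ ε > 0, ∀ p : Polynomial ℝ, (∀ x ∈ Set.Icc (-1 : ℝ) 1, |p.eval x - f x| < ε) →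
      ∀ n, |J α β (fun x => f x * Ep α β n x) - J α β (fun x => p.eval x * Ep α β n x)| ≤ ε * D := by
    intro ε hε p hp n
    have c0 := continuous_Ep α β n
    have cw := continuous_ww ha.le hb.le
    refine le_trans ?_ (mul_le_mul_of_nonneg_left ((hB' n).trans (le_max_left _ _)) hε.le)
    unfold J
    rw [← intervalIntegral.integral_sub (Continuous.intervalIntegrable (by fun_prop) _ _)
      (Continuous.intervalIntegrable (by fun_prop) _ _), ← intervalIntegral.integral_const_mul,
      ← Real.norm_eq_abs]
    refine intervalIntegral.norm_integral_le_of_norm_le (by norm_num) ?_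
      (Continuous.intervalIntegrable (by fun_prop) _ _)
    refine Eventually.of_forall fun x hx => ?_
    have hx' : x ∈ Set.Icc (-1 : ℝ) 1 := ⟨hx.1.le, hx.2⟩
    have e1 := Ep_nonneg (α := α) (β := β) (n := n) hx'
    have e2 := ww_nonneg (α := α) (β := β) hx'
    rw [Real.norm_eq_abs, ← sub_mul, ← sub_mul, mul_assoc, abs_mul, abs_of_nonneg (mul_nonneg e1 e2),
      abs_sub_comm]
    exact mul_le_mul_of_nonneg_right (hp x hx').le (mul_nonneg e1 e2)
  have key2 : ∀ ε > 0, ∀ p : Polynomial ℝ, (∀ x ∈ Set.Icc (-1 : ℝ) 1, |p.eval x - f x| < ε) →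
      |TT f - TT (fun x => p.eval x)| ≤ ε * D := by
    intro ε hε p hp
    refine le_trans ?_ (mul_le_mul_of_nonneg_left (le_max_right _ _) hε.le)
    unfold TT
    rw [← intervalIntegral.integral_sub (Continuous.intervalIntegrable (by fun_prop) _ _)
      (Continuous.intervalIntegrable (by fun_prop) _ _), ← intervalIntegral.integral_const_mul,
      ← Real.norm_eq_abs]
    refine intervalIntegral.norm_integral_le_of_norm_le (by norm_num) ?_
      (Continuous.intervalIntegrable (by fun_prop) _ _)
    refine Eventually.of_forall fun x hx => ?_
    have hx' : x ∈ Set.Icc (-1 : ℝ) 1 := ⟨hx.1.le, hx.2⟩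
    have e1 : 0 ≤ (2 / Real.pi) * √(1 - x ^ 2) := by positivity
    rw [Real.norm_eq_abs, ← sub_mul, abs_mul, abs_of_nonneg e1, abs_sub_comm, one_mul]
    exact mul_le_mul_of_nonneg_right (hp x hx').le e1
  rw [Metric.tendsto_atTop]
  intro ε hε
  have hD0 : 0 ≤ |D| := abs_nonneg _
  set η := ε / (3 * (|D| + 1)) with hη
  have hη0 : 0 < η := by positivity
  obtain ⟨p, hp⟩ := exists_polynomial_near_of_continuousOn (-1) 1 f hf.continuousOn η hη0
  have hηD : η * D ≤ ε / 3 := by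
    rw [hη, div_mul_eq_mul_div, div_le_div_iff₀ (by positivity) (by norm_num)]
    nlinarith [le_abs_self D]
  obtain ⟨N, hN⟩ := Metric.tendsto_atTop.1 (lim_poly ha hb p) (ε / 3) (by positivity)
  refine ⟨N, fun n hn => ?_⟩
  have a1 := abs_le.1 ((key1 η hη0 p hp n).trans hηD)
  have a2 := abs_le.1 ((key2 η hη0 p hp).trans hηD)
  have a3 := hN n hn
  rw [Real.dist_eq] at a3 ⊢
  have a3 := abs_lt.1 a3
  rw [abs_lt]
  constructor <;> linarith [a1.1, a1.2, a2.1, a2.2, a3.1, a3.2]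

end
end JacobiAux

namespace JacobiAux

lemma good_base (α β : ℝ) (ha1 : 1 < α) (hb1 : 1 < β) : Good α β := by
  have ha : 0 < α := by linarith
  have hb : 0 < β := by linarith
  obtain ⟨L, hL⟩ := exists_limit α β
  have cw := continuous_ww ha.le hb.le
  have hpt : ∀ x ∈ Set.Ioo (-1 : ℝ) 1, Tendsto (fun n => Ep α β n x) atTop (𝓝 (L x)) := by
    intro x hx
    have := abs_lt.2 hx
    exact (hL (1 - |x|) (by linarith)).tendsto_at (show |x| ≤ 1 - (1 - |x|) by linarith)
  have hLc : ContinuousOn L (Set.Ioo (-1 : ℝ) 1) := by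
    intro x hx
    have hx' := abs_lt.2 hx
    have h1 : ContinuousOn L {y | |y| ≤ 1 - (1 - |x|) / 2} :=
      (hL ((1 - |x|) / 2) (by linarith)).continuousOn
        (Frequently.of_forall fun n => (continuous_Ep α β n).continuousOn)
    refine (h1.continuousAt ?_).continuousWithinAt
    have : {y : ℝ | |y| < 1 - (1 - |x|) / 2} ∈ 𝓝 x :=
      (isOpen_lt continuous_abs continuous_const).mem_nhds (by simp only [Set.mem_ofPred_eq]; linarith)
    exact mem_of_superset this fun y hy => (show |y| < _ from hy).le
  set g : ℝ → ℝ := fun x => L x * ww α β x - (2 / Real.pi) * √(1 - x ^ 2) with hg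
  have hgc : ContinuousOn g (Set.Ioo (-1 : ℝ) 1) := by
    refine (hLc.mul cw.continuousOn).sub (Continuous.continuousOn ?_)
    fun_prop
  have hae := isOpen_Ioo.ae_eq_zero_of_integral_contDiff_smul_eq_zero
    (μ := MeasureTheory.volume) (f := g) (U := Set.Ioo (-1 : ℝ) 1)
    (hgc.locallyIntegrableOn measurableSet_Ioo) ?_
  · have heq : Set.EqOn g 0 (Set.Ioo (-1 : ℝ) 1) := by
      refine MeasureTheory.Measure.eqOn_open_of_ae_eq (μ := MeasureTheory.volume) ?_ isOpen_Ioo hgc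
        continuousOn_const
      exact (MeasureTheory.ae_restrict_iff' measurableSet_Ioo).2 hae
    intro x hx
    convert hpt x hx using 2
    have h0 := heq hx
    simp only [hg, Pi.zero_apply, ww] at h0
    have h1 : 0 < 1 - x := by linarith [hx.2]
    have h2 : 0 < 1 + x := by linarith [hx.1]
    have e0 : √(1 - x ^ 2) = (1 - x) ^ (1 / 2 : ℝ) * (1 + x) ^ (1 / 2 : ℝ) := by
      rw [← Real.mul_rpow h1.le h2.le, Real.sqrt_eq_rpow]; congr 1; ring
    rw [e0] at h0
    rw [Real.rpow_sub h1, Real.rpow_sub h2]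
    have p1 : 0 < (1 - x) ^ α := by positivity
    have p2 : 0 < (1 + x) ^ β := by positivity
    rw [div_mul_div_comm, ← mul_div_assoc, div_eq_iff (by positivity)]
    linear_combination -h0
  · intro f hf hfc hfs
    have hfcont : Continuous f := hf.continuous
    -- support is inside a smaller interval
    obtain ⟨δ, hδ, hsupp⟩ : ∃ δ > 0, ∀ x, 1 - δ < |x| → f x = 0 := by
      have hK : IsCompact (tsupport f) := hfc
      rcases (tsupport f).eq_empty_or_nonempty with he | hne
      · refine ⟨1, one_pos, fun x _ => ?_⟩
        exact image_eq_zero_of_notMem_tsupport (by rw [he]; exact Set.notMem_empty x)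
      · obtain ⟨x0, hx0, hmax⟩ := hK.exists_isMaxOn hne continuous_abs.continuousOn
        have := abs_lt.2 (hfs hx0)
        refine ⟨1 - |x0|, by linarith, fun x hx => ?_⟩
        refine image_eq_zero_of_notMem_tsupport fun hmem => ?_
        have := hmax hmem
        simp only [Set.mem_ofPred_eq] at this
        linarith
    obtain ⟨n0, -, hM⟩ := loc_bound α β
    obtain ⟨M, hM0, hM⟩ := hM δ hδ
    have hlim : Tendsto (fun n : ℕ => J α β (fun x => f x * Ep α β n x)) atTop
        (𝓝 (∫ x in (-1 : ℝ)..1, f x * L x * ww α β x)) := by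
      unfold J
      refine intervalIntegral.tendsto_integral_filter_of_dominated_convergence
        (fun x => |f x| * M * |ww α β x|) ?_ ?_ ?_ ?_
      · refine Eventually.of_forall fun n => ?_
        have := continuous_Ep α β n
        exact (by fun_prop : Continuous fun x => f x * Ep α β n x * ww α β x).aestronglyMeasurable
      · filter_upwards [eventually_ge_atTop n0] with n hn
        refine Eventually.of_forall fun x _ => ?_
        rw [Real.norm_eq_abs, abs_mul, abs_mul]
        by_cases hx : |x| ≤ 1 - δ
        · have := hM x hx n hn
          rw [abs_of_nonneg this.1]
          gcongr
          exact this.2.1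
        · rw [hsupp x (not_le.1 hx)]; simp
      · exact (by fun_prop : Continuous fun x => |f x| * M * |ww α β x|).intervalIntegrable _ _
      · refine Eventually.of_forall fun x _ => ?_
        by_cases hx : |x| ≤ 1 - δ
        · have hx' := hpt x (abs_lt.1 (by linarith))
          exact (hx'.const_mul _).mul_const _
        · simp only [hsupp x (not_le.1 hx), zero_mul]; exact tendsto_const_nhds
    have huniq := tendsto_nhds_unique hlim (lim_cont ha hb hfcont)
    have hfL : Continuous (fun x => f x * L x) := by
      rw [continuous_iff_continuousAt]
      intro x
      by_cases hx : x ∈ Set.Ioo (-1 : ℝ) 1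
      · exact hfcont.continuousAt.mul (hLc.continuousAt (isOpen_Ioo.mem_nhds hx))
      · have hx2 : x ∉ tsupport f := fun h => hx (hfs h)
        have hev : (fun x => f x * L x) =ᶠ[𝓝 x] fun _ => 0 := by
          filter_upwards [(isClosed_tsupport f).isOpen_compl.mem_nhds hx2] with y hy
          rw [image_eq_zero_of_notMem_tsupport hy, zero_mul]
        exact continuousAt_const.congr hev.symm
    have hfg0 : ∫ x in (-1 : ℝ)..1, f x * g x = 0 := by
      have : ∀ x, f x * g x = f x * L x * ww α β x - f x * ((2 / Real.pi) * √(1 - x ^ 2)) := by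
        intro x; rw [hg]; ring
      simp only [this]
      rw [intervalIntegral.integral_sub, huniq, TT, sub_self]
      · exact (hfL.mul cw).intervalIntegrable _ _
      · exact Continuous.intervalIntegrable (by fun_prop) _ _
    rw [intervalIntegral.integral_of_le (by norm_num),
      MeasureTheory.setIntegral_eq_integral_of_forall_compl_eq_zero] at hfg0
    · simpa using hfg0
    · intro x hx
      have : x ∉ tsupport f := fun h => hx ⟨(hfs h).1, (hfs h).2.le⟩
      rw [image_eq_zero_of_notMem_tsupport this, zero_mul]

lemma good (α β : ℝ) : Good α β := good_all good_base α β

end JacobiAux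

open JacobiAux

theorem truncated_green_jacobi_asymptotics (α β : ℝ) :
    (∀ x ∈ Set.Ioo (-1 : ℝ) 1,
      Tendsto
        (fun N : ℕ => (N : ℝ) *
          ∑' n : ℕ,
            (((n + N + 1).factorial : ℝ) * (2 * ((n + N + 1 : ℕ) : ℝ) + α + β + 1) *
                Real.Gamma (((n + N + 1 : ℕ) : ℝ) + α + β + 1) /
              ((2 : ℝ) ^ (α + β + 1) * Real.Gamma (((n + N + 1 : ℕ) : ℝ) + α + 1) *
                Real.Gamma (((n + N + 1 : ℕ) : ℝ) + β + 1))) *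
              (jacobiP α β (n + N + 1) x ^ 2 /
                (((n + N + 1 : ℕ) : ℝ) * (((n + N + 1 : ℕ) : ℝ) + α + β + 1))))
        atTop
        (nhds ((1 - x) ^ (-α - 1 / 2) * (1 + x) ^ (-β - 1 / 2) / Real.pi))) ∧
    (∀ x ∈ Set.Ioo (-1 : ℝ) 1, ∀ y ∈ Set.Ioo (-1 : ℝ) 1, x ≠ y → ∀ γ : ℝ, γ < 2 →
      Tendsto
        (fun N : ℕ => (N : ℝ) ^ γ *
          ∑' n : ℕ,
            (((n + N + 1).factorial : ℝ) * (2 * ((n + N + 1 : ℕ) : ℝ) + α + β + 1) *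
                Real.Gamma (((n + N + 1 : ℕ) : ℝ) + α + β + 1) /
              ((2 : ℝ) ^ (α + β + 1) * Real.Gamma (((n + N + 1 : ℕ) : ℝ) + α + 1) *
                Real.Gamma (((n + N + 1 : ℕ) : ℝ) + β + 1))) *
              (jacobiP α β (n + N + 1) x * jacobiP α β (n + N + 1) y /
                (((n + N + 1 : ℕ) : ℝ) * (((n + N + 1 : ℕ) : ℝ) + α + β + 1))))
        atTop (nhds 0)) := by
  obtain ⟨n0, hok⟩ := exists_ok α β
  constructor
  · intro x hx
    have h := diag_lim α β hx (good α β x hx) (α + β + 1)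
    have e : 2 / Real.pi * ((1 - x) ^ (1 / 2 - α) * (1 + x) ^ (1 / 2 - β)) / (2 * (1 - x ^ 2)) =
        (1 - x) ^ (-α - 1 / 2) * (1 + x) ^ (-β - 1 / 2) / Real.pi := by
      have h1 : 0 < 1 - x := by linarith [hx.2]
      have h2 : 0 < 1 + x := by linarith [hx.1]
      rw [show 1 / 2 - α = -α - 1 / 2 + 1 by ring, show 1 / 2 - β = -β - 1 / 2 + 1 by ring,
        Real.rpow_add_one h1.ne', Real.rpow_add_one h2.ne', show 1 - x ^ 2 = (1 - x) * (1 + x) by ring]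
      have := Real.pi_pos
      field_simp
    rw [e] at h
    refine h.congr' ?_
    filter_upwards [eventually_ge_atTop n0] with N hN
    congr 1
    refine tsum_congr fun n => ?_
    rw [pp_sq (hok (n + N + 1) (by omega)), gg, KK]
    simp only [div_eq_mul_inv, ← add_assoc]
    ring
  · intro x hx y hy hxy γ hγ
    refine (off_lim α β hx hy hxy (α + β + 1) hγ).congr' ?_
    filter_upwards [eventually_ge_atTop n0] with N hN
    congr 1
    refine tsum_congr fun n => ?_
    rw [pp_sq (hok (n + N + 1) (by omega)), gg, KK]
    simp only [div_eq_mul_inv, ← add_assoc]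
    ring
end

section
/- For all x, y ∈ (−1,1), lim_{N→∞} N · Σ_{n=N+1}^∞ (2n+1)·P_n(x)·P_n(y) / (2n(n+1)) equals 1/(π√(1−x²)) if x = y, and equals 0 if x ≠ y. -/
open Filter Topology

/-- The Legendre polynomials `P_n = P_n^{(0,0)}`. -/
noncomputable def legendreP (n : ℕ) (x : ℝ) : ℝ := jacobiP 0 0 n x

/-- Coefficients of the Legendre polynomials in powers of `(x-1)/2`, for a real index. -/
noncomputable def lcoef (r : ℝ) : ℕ → ℝ
  | 0 => 1
  | k + 1 => lcoef r k * ((r - k) * (r + k + 1)) / ((k : ℝ) + 1) ^ 2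

lemma lcoef_succ (r : ℝ) (k : ℕ) :
    lcoef r (k + 1) * ((k : ℝ) + 1) ^ 2 = lcoef r k * ((r - k) * (r + k + 1)) := by
  have : ((k : ℝ) + 1) ≠ 0 := by positivity
  rw [lcoef]; field_simp

lemma lcoef_A (r : ℝ) (k : ℕ) :
    lcoef r (k + 1) * ((k : ℝ) + 1) ^ 2 = lcoef (r + 1) k * ((r - k + 1) * (r - k)) := by
  induction k with
  | zero => simp only [lcoef]; push_cast; ring
  | succ k ih =>
    have h0 : ((k : ℝ) + 1) ^ 2 ≠ 0 := by positivity
    have h2 := lcoef_succ r (k + 1)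
    have h3 := lcoef_succ (r + 1) k
    rw [h2]
    apply mul_right_cancel₀ h0
    push_cast
    linear_combination ((r - k - 1) * (r + k + 2)) * ih - ((r - k) * (r - k - 1)) * h3

lemma lcoef_B (r : ℝ) (k : ℕ) :
    lcoef (r + 1) (k + 1) * ((k : ℝ) + 1) ^ 2 = lcoef r k * ((r + k + 1) * (r + k + 2)) := by
  induction k with
  | zero => simp only [lcoef]; push_cast; ring
  | succ k ih =>
    have h0 : ((k : ℝ) + 1) ^ 2 ≠ 0 := by positivity
    have h2 := lcoef_succ (r + 1) (k + 1)
    have h3 := lcoef_succ r k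
    rw [h2]
    apply mul_right_cancel₀ h0
    push_cast
    linear_combination ((r - k) * (r + k + 3)) * ih - ((r + k + 2) * (r + k + 3)) * h3

lemma lcoef_rec (r : ℝ) (k : ℕ) :
    (r + 2) * lcoef (r + 2) (k + 1) =
      (2 * r + 3) * (lcoef (r + 1) (k + 1) + 2 * lcoef (r + 1) k) - (r + 1) * lcoef r (k + 1) := by
  have h0 : ((k : ℝ) + 1) ^ 2 ≠ 0 := by positivity
  have hA := lcoef_A r k
  have hB := lcoef_B (r + 1) k
  have hS := lcoef_succ (r + 1) k
  rw [show r + 1 + 1 = r + 2 by ring] at hB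
  apply mul_right_cancel₀ h0
  linear_combination (r + 2) * hB - (2 * r + 3) * hS + (r + 1) * hA

lemma lcoef_zero_of_lt (n k : ℕ) (h : n < k) : lcoef (n : ℝ) k = 0 := by
  induction k with
  | zero => omega
  | succ k ih =>
    rcases Nat.lt_succ_iff_lt_or_eq.mp h with h | h
    · simp [lcoef, ih h]
    · subst h; simp [lcoef]

lemma asc_fact (n k : ℕ) :
    (n.factorial : ℝ) * (ascPochhammer ℝ k).eval ((n : ℝ) + 1) = ((n + k).factorial : ℝ) := by
  induction k with
  | zero => simp
  | succ k ih =>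
    rw [ascPochhammer_succ_right, ← add_assoc, Nat.factorial_succ]
    simp only [Polynomial.eval_mul, Polynomial.eval_add, Polynomial.eval_X,
      Polynomial.eval_natCast]
    push_cast
    rw [← mul_assoc, ih]; ring

lemma lcoef_fact (n k : ℕ) (h : k ≤ n) :
    lcoef (n : ℝ) k * ((n - k).factorial * (k.factorial : ℝ) ^ 2) = ((n + k).factorial : ℝ) := by
  induction k with
  | zero => simp [lcoef]
  | succ k ih =>
    have ih := ih (by omega)
    obtain ⟨d, rfl⟩ : ∃ d, n = k + 1 + d := ⟨n - (k + 1), by omega⟩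
    have h1 := lcoef_succ ((k + 1 + d : ℕ) : ℝ) k
    have e1 : k + 1 + d - k = d + 1 := by omega
    have e2 : k + 1 + d - (k + 1) = d := by omega
    rw [e1] at ih
    rw [e2, ← add_assoc, Nat.factorial_succ (k + 1 + d + k), Nat.factorial_succ k]
    rw [Nat.factorial_succ d] at ih
    push_cast at *
    linear_combination (d.factorial * (k.factorial : ℝ) ^ 2) * h1 + ((k : ℝ) + 1 + d + k + 1) * ih

lemma legendreP_eq (n M : ℕ) (hM : n < M) (x : ℝ) :
    legendreP n x = ∑ k ∈ Finset.range M, lcoef (n : ℝ) k * ((x - 1) / 2) ^ k := by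
  have hsub : Finset.range (n + 1) ⊆ Finset.range M := by
    intro i; simp; omega
  rw [← Finset.sum_subset hsub]
  · unfold legendreP jacobiP
    rw [Finset.mul_sum]
    refine Finset.sum_congr rfl fun k hk => ?_
    have hk : k ≤ n := by simpa [Nat.lt_succ_iff] using hk
    rw [← mul_assoc]
    congr 1
    have h1 := asc_fact n k
    have h2 := asc_fact k (n - k)
    have h3 := lcoef_fact n k hk
    have h4 : ((n.choose k : ℕ) : ℝ) * k.factorial * (n - k).factorial = n.factorial := by
      exact_mod_cast Nat.choose_mul_factorial_mul_factorial hk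
    rw [Nat.add_sub_cancel' hk] at h2
    simp only [add_zero, zero_add]
    have f1 : (n.factorial : ℝ) ≠ 0 := by positivity
    have f2 : (k.factorial : ℝ) ≠ 0 := by positivity
    have f3 : ((n - k).factorial : ℝ) ≠ 0 := by positivity
    have e1 : (ascPochhammer ℝ k).eval ((n : ℝ) + 1) = ((n + k).factorial : ℝ) / n.factorial := by
      rw [eq_div_iff f1]; linarith
    have e2 : (ascPochhammer ℝ (n - k)).eval ((k : ℝ) + 1) = (n.factorial : ℝ) / k.factorial := by
      rw [eq_div_iff f2]; linarith
    have e3 : lcoef (n : ℝ) k =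
        ((n + k).factorial : ℝ) / ((n - k).factorial * (k.factorial : ℝ) ^ 2) := by
      rw [eq_div_iff (by positivity)]; exact h3
    have e4 : ((n.choose k : ℕ) : ℝ) = n.factorial / (k.factorial * (n - k).factorial) := by
      rw [eq_div_iff (by positivity)]; linarith
    rw [e1, e2, e3, e4]
    field_simp
  · intro k _ hk
    rw [lcoef_zero_of_lt n k (by simp at hk; omega), zero_mul]

lemma leg_zero (x : ℝ) : legendreP 0 x = 1 := by
  simp [legendreP, jacobiP]

lemma leg_one (x : ℝ) : legendreP 1 x = x := by
  rw [legendreP_eq 1 2 (by norm_num)]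
  simp [Finset.sum_range_succ, lcoef]
  ring

lemma leg_rec (n : ℕ) (x : ℝ) :
    ((n : ℝ) + 2) * legendreP (n + 2) x =
      (2 * n + 3) * x * legendreP (n + 1) x - (n + 1) * legendreP n x := by
  have h2 := legendreP_eq (n + 2) (n + 3 + 1) (by omega) x
  have h1 := legendreP_eq (n + 1) (n + 3 + 1) (by omega) x
  have h1' := legendreP_eq (n + 1) (n + 3) (by omega) x
  have h0 := legendreP_eq n (n + 3 + 1) (by omega) x
  have hx : x * legendreP (n + 1) x =
      legendreP (n + 1) x + 2 * (((x - 1) / 2) * legendreP (n + 1) x) := by ring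
  rw [mul_assoc (2 * (n : ℝ) + 3), hx]
  nth_rw 2 [h1']
  rw [Finset.sum_range_succ'] at h0 h1 h2
  rw [h2, h1, h0]
  simp only [Finset.mul_sum, mul_add]
  have key : ∀ k ∈ Finset.range (n + 3),
      ((n : ℝ) + 2) * (lcoef ((n + 2 : ℕ) : ℝ) (k + 1) * ((x - 1) / 2) ^ (k + 1)) =
      (2 * n + 3) * (lcoef ((n + 1 : ℕ) : ℝ) (k + 1) * ((x - 1) / 2) ^ (k + 1)) +
      (2 * n + 3) * (2 * ((x - 1) / 2 * (lcoef ((n + 1 : ℕ) : ℝ) k * ((x - 1) / 2) ^ k)))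
      - (n + 1) * (lcoef (n : ℝ) (k + 1) * ((x - 1) / 2) ^ (k + 1)) := by
    intro k _
    have := lcoef_rec n k
    push_cast
    linear_combination ((x - 1) / 2) ^ (k + 1) * this
  rw [Finset.sum_congr rfl key, Finset.sum_sub_distrib, Finset.sum_add_distrib]
  simp only [lcoef]
  ring

lemma leg_deriv (n : ℕ) (x : ℝ) (hx : x ∈ Set.Ioo (-1 : ℝ) 1) :
    HasDerivAt (legendreP n)
      (((n : ℝ) + 1) * (x * legendreP n x - legendreP (n + 1) x) / (1 - x ^ 2)) x ∧
    HasDerivAt (legendreP (n + 1))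
      (((n : ℝ) + 1) * (legendreP n x - x * legendreP (n + 1) x) / (1 - x ^ 2)) x := by
  have hpos : 0 < 1 - x ^ 2 := by nlinarith [hx.1, hx.2]
  induction n with
  | zero =>
    have e0 : legendreP 0 = fun _ => 1 := funext leg_zero
    have e1 : legendreP (0 + 1) = fun x => x := funext leg_one
    have v0 : (((0 : ℕ) : ℝ) + 1) * (x * legendreP 0 x - legendreP (0 + 1) x) / (1 - x ^ 2) = 0 := by
      rw [leg_zero, zero_add, leg_one]; simp
    have v1 : (((0 : ℕ) : ℝ) + 1) * (legendreP 0 x - x * legendreP (0 + 1) x) / (1 - x ^ 2) = 1 := by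
      rw [leg_zero, zero_add, leg_one, div_eq_one_iff_eq hpos.ne']; push_cast; ring
    rw [v0, v1, e0, e1]
    exact ⟨hasDerivAt_const x (1 : ℝ), hasDerivAt_id' x⟩
  | succ n ih =>
    obtain ⟨ih0, ih1⟩ := ih
    have hr := leg_rec n x
    have h2 : ((n : ℝ) + 2) ≠ 0 := by positivity
    constructor
    · convert ih1 using 1
      congr 1
      push_cast
      linear_combination -hr
    · have e : legendreP (n + 1 + 1) = fun x =>
        ((2 * n + 3) * (x * legendreP (n + 1) x) - (n + 1) * legendreP n x) / ((n : ℝ) + 2) := by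
        funext z
        rw [eq_div_iff h2]
        linear_combination leg_rec n z
      have hd := ((((hasDerivAt_id' x).mul ih1).const_mul (2 * (n : ℝ) + 3)).sub
        (ih0.const_mul ((n : ℝ) + 1))).div_const ((n : ℝ) + 2)
      rw [show ((n + 1 : ℕ) : ℝ) = n + 1 by push_cast; ring]
      have hv : ((n : ℝ) + 1 + 1) * (legendreP (n + 1) x - x * legendreP (n + 1 + 1) x) / (1 - x ^ 2)
          = ((2 * n + 3) * (1 * legendreP (n + 1) x + x * (((n : ℝ) + 1) *
            (legendreP n x - x * legendreP (n + 1) x) / (1 - x ^ 2))) - (n + 1) * (((n : ℝ) + 1) *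
            (x * legendreP n x - legendreP (n + 1) x) / (1 - x ^ 2))) / ((n : ℝ) + 2) := by
        have hr' : legendreP (n + 1 + 1) x = 
            ((2 * n + 3) * (x * legendreP (n + 1) x) - (n + 1) * legendreP n x) / ((n : ℝ) + 2) := by
          rw [eq_div_iff h2]
          linear_combination hr
        rw [hr']
        have := hpos.ne'
        field_simp
        ring
      rw [hv, e]
      exact hd

/-- The quadratic form in two consecutive Legendre polynomials. -/
noncomputable def legE (n : ℕ) (x : ℝ) : ℝ :=
  ((n : ℝ) + 1) * (legendreP n x ^ 2 - 2 * x * (legendreP n x * legendreP (n + 1) x)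
    + legendreP (n + 1) x ^ 2)

lemma legE_deriv (n : ℕ) (x : ℝ) (hx : x ∈ Set.Ioo (-1 : ℝ) 1) :
    HasDerivAt (legE n) (-2 * ((n : ℝ) + 1) * (legendreP n x * legendreP (n + 1) x)) x := by
  obtain ⟨h0, h1⟩ := leg_deriv n x hx
  have hpos : 0 < 1 - x ^ 2 := by nlinarith [hx.1, hx.2]
  have hd := (((h0.pow 2).sub (((hasDerivAt_id' x).const_mul 2).mul (h0.mul h1))).add
    (h1.pow 2)).const_mul ((n : ℝ) + 1)
  have e : legE n = fun x => ((n : ℝ) + 1) * (legendreP n x ^ 2 - 2 * x *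
    (legendreP n x * legendreP (n + 1) x) + legendreP (n + 1) x ^ 2) := rfl
  rw [e]
  refine hd.congr_deriv ?_
  have := hpos.ne'
  simp only [Pi.mul_apply]
  field_simp
  push_cast
  ring

lemma legE_bound_pos (n : ℕ) (x : ℝ) (h0 : 0 ≤ x) (h1 : x < 1) :
    legE n x * (1 - x) ≤ legE n 0 := by
  have hd : ∀ z ∈ Set.Icc 0 x, HasDerivAt (fun z => legE n z * (1 - z))
      (-2 * ((n : ℝ) + 1) * (legendreP n z * legendreP (n + 1) z) * (1 - z) + legE n z * (-1)) z := by
    intro z hz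
    exact (legE_deriv n z ⟨by linarith [hz.1], by linarith [hz.2]⟩).mul
      ((hasDerivAt_id' z).const_sub 1)
  have ha : AntitoneOn (fun z => legE n z * (1 - z)) (Set.Icc 0 x) := by
    apply antitoneOn_of_deriv_nonpos (convex_Icc 0 x)
    · exact fun z hz => (hd z hz).continuousAt.continuousWithinAt
    · exact fun z hz => (hd z (interior_subset hz)).differentiableAt.differentiableWithinAt
    · intro z hz
      have hz := interior_subset hz
      rw [(hd z hz).deriv]
      have : -2 * ((n : ℝ) + 1) * (legendreP n z * legendreP (n + 1) z) * (1 - z) + legE n z * (-1)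
        = -(((n : ℝ) + 1) * ((1 - z) * (legendreP n z + legendreP (n + 1) z) ^ 2 +
          z * (legendreP n z - legendreP (n + 1) z) ^ 2)) := by
        unfold legE; ring
      rw [this, neg_nonpos]
      have h3 : 0 ≤ 1 - z := by linarith [hz.2]
      have h4 := hz.1
      positivity
  have := ha ⟨le_refl 0, h0⟩ ⟨h0, le_refl x⟩ h0
  simpa using this

lemma legE_bound_neg (n : ℕ) (x : ℝ) (h0 : x ≤ 0) (h1 : -1 < x) :
    legE n x * (1 + x) ≤ legE n 0 := by
  have hd : ∀ z ∈ Set.Icc x 0, HasDerivAt (fun z => legE n z * (1 + z))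
      (-2 * ((n : ℝ) + 1) * (legendreP n z * legendreP (n + 1) z) * (1 + z) + legE n z * 1) z := by
    intro z hz
    exact (legE_deriv n z ⟨by linarith [hz.1], by linarith [hz.2]⟩).mul
      ((hasDerivAt_id' z).const_add 1)
  have ha : MonotoneOn (fun z => legE n z * (1 + z)) (Set.Icc x 0) := by
    apply monotoneOn_of_deriv_nonneg (convex_Icc x 0)
    · exact fun z hz => (hd z hz).continuousAt.continuousWithinAt
    · exact fun z hz => (hd z (interior_subset hz)).differentiableAt.differentiableWithinAt
    · intro z hz
      have hz := interior_subset hz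
      rw [(hd z hz).deriv]
      have : -2 * ((n : ℝ) + 1) * (legendreP n z * legendreP (n + 1) z) * (1 + z) + legE n z * 1
        = (((n : ℝ) + 1) * ((1 + z) * (legendreP n z - legendreP (n + 1) z) ^ 2 +
          (-z) * (legendreP n z + legendreP (n + 1) z) ^ 2)) := by
        unfold legE; ring
      rw [this]
      have h3 : 0 ≤ 1 + z := by linarith [hz.1]
      have h4 : 0 ≤ -z := by linarith [hz.2]
      positivity
  have := ha ⟨le_refl x, h0⟩ ⟨h0, le_refl 0⟩ h0
  simpa using this

lemma legE_bound (n : ℕ) (x : ℝ) (hx : |x| < 1) : legE n x * (1 - |x|) ≤ legE n 0 := by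
  rcases le_total 0 x with h | h
  · rw [abs_of_nonneg h] at *; exact legE_bound_pos n x h hx
  · rw [abs_of_nonpos h] at *
    have := legE_bound_neg n x h (by linarith)
    rwa [sub_neg_eq_add]

lemma legE_lower (n : ℕ) (x : ℝ) :
    ((n : ℝ) + 1) * (1 - |x|) * (legendreP n x ^ 2 + legendreP (n + 1) x ^ 2) ≤ legE n x := by
  unfold legE
  rw [mul_assoc]
  apply mul_le_mul_of_nonneg_left _ (by positivity)
  have h1 : 2 * x * (legendreP n x * legendreP (n + 1) x) ≤
      |x| * (2 * (|legendreP n x| * |legendreP (n + 1) x|)) := by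
    calc _ ≤ |2 * x * (legendreP n x * legendreP (n + 1) x)| := le_abs_self _
      _ = _ := by rw [abs_mul, abs_mul, abs_mul, abs_two]; ring
  have h2 : 2 * (|legendreP n x| * |legendreP (n + 1) x|) ≤
      legendreP n x ^ 2 + legendreP (n + 1) x ^ 2 := by
    nlinarith [sq_nonneg (|legendreP n x| - |legendreP (n + 1) x|), sq_abs (legendreP n x),
      sq_abs (legendreP (n + 1) x)]
  nlinarith [mul_le_mul_of_nonneg_left h2 (abs_nonneg x)]

lemma leg_sq_bound (n : ℕ) (x : ℝ) (hx : |x| < 1) :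
    legendreP n x ^ 2 + legendreP (n + 1) x ^ 2 ≤ legE n 0 / (((n : ℝ) + 1) * (1 - |x|) ^ 2) := by
  have h3 : 0 < 1 - |x| := by linarith
  rw [le_div_iff₀ (by positivity)]
  have h1 := legE_lower n x
  have h2 := legE_bound n x hx
  nlinarith [mul_le_mul_of_nonneg_right h1 h3.le]

/-- Corrected energy, nearly independent of `x`. -/
noncomputable def legW (n : ℕ) (x : ℝ) : ℝ :=
  (legE n x - (legendreP n x ^ 2 - legendreP (n + 1) x ^ 2) / 2) / Real.sqrt (1 - x ^ 2)

lemma legW_deriv (n : ℕ) (x : ℝ) (hx : x ∈ Set.Ioo (-1 : ℝ) 1) :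
    HasDerivAt (legW n) (-((legendreP n x ^ 2 - legendreP (n + 1) x ^ 2) / 2 * x) /
      ((1 - x ^ 2) * Real.sqrt (1 - x ^ 2))) x := by
  obtain ⟨h0, h1⟩ := leg_deriv n x hx
  have hE := legE_deriv n x hx
  have hpos : 0 < 1 - x ^ 2 := by nlinarith [hx.1, hx.2]
  have hs : HasDerivAt (fun x : ℝ => Real.sqrt (1 - x ^ 2)) (-(2 * x) / (2 * Real.sqrt (1 - x ^ 2))) x := by
    have := ((hasDerivAt_pow 2 x).const_sub 1).sqrt hpos.ne'
    simpa using this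
  have hsp : 0 < Real.sqrt (1 - x ^ 2) := Real.sqrt_pos.mpr hpos
  have hd := (hE.sub (((h0.pow 2).sub (h1.pow 2)).div_const 2)).div hs hsp.ne'
  have e : legW n = fun x => (legE n x - (legendreP n x ^ 2 - legendreP (n + 1) x ^ 2) / 2) /
    Real.sqrt (1 - x ^ 2) := rfl
  rw [e]
  refine hd.congr_deriv ?_
  simp only [Pi.sub_apply, Pi.pow_apply]
  have hss : Real.sqrt (1 - x ^ 2) ^ 2 = 1 - x ^ 2 := Real.sq_sqrt hpos.le
  set w := Real.sqrt (1 - x ^ 2)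
  rw [← hss]
  unfold legE
  field_simp
  have hx2 : x ^ 2 = 1 - w ^ 2 := by linarith
  push_cast
  ring_nf
  simp only [hx2]
  ring

lemma legW_close (n : ℕ) (x : ℝ) (hx : |x| < 1) :
    |legW n x - legW n 0| ≤
      legE n 0 / (((n : ℝ) + 1) * (1 - |x|) ^ 2) / ((1 - x ^ 2) * Real.sqrt (1 - x ^ 2)) := by
  have hpos : 0 < 1 - x ^ 2 := by nlinarith [sq_abs x, abs_nonneg x]
  have hsp : 0 < Real.sqrt (1 - x ^ 2) := Real.sqrt_pos.mpr hpos
  set C := legE n 0 / (((n : ℝ) + 1) * (1 - |x|) ^ 2) / ((1 - x ^ 2) * Real.sqrt (1 - x ^ 2)) with hC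
  have hE0 : 0 ≤ legE n 0 := by unfold legE; simp; positivity
  have hC0 : 0 ≤ C := by positivity
  have habs : ∀ z ∈ Set.uIcc 0 x, |z| ≤ |x| := by
    intro z hz
    have := Set.abs_sub_left_of_mem_uIcc hz
    simpa using this
  have hb : ∀ z ∈ Set.uIcc 0 x, ‖-((legendreP n z ^ 2 - legendreP (n + 1) z ^ 2) / 2 * z) /
      ((1 - z ^ 2) * Real.sqrt (1 - z ^ 2))‖ ≤ C := by
    intro z hz
    have hzx := habs z hz
    have hz2 : z ^ 2 ≤ x ^ 2 := sq_le_sq.mpr hzx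
    have hposz : 0 < 1 - z ^ 2 := by linarith
    have hspz : 0 < Real.sqrt (1 - z ^ 2) := Real.sqrt_pos.mpr hposz
    rw [Real.norm_eq_abs, abs_div, abs_neg, abs_mul, abs_of_pos (mul_pos hposz hspz), hC]
    have h3 : 0 < 1 - |x| := by linarith
    apply div_le_div₀ (by positivity)
    · have hz1 : |z| ≤ 1 := by linarith
      calc _ ≤ |(legendreP n z ^ 2 - legendreP (n + 1) z ^ 2) / 2| * 1 := by gcongr
        _ ≤ legendreP n z ^ 2 + legendreP (n + 1) z ^ 2 := by
            rw [mul_one, abs_le]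
            constructor <;> nlinarith [sq_nonneg (legendreP n z), sq_nonneg (legendreP (n + 1) z)]
        _ ≤ legE n 0 / (((n : ℝ) + 1) * (1 - |z|) ^ 2) := leg_sq_bound n z (by linarith)
        _ ≤ _ := by gcongr
    · positivity
    · gcongr
  have hm := (convex_uIcc (0 : ℝ) x).norm_image_sub_le_of_norm_hasDerivWithin_le
    (f := legW n) (C := C)
    (fun z hz => (legW_deriv n z (by
      have := abs_lt.mp ((habs z hz).trans_lt hx); exact this)).hasDerivWithinAt)
    hb (Set.left_mem_uIcc) (Set.right_mem_uIcc)
  rw [Real.norm_eq_abs, Real.norm_eq_abs, sub_zero] at hm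
  nlinarith

lemma leg_zero_wallis (k : ℕ) :
    (2 * (k : ℝ) + 1) * legendreP (2 * k) 0 ^ 2 * Real.Wallis.W k = 1 ∧
    legendreP (2 * k + 1) 0 = 0 := by
  induction k with
  | zero => simp [leg_zero, leg_one, Real.Wallis.W]
  | succ k ih =>
    obtain ⟨h1, h2⟩ := ih
    have r1 := leg_rec (2 * k) 0
    have r2 := leg_rec (2 * k + 1) 0
    rw [h2] at r2
    have e : legendreP (2 * (k + 1)) 0 = -((2 * (k : ℝ) + 1) * legendreP (2 * k) 0) / (2 * k + 2) := by
      rw [eq_div_iff (by positivity)]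
      push_cast at r1
      linear_combination r1
    constructor
    · rw [Real.Wallis.W_succ, e]
      push_cast
      have : (2 * (k : ℝ) + 1) ≠ 0 := by positivity
      have : (2 * (k : ℝ) + 2) ≠ 0 := by positivity
      have : (2 * (k : ℝ) + 3) ≠ 0 := by positivity
      have h1' : Real.Wallis.W k = 1 / ((2 * (k : ℝ) + 1) * legendreP (2 * k) 0 ^ 2) := by
        rw [eq_div_iff (left_ne_zero_of_mul_eq_one h1)]; linarith
      have hL : legendreP (2 * k) 0 ≠ 0 := by
        intro h0; rw [h0] at h1; simp at h1
      rw [h1']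
      field_simp
      try ring
    · rw [show 2 * (k + 1) + 1 = 2 * k + 1 + 2 by ring]
      simp only [mul_zero, zero_mul, sub_zero] at r2
      have : ((2 * k + 1 : ℕ) : ℝ) + 2 ≠ 0 := by positivity
      exact (mul_eq_zero.mp r2).resolve_left this

lemma legE_zero_tendsto : Tendsto (fun n => legE n 0) atTop (𝓝 (2 / Real.pi)) := by
  have hW : Tendsto Real.Wallis.W atTop (𝓝 (Real.pi / 2)) := Real.Wallis.tendsto_W_nhds_pi_div_two
  have hWi : Tendsto (fun k => (Real.Wallis.W k)⁻¹) atTop (𝓝 (2 / Real.pi)) := by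
    have := hW.inv₀ (by positivity)
    rwa [inv_div] at this
  have hev : ∀ k : ℕ, legE (2 * k) 0 = (Real.Wallis.W k)⁻¹ := by
    intro k
    obtain ⟨h1, h2⟩ := leg_zero_wallis k
    unfold legE
    rw [h2, ← eq_inv_of_mul_eq_one_left h1]
    push_cast; ring
  have hod : ∀ k : ℕ, legE (2 * k + 1) 0 =
      (Real.Wallis.W (k + 1))⁻¹ * (1 - 1 / (2 * (k : ℝ) + 3)) := by
    intro k
    obtain ⟨-, h2⟩ := leg_zero_wallis k
    obtain ⟨h1, -⟩ := leg_zero_wallis (k + 1)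
    have h3 : (2 * (k : ℝ) + 3) ≠ 0 := by positivity
    have : (Real.Wallis.W (k + 1))⁻¹ = (2 * ((k + 1 : ℕ) : ℝ) + 1) * legendreP (2 * (k + 1)) 0 ^ 2 := by
      exact (eq_inv_of_mul_eq_one_left h1).symm
    rw [this]
    unfold legE
    rw [h2, show 2 * k + 1 + 1 = 2 * (k + 1) by ring]
    push_cast
    field_simp
    ring
  have hodt : Tendsto (fun k : ℕ => legE (2 * k + 1) 0) atTop (𝓝 (2 / Real.pi)) := by
    simp only [hod]
    have h1 := hWi.comp (tendsto_add_atTop_nat 1)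
    have h2 : Tendsto (fun k : ℕ => 1 - 1 / (2 * (k : ℝ) + 3)) atTop (𝓝 (1 - 0)) := by
      apply tendsto_const_nhds.sub
      apply tendsto_const_nhds.div_atTop
      apply tendsto_atTop_add_const_right
      exact tendsto_natCast_atTop_atTop.const_mul_atTop (by norm_num)
    simpa using h1.mul h2
  have hevt : Tendsto (fun k : ℕ => legE (2 * k) 0) atTop (𝓝 (2 / Real.pi)) := by
    simpa only [hev] using hWi
  rw [Metric.tendsto_atTop] at *
  intro ε hε
  obtain ⟨A, hA⟩ := hevt ε hε
  obtain ⟨B, hB⟩ := hodt ε hε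
  refine ⟨2 * A + 2 * B + 1, fun n hn => ?_⟩
  rcases Nat.even_or_odd' n with ⟨k, rfl | rfl⟩
  · exact hA k (by omega)
  · exact hB k (by omega)

lemma tendsto_inv_succ (c : ℝ) :
    Tendsto (fun n : ℕ => legE n 0 / (((n : ℝ) + 1) * c)) atTop (𝓝 0) := by
  have h := legE_zero_tendsto.mul (tendsto_one_div_add_atTop_nhds_zero_nat (𝕜 := ℝ))
  have h := h.mul_const c⁻¹
  simp only [mul_zero, zero_mul] at h
  refine h.congr fun n => ?_
  simp only [div_eq_mul_inv, mul_inv]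
  ring

lemma leg_sq_tendsto (x : ℝ) (hx : |x| < 1) :
    Tendsto (fun n => legendreP n x ^ 2 + legendreP (n + 1) x ^ 2) atTop (𝓝 0) :=
  squeeze_zero (fun n => by positivity) (fun n => leg_sq_bound n x hx) (tendsto_inv_succ _)

lemma leg_tendsto (x : ℝ) (hx : |x| < 1) :
    Tendsto (fun n => legendreP n x) atTop (𝓝 0) := by
  have : Tendsto (fun n => legendreP n x ^ 2) atTop (𝓝 0) :=
    squeeze_zero (fun n => by positivity) (fun n => by nlinarith [sq_nonneg (legendreP (n + 1) x)])
      (leg_sq_tendsto x hx)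
  have := this.sqrt
  simp only [Real.sqrt_sq_eq_abs, Real.sqrt_zero] at this
  exact (tendsto_zero_iff_abs_tendsto_zero _).mpr this

lemma legE_tendsto (x : ℝ) (hx : |x| < 1) :
    Tendsto (fun n => legE n x) atTop (𝓝 (2 / Real.pi * Real.sqrt (1 - x ^ 2))) := by
  have hpos : 0 < 1 - x ^ 2 := by nlinarith [sq_abs x, abs_nonneg x]
  have hsp : 0 < Real.sqrt (1 - x ^ 2) := Real.sqrt_pos.mpr hpos
  have hdiff : ∀ z : ℝ, |z| < 1 → Tendsto (fun n => (legendreP n z ^ 2 - legendreP (n + 1) z ^ 2) / 2)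
      atTop (𝓝 0) := by
    intro z hz
    have h := leg_tendsto z hz
    have h' := h.comp (tendsto_add_atTop_nat 1)
    simpa using ((h.pow 2).sub (h'.pow 2)).div_const 2
  have hW0 : Tendsto (fun n => legW n 0) atTop (𝓝 (2 / Real.pi)) := by
    have := legE_zero_tendsto.sub (hdiff 0 (by simp))
    rw [sub_zero] at this
    refine this.congr fun n => ?_
    simp [legW]
  have hWd : Tendsto (fun n => legW n x - legW n 0) atTop (𝓝 0) := by
    refine squeeze_zero_norm (fun n => legW_close n x hx) ?_
    simpa using (tendsto_inv_succ ((1 - |x|) ^ 2)).div_const ((1 - x ^ 2) * Real.sqrt (1 - x ^ 2))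
  have hWx : Tendsto (fun n => legW n x) atTop (𝓝 (2 / Real.pi)) := by
    simpa using hWd.add hW0
  have := (hWx.mul_const (Real.sqrt (1 - x ^ 2))).add (hdiff x hx)
  rw [add_zero] at this
  refine this.congr fun n => ?_
  unfold legW
  field_simp
  ring

/-- Partial sums of the Christoffel-Darboux kernel. -/
noncomputable def legS (x y : ℝ) (n : ℕ) : ℝ :=
  ∑ k ∈ Finset.range (n + 1), (2 * (k : ℝ) + 1) * legendreP k x * legendreP k y

lemma legS_diag (x : ℝ) (n : ℕ) : (1 - x ^ 2) * legS x x n = ((n : ℝ) + 1) * legE n x := by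
  induction n with
  | zero => simp [legS, legE, leg_zero, leg_one]; ring
  | succ n ih =>
    have hr := leg_rec n x
    have : legendreP (n + 1 + 1) x =
        ((2 * n + 3) * (x * legendreP (n + 1) x) - (n + 1) * legendreP n x) / ((n : ℝ) + 2) := by
      rw [eq_div_iff (by positivity)]
      linear_combination hr
    unfold legS at *
    rw [Finset.sum_range_succ, mul_add, ih]
    unfold legE
    rw [this]
    have : (n : ℝ) + 2 ≠ 0 := by positivity
    push_cast
    field_simp
    ring

lemma legS_off (x y : ℝ) (n : ℕ) : (x - y) * legS x y n = ((n : ℝ) + 1) *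
    (legendreP (n + 1) x * legendreP n y - legendreP n x * legendreP (n + 1) y) := by
  induction n with
  | zero => simp [legS, leg_zero, leg_one]
  | succ n ih =>
    have hr := leg_rec n x
    have hr' := leg_rec n y
    unfold legS at *
    rw [Finset.sum_range_succ, mul_add, ih]
    push_cast
    linear_combination -legendreP (n + 1) y * hr + legendreP (n + 1) x * hr'

lemma legS_tendsto (x y : ℝ) (hx : |x| < 1) (hy : |y| < 1) :
    Tendsto (fun n : ℕ => legS x y n / ((n : ℝ) + 1)) atTop
      (𝓝 (2 * (if x = y then 1 / (Real.pi * Real.sqrt (1 - x ^ 2)) else 0))) := by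
  split_ifs with h
  · subst h
    have hpos : 0 < 1 - x ^ 2 := by nlinarith [sq_abs x, abs_nonneg x]
    have hsp : 0 < Real.sqrt (1 - x ^ 2) := Real.sqrt_pos.mpr hpos
    have h1 := (legE_tendsto x hx).div_const (1 - x ^ 2)
    have e : 2 / Real.pi * Real.sqrt (1 - x ^ 2) / (1 - x ^ 2) =
        2 * (1 / (Real.pi * Real.sqrt (1 - x ^ 2))) := by
      have hss : Real.sqrt (1 - x ^ 2) ^ 2 = 1 - x ^ 2 := Real.sq_sqrt hpos.le
      have hpi := Real.pi_pos
      rw [← hss, Real.sqrt_sq hsp.le]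
      field_simp
    rw [e] at h1
    refine h1.congr fun n => ?_
    have := legS_diag x n
    rw [div_eq_div_iff hpos.ne' (by positivity)]
    linarith
  · have hne : x - y ≠ 0 := sub_ne_zero.mpr h
    have h1 := leg_tendsto x hx
    have h2 := leg_tendsto y hy
    have h3 := (((h1.comp (tendsto_add_atTop_nat 1)).mul h2).sub
      (h1.mul (h2.comp (tendsto_add_atTop_nat 1)))).div_const (x - y)
    simp only [mul_zero, sub_zero, zero_div] at h3 ⊢
    refine h3.congr fun n => ?_
    have := legS_off x y n
    simp only [Function.comp]
    rw [div_eq_div_iff hne (by positivity)]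
    linarith

lemma tele_hasSum (N : ℕ) :
    HasSum (fun n : ℕ => 1 / (((n : ℝ) + N + 1) * ((n : ℝ) + N + 2))) (1 / ((N : ℝ) + 1)) := by
  rw [hasSum_iff_tendsto_nat_of_nonneg (fun n => by positivity)]
  have e : ∀ m : ℕ, ∑ n ∈ Finset.range m, 1 / (((n : ℝ) + N + 1) * ((n : ℝ) + N + 2)) =
      1 / ((N : ℝ) + 1) - 1 / ((m : ℝ) + N + 1) := by
    intro m
    induction m with
    | zero => simp
    | succ m ih =>
      rw [Finset.sum_range_succ, ih]
      push_cast
      have h1 : (m : ℝ) + N + 1 ≠ 0 := by positivity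
      have h2 : (m : ℝ) + N + 2 ≠ 0 := by positivity
      have h3 : (m : ℝ) + 1 + N + 1 ≠ 0 := by positivity
      have h4 : (N : ℝ) + 1 ≠ 0 := by positivity
      field_simp
      ring
  simp only [e]
  have : Tendsto (fun m : ℕ => 1 / ((m : ℝ) + N + 1)) atTop (𝓝 0) := by
    apply tendsto_const_nhds.div_atTop
    apply tendsto_atTop_add_const_right
    apply tendsto_atTop_add_const_right
    exact tendsto_natCast_atTop_atTop
  simpa using (tendsto_const_nhds (x := 1 / ((N : ℝ) + 1))).sub this

lemma u_summable (u : ℕ → ℝ) (l : ℝ) (hu : Tendsto u atTop (𝓝 l)) (N : ℕ) :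
    Summable (fun n : ℕ => u (n + N) * (1 / (((n : ℝ) + N + 1) * ((n : ℝ) + N + 2)))) := by
  obtain ⟨C, hC⟩ := (hu.norm.bddAbove_range)
  refine Summable.of_norm_bounded ((tele_hasSum N).summable.mul_left C) fun n => ?_
  rw [norm_mul, Real.norm_of_nonneg (r := 1 / _) (by positivity)]
  apply mul_le_mul_of_nonneg_right _ (by positivity)
  exact hC ⟨n + N, rfl⟩

lemma u_tail (u : ℕ → ℝ) (l : ℝ) (hu : Tendsto u atTop (𝓝 l)) :
    Tendsto (fun N : ℕ => ((N : ℝ) + 1) *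
      ∑' n : ℕ, u (n + N) * (1 / (((n : ℝ) + N + 1) * ((n : ℝ) + N + 2)))) atTop (𝓝 l) := by
  rw [Metric.tendsto_atTop]
  intro ε hε
  obtain ⟨A, hA⟩ := Metric.tendsto_atTop.mp hu (ε / 2) (by positivity)
  refine ⟨A, fun N hN => ?_⟩
  have hs := u_summable u l hu N
  have ht := tele_hasSum N
  have hN1 : (0 : ℝ) < (N : ℝ) + 1 := by positivity
  have e : ((N : ℝ) + 1) * (∑' n : ℕ, u (n + N) * (1 / (((n : ℝ) + N + 1) * ((n : ℝ) + N + 2)))) - l =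
      ((N : ℝ) + 1) * ∑' n : ℕ, (u (n + N) - l) * (1 / (((n : ℝ) + N + 1) * ((n : ℝ) + N + 2))) := by
    have h2 := (hs.hasSum.sub (ht.mul_left l)).tsum_eq
    simp only [← sub_mul] at h2
    rw [h2]
    field_simp
  rw [Real.dist_eq, e, abs_mul, abs_of_pos hN1]
  have hb : ‖∑' n : ℕ, (u (n + N) - l) * (1 / (((n : ℝ) + N + 1) * ((n : ℝ) + N + 2)))‖ ≤
      ε / 2 * (1 / ((N : ℝ) + 1)) := by
    apply tsum_of_norm_bounded (ht.mul_left (ε / 2))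
    intro n
    rw [norm_mul, Real.norm_of_nonneg (r := 1 / _) (by positivity)]
    apply mul_le_mul_of_nonneg_right _ (by positivity)
    have := hA (n + N) (by omega)
    rw [Real.dist_eq] at this
    exact this.le
  rw [Real.norm_eq_abs] at hb
  calc _ ≤ ((N : ℝ) + 1) * (ε / 2 * (1 / ((N : ℝ) + 1))) := by gcongr
    _ = ε / 2 := by field_simp
    _ < ε := by linarith

lemma abel_tail (s : ℕ → ℝ) (l C : ℝ) (hb : ∀ n, |s (n + 1) - s n| ≤ C)
    (hs : Tendsto (fun n : ℕ => s n / ((n : ℝ) + 1)) atTop (𝓝 l)) :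
    Tendsto (fun N : ℕ => (N : ℝ) * ∑' n : ℕ, (s (n + N + 1) - s (n + N)) /
      (2 * ((n + N + 1 : ℕ) : ℝ) * (((n + N + 1 : ℕ) : ℝ) + 1))) atTop (𝓝 (l / 2)) := by
  have hq : Tendsto (fun n : ℕ => ((n : ℝ) + 1) / n) atTop (𝓝 1) := by
    have h := (tendsto_const_nhds (x := (1 : ℝ))).add (tendsto_one_div_atTop_nhds_zero_nat (𝕜 := ℝ))
    rw [add_zero] at h
    refine h.congr' ?_
    filter_upwards [eventually_gt_atTop 0] with n hn
    have : (n : ℝ) ≠ 0 := by positivity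
    field_simp
  have hu : Tendsto (fun n : ℕ => s n / n) atTop (𝓝 l) := by
    have h := hs.mul hq
    rw [mul_one] at h
    refine h.congr fun n => ?_
    have : (n : ℝ) + 1 ≠ 0 := by positivity
    rw [div_mul_div_cancel₀ this]
  have hqi : Tendsto (fun n : ℕ => (n : ℝ) / ((n : ℝ) + 1)) atTop (𝓝 1) := by
    have := hq.inv₀ one_ne_zero
    simpa using this
  have main := ((u_tail _ l hu).mul hqi).sub ((hs.div_const 2))
  rw [mul_one, show l - l / 2 = l / 2 by ring] at main
  refine main.congr' ?_
  filter_upwards [eventually_gt_atTop 0] with N hN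
  have hN0 : (0 : ℝ) < N := by exact_mod_cast hN
  have hN1 : (N : ℝ) + 1 ≠ 0 := by positivity
  have hsum := (u_summable _ l hu N).hasSum
  -- the telescoping part
  set f : ℕ → ℝ := fun n => s (n + N) / (2 * ((n : ℝ) + N) * ((n : ℝ) + N + 1)) with hf
  have hf0 : Tendsto f atTop (𝓝 0) := by
    have h1 := hs.comp (tendsto_add_atTop_nat N)
    have h2 : Tendsto (fun n : ℕ => 1 / (2 * ((n : ℝ) + N))) atTop (𝓝 0) := by
      apply tendsto_const_nhds.div_atTop
      apply Tendsto.const_mul_atTop (by norm_num)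
      apply tendsto_atTop_add_const_right
      exact tendsto_natCast_atTop_atTop
    have h3 := h1.mul h2
    rw [mul_zero] at h3
    refine h3.congr fun n => ?_
    simp only [Function.comp, hf]
    push_cast
    rw [div_mul_div_comm]
    ring
  have hterm : ∀ n : ℕ, (s (n + N + 1) - s (n + N)) /
      (2 * ((n + N + 1 : ℕ) : ℝ) * (((n + N + 1 : ℕ) : ℝ) + 1)) =
      s (n + N) / ((n + N : ℕ) : ℝ) * (1 / (((n : ℝ) + N + 1) * ((n : ℝ) + N + 2))) +
        (f (n + 1) - f n) := by
    intro n
    simp only [hf]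
    rw [show n + 1 + N = n + N + 1 by ring]
    push_cast
    have h1 : (n : ℝ) + N ≠ 0 := by positivity
    have h2 : (n : ℝ) + N + 1 ≠ 0 := by positivity
    have h3 : (n : ℝ) + N + 2 ≠ 0 := by positivity
    rw [show (n : ℝ) + 1 + N = n + N + 1 by ring, show (n : ℝ) + N + 1 + 1 = n + N + 2 by ring]
    field_simp
    ring
  have hsumT : Summable (fun n : ℕ => (s (n + N + 1) - s (n + N)) /
      (2 * ((n + N + 1 : ℕ) : ℝ) * (((n + N + 1 : ℕ) : ℝ) + 1))) := by
    refine Summable.of_norm_bounded ((tele_hasSum N).summable.mul_left (C / 2)) fun n => ?_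
    rw [norm_div, Real.norm_of_nonneg (r := 2 * _ * _) (by positivity), Real.norm_eq_abs]
    push_cast
    have h2 : (0 : ℝ) < (n : ℝ) + N + 1 := by positivity
    have h3 : (0 : ℝ) < (n : ℝ) + N + 2 := by positivity
    rw [show (n : ℝ) + N + 1 + 1 = n + N + 2 by ring]
    calc _ ≤ C / (2 * ((n : ℝ) + N + 1) * ((n : ℝ) + N + 2)) := by
          gcongr; exact hb (n + N)
      _ = _ := by field_simp
  have hsum' : Summable (fun n => f (n + 1) - f n) := by
    refine (hsumT.sub hsum.summable).congr fun n => ?_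
    rw [hterm n]; ring
  have htel : HasSum (fun n => f (n + 1) - f n) (0 - f 0) := by
    rw [hsum'.hasSum_iff_tendsto_nat]
    simp only [Finset.sum_range_sub]
    exact hf0.sub_const _
  simp only [hterm]
  rw [(hsum.add htel).tsum_eq]
  generalize (∑' n : ℕ, s (n + N) / ((n + N : ℕ) : ℝ) *
    (1 / (((n : ℝ) + N + 1) * ((n : ℝ) + N + 2)))) = T
  simp only [hf]
  simp only [Nat.cast_zero, zero_add]
  field_simp
  ring

lemma legS_bound (x y : ℝ) (hx : |x| < 1) (hy : |y| < 1) :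
    ∃ C, ∀ n, |legS x y (n + 1) - legS x y n| ≤ C := by
  obtain ⟨K, hK⟩ := legE_zero_tendsto.bddAbove_range
  refine ⟨3 / 2 * (K / (1 - |x|) ^ 2 + K / (1 - |y|) ^ 2), fun n => ?_⟩
  have hn : (0 : ℝ) < (n : ℝ) + 1 := by positivity
  have key : ∀ z : ℝ, |z| < 1 → ((n : ℝ) + 1) * legendreP (n + 1) z ^ 2 ≤ K / (1 - |z|) ^ 2 := by
    intro z hz
    have h3 : 0 < 1 - |z| := by linarith
    have h1 := leg_sq_bound n z hz
    have h2 : legE n 0 ≤ K := hK ⟨n, rfl⟩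
    calc ((n : ℝ) + 1) * legendreP (n + 1) z ^ 2
        ≤ ((n : ℝ) + 1) * (legE n 0 / (((n : ℝ) + 1) * (1 - |z|) ^ 2)) := by
          gcongr; nlinarith [sq_nonneg (legendreP n z)]
      _ = legE n 0 / (1 - |z|) ^ 2 := by field_simp
      _ ≤ _ := by gcongr
  have hX := key x hx
  have hY := key y hy
  have e : legS x y (n + 1) - legS x y n =
      (2 * (n : ℝ) + 3) * (legendreP (n + 1) x * legendreP (n + 1) y) := by
    unfold legS
    rw [Finset.sum_range_succ _ (n + 1)]
    push_cast
    ring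
  rw [e, abs_mul, abs_of_pos (by positivity)]
  have hp : |legendreP (n + 1) x * legendreP (n + 1) y| ≤
      (legendreP (n + 1) x ^ 2 + legendreP (n + 1) y ^ 2) / 2 := by
    rw [abs_le]
    constructor <;> nlinarith [sq_nonneg (legendreP (n + 1) x + legendreP (n + 1) y),
      sq_nonneg (legendreP (n + 1) x - legendreP (n + 1) y)]
  calc _ ≤ (3 * ((n : ℝ) + 1)) * ((legendreP (n + 1) x ^ 2 + legendreP (n + 1) y ^ 2) / 2) := by
        apply mul_le_mul _ hp (abs_nonneg _) (by positivity)
        linarith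
    _ ≤ _ := by linarith

/-- Asymptotic error in the eigenfunction expansion of the Green's function associated
with the Legendre polynomials. -/
theorem truncated_green_legendre_asymptotics (x y : ℝ)
    (hx : x ∈ Set.Ioo (-1 : ℝ) 1) (hy : y ∈ Set.Ioo (-1 : ℝ) 1) :
    Tendsto
      (fun N : ℕ => (N : ℝ) *
        ∑' n : ℕ,
          (2 * ((n + N + 1 : ℕ) : ℝ) + 1) * legendreP (n + N + 1) x * legendreP (n + N + 1) y /
            (2 * ((n + N + 1 : ℕ) : ℝ) * (((n + N + 1 : ℕ) : ℝ) + 1)))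
      atTop
      (nhds (if x = y then 1 / (Real.pi * Real.sqrt (1 - x ^ 2)) else 0)) := by
  have hx' : |x| < 1 := abs_lt.mpr hx
  have hy' : |y| < 1 := abs_lt.mpr hy
  obtain ⟨C, hC⟩ := legS_bound x y hx' hy'
  have h := abel_tail (legS x y) _ C hC (legS_tendsto x y hx' hy')
  rw [mul_div_cancel_left₀ _ (two_ne_zero)] at h
  refine h.congr fun N => ?_
  congr 1
  refine tsum_congr fun n => ?_
  congr 1
  unfold legS
  rw [Finset.sum_range_succ _ (n + N + 1)]
  ring
end

section
/- Fix α ∈ ℝ with α > −1. For every n ∈ ℕ, ∫_0^∞ x^{2α+1} e^{−2x} · L_n^{(α)}(x)² dx = Γ(n+α+1)·Γ(n+1/2)·Γ(α+3/2) / (2π·(Γ(n+1))²). -/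
open Filter Topology

/-- The associated Laguerre polynomials `L_n^{(α)}`. -/
noncomputable def assocLaguerre (α : ℝ) (n : ℕ) (x : ℝ) : ℝ :=
  ∑ k ∈ Finset.range (n + 1),
    (-1 : ℝ) ^ k *
      (Real.Gamma ((n : ℝ) + α + 1) /
        (Real.Gamma ((k : ℝ) + α + 1) * ((n - k).factorial : ℝ) * (k.factorial : ℝ))) * x ^ k

open Polynomial in
/-- Laguerre as a polynomial. -/
noncomputable def lagPoly (α : ℝ) (n : ℕ) : ℝ[X] :=
  ∑ k ∈ Finset.range (n + 1), monomial k ((-1 : ℝ) ^ k *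
      (Real.Gamma ((n : ℝ) + α + 1) /
        (Real.Gamma ((k : ℝ) + α + 1) * ((n - k).factorial : ℝ) * (k.factorial : ℝ))))

lemma lagPoly_eval (α : ℝ) (n : ℕ) (x : ℝ) : (lagPoly α n).eval x = assocLaguerre α n x := by
  simp [lagPoly, assocLaguerre, Polynomial.eval_finsetSum]

lemma lagPoly_coeff (α : ℝ) (n k : ℕ) : (lagPoly α n).coeff k = if k ≤ n then (-1 : ℝ) ^ k *
      (Real.Gamma ((n : ℝ) + α + 1) /
        (Real.Gamma ((k : ℝ) + α + 1) * ((n - k).factorial : ℝ) * (k.factorial : ℝ))) else 0 := by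
  simp [lagPoly, Polynomial.coeff_monomial]

lemma gam_succ (α : ℝ) (hα : α > -1) (k : ℕ) :
    Real.Gamma (((k + 1 : ℕ) : ℝ) + α + 1) = (k + α + 1) * Real.Gamma (k + α + 1) := by
  have : (k : ℝ) ≥ 0 := by positivity
  rw [← Real.Gamma_add_one (by linarith)]
  push_cast; ring_nf

lemma gam_pos (α : ℝ) (hα : α > -1) (k : ℕ) : 0 < Real.Gamma ((k : ℝ) + α + 1) := by
  have : (k : ℝ) ≥ 0 := by positivity
  exact Real.Gamma_pos_of_pos (by linarith)

open Polynomial in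
lemma lag_R1 (α : ℝ) (hα : α > -1) (m : ℕ) :
    X * derivative (lagPoly α (m + 1)) =
      C ((m : ℝ) + 1) * lagPoly α (m + 1) - C ((m : ℝ) + 1 + α) * lagPoly α m := by
  ext k
  have h1 : (X * derivative (lagPoly α (m + 1))).coeff k = k * (lagPoly α (m + 1)).coeff k := by
    cases k with
    | zero => simp
    | succ k => simp [coeff_X_mul, coeff_derivative]; ring
  rw [h1, coeff_sub, coeff_C_mul, coeff_C_mul, lagPoly_coeff, lagPoly_coeff, gam_succ α hα m]
  rcases lt_trichotomy k (m + 1) with h | h | h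
  · obtain ⟨d, rfl⟩ : ∃ d, m = k + d := ⟨m - k, by omega⟩
    rw [if_pos (by omega), if_pos (by omega), show k + d + 1 - k = d + 1 by omega,
      show k + d - k = d by omega, Nat.factorial_succ]
    have := (gam_pos α hα k).ne'
    push_cast
    field_simp
    ring
  · subst h
    simp
  · rw [if_neg (by omega), if_neg (by omega)]; simp

open Polynomial in
lemma lag_R2 (α : ℝ) (hα : α > -1) (m : ℕ) :
    X * derivative (lagPoly α m) =
      X * lagPoly α m - C ((m : ℝ) + 1 + α) * lagPoly α m + C ((m : ℝ) + 1) * lagPoly α (m + 1) := by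
  ext k
  cases k with
  | zero =>
    have := (gam_pos α hα 0).ne'
    simp only [CharP.cast_eq_zero] at this
    simp [lagPoly_coeff]
    have h := gam_succ α hα m
    push_cast at h
    rw [h, Nat.factorial_succ]
    push_cast
    field_simp
    ring
  | succ k =>
    rw [coeff_add, coeff_sub, coeff_X_mul, coeff_X_mul, coeff_C_mul, coeff_C_mul,
      coeff_derivative, lagPoly_coeff, lagPoly_coeff, lagPoly_coeff, gam_succ α hα m,
      gam_succ α hα k]
    have g := (gam_pos α hα k).ne'
    have g2 : (k : ℝ) + α + 1 ≠ 0 := by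
      have : (k : ℝ) ≥ 0 := by positivity
      linarith
    rcases lt_trichotomy k m with h | h | h
    · obtain ⟨d, rfl⟩ : ∃ d, m = k + 1 + d := ⟨m - (k + 1), by omega⟩
      rw [if_pos (by omega), if_pos (by omega), if_pos (by omega),
        show k + 1 + d + 1 - (k + 1) = d + 1 by omega,
        show k + 1 + d - (k + 1) = d by omega, show k + 1 + d - k = d + 1 by omega,
        Nat.factorial_succ, Nat.factorial_succ]
      push_cast
      field_simp
      ring
    · subst h
      rw [if_neg (by omega), if_pos (by omega), if_pos (by omega), Nat.factorial_succ]
      simp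
      field_simp
      ring
    · rw [if_neg (by omega), if_neg (by omega), if_neg (by omega)]; simp

lemma lag_integrable_pow (α : ℝ) (hα : α > -1) (k : ℕ) :
    MeasureTheory.IntegrableOn (fun x : ℝ => x ^ (2 * α + 1) * Real.exp (-2 * x) * x ^ k)
      (Set.Ioi 0) := by
  have hk : (k : ℝ) ≥ 0 := by positivity
  have h := integrableOn_rpow_mul_exp_neg_mul_rpow (s := 2 * α + 1 + k) (p := 1) (b := 2)
    (by linarith) one_pos two_pos
  refine h.congr_fun (fun x hx => ?_) measurableSet_Ioi
  have hx : 0 < x := hx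
  simp only [Real.rpow_one]
  rw [Real.rpow_add hx, Real.rpow_natCast]; ring

lemma lag_integral_pow (α : ℝ) (hα : α > -1) (k : ℕ) :
    ∫ x in Set.Ioi (0 : ℝ), x ^ (2 * α + 1) * Real.exp (-2 * x) * x ^ k =
      (1 / 2) ^ (2 * α + 2 + k) * Real.Gamma (2 * α + 2 + k) := by
  have hk : (k : ℝ) ≥ 0 := by positivity
  rw [← Real.integral_rpow_mul_exp_neg_mul_Ioi (a := 2 * α + 2 + k) (r := 2)
    (by linarith) two_pos]
  refine MeasureTheory.setIntegral_congr_fun measurableSet_Ioi (fun x hx => ?_)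
  have hx : 0 < x := hx
  rw [show 2 * α + 2 + k - 1 = 2 * α + 1 + k by ring, Real.rpow_add hx _ (k : ℝ), Real.rpow_natCast]
  ring_nf

lemma lag_integrable (α : ℝ) (hα : α > -1) (p : Polynomial ℝ) :
    MeasureTheory.IntegrableOn (fun x : ℝ => x ^ (2 * α + 1) * Real.exp (-2 * x) * p.eval x)
      (Set.Ioi 0) := by
  induction p using Polynomial.induction_on' with
  | add p q hp hq =>
    simp only [Polynomial.eval_add, mul_add]
    exact hp.add hq
  | monomial k a =>
    have := (lag_integrable_pow α hα k).const_mul a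
    simp only [Polynomial.eval_monomial]
    refine MeasureTheory.Integrable.congr this (Filter.Eventually.of_forall fun x => ?_)
    ring

/-- The weighted integration functional. -/
noncomputable def lagPhi (α : ℝ) (hα : α > -1) : Polynomial ℝ →ₗ[ℝ] ℝ where
  toFun p := ∫ x in Set.Ioi (0 : ℝ), x ^ (2 * α + 1) * Real.exp (-2 * x) * p.eval x
  map_add' p q := by
    simp only [Polynomial.eval_add, mul_add]
    exact MeasureTheory.integral_add (lag_integrable α hα p) (lag_integrable α hα q)
  map_smul' a p := by
    simp only [Polynomial.eval_smul, smul_eq_mul, RingHom.id_apply]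
    rw [← MeasureTheory.integral_const_mul]
    congr 1
    ext x
    ring

lemma lagPhi_C (α : ℝ) (hα : α > -1) (a : ℝ) (p : Polynomial ℝ) :
    lagPhi α hα (Polynomial.C a * p) = a * lagPhi α hα p := by
  rw [← Polynomial.smul_eq_C_mul, map_smul, smul_eq_mul]

open Polynomial in
lemma lagPhi_X_pow (α : ℝ) (hα : α > -1) (k : ℕ) :
    lagPhi α hα (X ^ k) = (1 / 2) ^ (2 * α + 2 + k) * Real.Gamma (2 * α + 2 + k) := by
  rw [← lag_integral_pow α hα k]
  simp [lagPhi]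

open Polynomial in
lemma lagPhi_ibp (α : ℝ) (hα : α > -1) (p : ℝ[X]) :
    lagPhi α hα (C (2 * α + 2) * p - C 2 * (X * p) + X * derivative p) = 0 := by
  induction p using Polynomial.induction_on' with
  | add p q hp hq =>
    rw [← add_zero (0 : ℝ)]
    nth_rw 1 [← hp]
    rw [← hq, ← map_add]
    congr 1
    simp only [derivative_add]
    ring
  | monomial k a =>
    have hk : (k : ℝ) ≥ 0 := by positivity
    have e : C (2 * α + 2) * monomial k a - C 2 * (X * monomial k a) + X * derivative (monomial k a)
        = C (a * (2 * α + 2 + k)) * X ^ k - C (2 * a) * X ^ (k + 1) := by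
      rw [← C_mul_X_pow_eq_monomial, derivative_C_mul_X_pow]
      cases k with
      | zero => simp; ring
      | succ k => simp; ring
    rw [e, map_sub, lagPhi_C, lagPhi_C, lagPhi_X_pow, lagPhi_X_pow]
    rw [show 2 * α + 2 + ((k + 1 : ℕ) : ℝ) = (2 * α + 2 + k) + 1 by push_cast; ring,
      Real.Gamma_add_one (by linarith), Real.rpow_add (z := 1) (by norm_num), Real.rpow_one]
    ring

section
open Polynomial

lemma lag_i (α : ℝ) (hα : α > -1) (m : ℕ) :
    ((m : ℝ) + 1) * lagPhi α hα (lagPoly α (m + 1) * lagPoly α m) =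
      m * lagPhi α hα (lagPoly α m * lagPoly α m) := by
  have h := lagPhi_ibp α hα (lagPoly α m * lagPoly α m)
  have R2 := lag_R2 α hα m
  have e : C (2 * α + 2) * (lagPoly α m * lagPoly α m) - C 2 * (X * (lagPoly α m * lagPoly α m))
      + X * derivative (lagPoly α m * lagPoly α m) =
      C (-2 * (m : ℝ)) * (lagPoly α m * lagPoly α m)
        + C (2 * ((m : ℝ) + 1)) * (lagPoly α (m + 1) * lagPoly α m) := by
    simp only [derivative_mul, map_add, map_mul, map_neg, map_one] at R2 ⊢
    have : (C 2 : ℝ[X]) = 2 := rfl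
    rw [this]
    linear_combination 2 * lagPoly α m * R2
  rw [e, map_add, lagPhi_C, lagPhi_C] at h
  linarith

lemma lag_ii (α : ℝ) (hα : α > -1) (m : ℕ) :
    ((m : ℝ) + 2) * lagPhi α hα (lagPoly α (m + 2) * lagPoly α m) =
      (2 * m + 1) * lagPhi α hα (lagPoly α (m + 1) * lagPoly α m)
        - (m + 1) * lagPhi α hα (lagPoly α (m + 1) * lagPoly α (m + 1)) := by
  have h := lagPhi_ibp α hα (lagPoly α (m + 1) * lagPoly α m)
  have R2 := lag_R2 α hα m
  have R2' := lag_R2 α hα (m + 1)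
  have e : C (2 * α + 2) * (lagPoly α (m + 1) * lagPoly α m)
      - C 2 * (X * (lagPoly α (m + 1) * lagPoly α m))
      + X * derivative (lagPoly α (m + 1) * lagPoly α m) =
      C (-(2 * (m : ℝ) + 1)) * (lagPoly α (m + 1) * lagPoly α m)
        + C ((m : ℝ) + 1) * (lagPoly α (m + 1) * lagPoly α (m + 1))
        + C ((m : ℝ) + 2) * (lagPoly α (m + 2) * lagPoly α m) := by
    push_cast at R2'
    simp only [derivative_mul, map_add, map_mul, map_neg, map_one] at R2 R2' ⊢
    have : (C 2 : ℝ[X]) = 2 := rfl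
    rw [this]
    linear_combination lagPoly α (m + 1) * R2 + lagPoly α m * R2'
  rw [e, map_add, map_add, lagPhi_C, lagPhi_C, lagPhi_C] at h
  linarith

lemma lag_iii (α : ℝ) (hα : α > -1) (m : ℕ) :
    ((m : ℝ) + 1 + α) * lagPhi α hα (lagPoly α (m + 2) * lagPoly α m) =
      (2 * m + 1) * lagPhi α hα (lagPoly α (m + 2) * lagPoly α (m + 1))
        + (m + 2 + α) * lagPhi α hα (lagPoly α (m + 1) * lagPoly α (m + 1))
        - 2 * (m + 2) * lagPhi α hα (lagPoly α (m + 2) * lagPoly α (m + 2)) := by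
  have h := lagPhi_ibp α hα (lagPoly α (m + 2) * lagPoly α (m + 1))
  have R1 := lag_R1 α hα m
  have R1' := lag_R1 α hα (m + 1)
  have R2' := lag_R2 α hα (m + 1)
  have e : C (2 * α + 2) * (lagPoly α (m + 2) * lagPoly α (m + 1))
      - C 2 * (X * (lagPoly α (m + 2) * lagPoly α (m + 1)))
      + X * derivative (lagPoly α (m + 2) * lagPoly α (m + 1)) =
      C (-(2 * (m : ℝ) + 1)) * (lagPoly α (m + 2) * lagPoly α (m + 1))
        + C (-((m : ℝ) + 2 + α)) * (lagPoly α (m + 1) * lagPoly α (m + 1))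
        + C (2 * ((m : ℝ) + 2)) * (lagPoly α (m + 2) * lagPoly α (m + 2))
        + C ((m : ℝ) + 1 + α) * (lagPoly α (m + 2) * lagPoly α m) := by
    push_cast at R2' R1'
    simp only [derivative_mul, map_add, map_mul, map_neg, map_one] at R1 R1' R2' ⊢
    have : (C 2 : ℝ[X]) = 2 := rfl
    rw [this]
    linear_combination lagPoly α (m + 1) * R1' + 2 * lagPoly α (m + 2) * R2' -
      lagPoly α (m + 2) * R1
  rw [e, map_add, map_add, map_add, lagPhi_C, lagPhi_C, lagPhi_C, lagPhi_C] at h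
  linarith

lemma lag_zero (α : ℝ) (hα : α > -1) : lagPoly α 0 = 1 := by
  have := (gam_pos α hα 0).ne'
  simp only [CharP.cast_eq_zero, zero_add] at this
  simp [lagPoly, this]

lemma lag_base (α : ℝ) (hα : α > -1) :
    2 * lagPhi α hα (lagPoly α 1 * lagPoly α 1) =
      (1 + α) * lagPhi α hα (lagPoly α 0 * lagPoly α 0) := by
  have h := lagPhi_ibp α hα (lagPoly α 1 * lagPoly α 0)
  have i := lag_i α hα 0
  have R1 := lag_R1 α hα 0
  have R2 := lag_R2 α hα 0
  have e : C (2 * α + 2) * (lagPoly α 1 * lagPoly α 0)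
      - C 2 * (X * (lagPoly α 1 * lagPoly α 0))
      + X * derivative (lagPoly α 1 * lagPoly α 0) =
      C 1 * (lagPoly α 1 * lagPoly α 0)
        + C (-(1 + α)) * (lagPoly α 0 * lagPoly α 0)
        + C 2 * (lagPoly α 1 * lagPoly α 1) := by
    have d0 : derivative (lagPoly α 0) = 0 := by rw [lag_zero α hα]; simp
    simp only [derivative_mul, map_add, map_mul, map_neg, map_one, zero_add, d0,
      CharP.cast_eq_zero, map_zero, mul_zero] at R1 R2 ⊢
    have : (C 2 : ℝ[X]) = 2 := rfl
    rw [this]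
    linear_combination lagPoly α 0 * R1 + 2 * lagPoly α 1 * R2
  rw [e, map_add, map_add, lagPhi_C, lagPhi_C, lagPhi_C] at h
  simp only [CharP.cast_eq_zero, zero_mul, zero_add, one_mul] at i
  rw [i] at h
  linarith

lemma lag_rec (α : ℝ) (hα : α > -1) (m : ℕ) :
    ((m : ℝ) + 1) ^ 2 * lagPhi α hα (lagPoly α (m + 1) * lagPoly α (m + 1)) =
      (m + 1 + α) * (m + 1 / 2) * lagPhi α hα (lagPoly α m * lagPoly α m) := by
  induction m with
  | zero =>
    have := lag_base α hα
    simp only [CharP.cast_eq_zero, zero_add]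
    linarith
  | succ m ih =>
    have i0 := lag_i α hα m
    have i1 := lag_i α hα (m + 1)
    have h2 := lag_ii α hα m
    have h3 := lag_iii α hα m
    push_cast at i1 ⊢
    rw [show m + 1 + 1 = m + 2 from rfl] at *
    generalize lagPhi α hα (lagPoly α (m + 2) * lagPoly α (m + 2)) = A2 at *
    generalize lagPhi α hα (lagPoly α (m + 1) * lagPoly α (m + 1)) = A1 at *
    generalize lagPhi α hα (lagPoly α m * lagPoly α m) = A0 at *
    generalize lagPhi α hα (lagPoly α (m + 2) * lagPoly α m) = C0 at *
    generalize lagPhi α hα (lagPoly α (m + 2) * lagPoly α (m + 1)) = B1 at *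
    generalize lagPhi α hα (lagPoly α (m + 1) * lagPoly α m) = B0 at *
    have ht : (m : ℝ) + 1 ≠ 0 := by positivity
    generalize (m : ℝ) = t at *
    apply mul_left_cancel₀ ht
    linear_combination (t + 1) * (t + 2) / 2 * h3 - (t + 1) * (t + 1 + α) / 2 * h2 +
      (2 * t + 1) * (t + 1) / 2 * i1 - (t + 1 + α) * (2 * t + 1) / 2 * i0 + t * ih

end

/-- `∫_0^∞ x^{2α+1} e^{-2x} L_n^{(α)}(x)² dx
      = Γ(n+α+1) Γ(n+1/2) Γ(α+3/2) / (2π Γ(n+1)²)`. -/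
theorem integral_laguerre_sq_weighted (α : ℝ) (hα : α > -1) (n : ℕ) :
    ∫ x in Set.Ioi (0 : ℝ), x ^ (2 * α + 1) * Real.exp (-2 * x) * assocLaguerre α n x ^ 2
      = Real.Gamma ((n : ℝ) + α + 1) * Real.Gamma ((n : ℝ) + 1 / 2) *
          Real.Gamma (α + 3 / 2) / (2 * Real.pi * Real.Gamma ((n : ℝ) + 1) ^ 2) := by
  have key : ∫ x in Set.Ioi (0 : ℝ), x ^ (2 * α + 1) * Real.exp (-2 * x) * assocLaguerre α n x ^ 2
      = lagPhi α hα (lagPoly α n * lagPoly α n) := by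
    simp [lagPhi, lagPoly_eval, sq]
  rw [key]
  clear key
  induction n with
  | zero =>
    rw [lag_zero α hα, mul_one, ← pow_zero Polynomial.X, lagPhi_X_pow]
    have d := Real.Gamma_mul_Gamma_add_half_of_pos (show 0 < α + 1 by linarith)
    have hp : √Real.pi * √Real.pi = Real.pi := Real.mul_self_sqrt Real.pi_pos.le
    simp only [CharP.cast_eq_zero, zero_add, add_zero, Real.Gamma_one]
    rw [Real.Gamma_one_half_eq, mul_right_comm, show α + 3 / 2 = α + 1 + 1 / 2 by ring, d,
      show 2 * α + 2 = 2 * (α + 1) by ring, Real.rpow_sub two_pos, one_div,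
      Real.inv_rpow two_pos.le, Real.rpow_one]
    have := Real.pi_pos.ne'
    have : (2 : ℝ) ^ (2 * (α + 1)) ≠ 0 := by positivity
    field_simp
    linear_combination -Real.Gamma (2 * (α + 1)) * hp
  | succ n ih =>
    have h := lag_rec α hα n
    have hn : (n : ℝ) ≥ 0 := by positivity
    rw [ih] at h
    have g1 := gam_succ α hα n
    have g2 : Real.Gamma (((n + 1 : ℕ) : ℝ) + 1) = (n + 1) * Real.Gamma (n + 1) := by
      push_cast
      exact Real.Gamma_add_one (by linarith)
    have g3 : Real.Gamma (((n + 1 : ℕ) : ℝ) + 1 / 2) = (n + 1 / 2) * Real.Gamma (n + 1 / 2) := by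
      rw [← Real.Gamma_add_one (by linarith)]
      push_cast
      ring_nf
    rw [g1, g2, g3]
    have g := (Real.Gamma_pos_of_pos (show (0 : ℝ) < n + 1 by linarith)).ne'
    have := Real.pi_pos.ne'
    apply mul_left_cancel₀ (show ((n : ℝ) + 1) ^ 2 ≠ 0 by positivity)
    rw [h]
    field_simp
    ring
end
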